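/- Consider the linear hyperbolic system ∂_t u + a(x,t)∂_x u + b(x,t)u = f(x,t) on (0,1)×ℝ with the reflection boundary conditions, where a, b have bounded continuous partial derivatives up to second order on [0,1]×ℝ, a satisfies the Λ₀-condition, and (H3) holds; let {U(t,s)}_{t≥s} be the evolution family on L²((0,1);ℝⁿ) generated by the homogeneous problem and let d > 0 be its smoothing time constant. Then there exists L > 0, depending on d but not on the initial time s, the initial datum φ ∈ L²((0,1);ℝⁿ), or f, such that for every s ∈ ℝ and φ ∈ L²((0,1);ℝⁿ), the mild solution u(t) = U(t,s)φ + ∫_s^t U(t,r) f(·,r) dr of the nonhomogeneous problem satisfies: (i) if f has bounded continuous partial derivatives up to first order, then for every t ∈ [s+2d, s+3d], u(t) has a C¹([0,1];ℝⁿ) representative with ‖u(·,t)‖_{C¹} ≤ L(‖φ‖_{L²} + ‖f‖_{BC¹}); and (ii) if f has bounded continuous partial derivatives up to second order, then u(s+3d) has a C²([0,1];ℝⁿ) representative with ‖u(·,s+3d)‖_{C²} ≤ L(‖φ‖_{L²} + ‖f‖_{BC²}). -/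

import Mathlib

noncomputable section

open MeasureTheory Set Filter

/-- `ℝⁿ` with the Euclidean norm. -/
abbrev Vn (n : ℕ) : Type := EuclideanSpace ℝ (Fin n)

/-- The strip `[0,1] × ℝ`. -/
def strip : Set (ℝ × ℝ) := Set.Icc (0:ℝ) 1 ×ˢ (Set.univ : Set ℝ)

/-- `g` is `C^k` on the strip `[0,1] × ℝ` with the function and all its partial
derivatives up to order `k` bounded by `C` there (the `BC^k`-norm is `≤ C`). -/
def BCle (k : ℕ) (g : ℝ → ℝ → ℝ) (C : ℝ) : Prop :=
  ContDiffOn ℝ k (fun q : ℝ × ℝ => g q.1 q.2) strip ∧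
  ∀ i : ℕ, i ≤ k → ∀ q ∈ strip,
    ‖iteratedFDerivWithin ℝ i (fun q : ℝ × ℝ => g q.1 q.2) strip q‖ ≤ C

/-- The reflection boundary conditions relating the boundary values
`w0 = u(0,t)` and `w1 = u(1,t)`. -/
def BCrel (n m : ℕ) (p : Fin n → Fin n → ℝ) (w0 w1 : Vn n) : Prop :=
  ∀ j : Fin n,
    ((j : ℕ) < m →
      w0 j = ∑ k : Fin n, if m ≤ (k : ℕ) then p j k * w0 k else p j k * w1 k) ∧
    (m ≤ (j : ℕ) →
      w1 j = ∑ k : Fin n, if m ≤ (k : ℕ) then p j k * w0 k else p j k * w1 k)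

/-- Assumption (H3). -/
def H3cond (n : ℕ) (p : Fin n → Fin n → ℝ) : Prop :=
  ∀ i : Fin (n + 1) → Fin n, ∏ l : Fin n, p (i l.castSucc) (i l.succ) = 0

/-- The `Λ₀`-condition on the diagonal coefficients `a`. -/
def LamCond (n m : ℕ) (Λ₀ : ℝ) (a : ℝ → ℝ → Fin n → ℝ) : Prop :=
  ∀ x ∈ Set.Icc (0:ℝ) 1, ∀ t : ℝ,
    (∀ j : Fin n, ((j : ℕ) < m → Λ₀ ≤ a x t j) ∧ (m ≤ (j : ℕ) → a x t j ≤ -Λ₀)) ∧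
    ∀ j k : Fin n, j ≠ k → Λ₀ ≤ |a x t j - a x t k|

/-- A classical solution `u` (with partial derivatives `ux`, `ut`) of the linear
problem `∂ₜu + a ∂ₓu + b u = f` on `[0,1] × [s,∞)` with the reflection boundary
conditions and initial datum `φ` at time `s`. -/
def IsLinSol (n m : ℕ) (p : Fin n → Fin n → ℝ)
    (a : ℝ → ℝ → Fin n → ℝ) (b : ℝ → ℝ → Fin n → Fin n → ℝ)
    (f : ℝ → ℝ → Fin n → ℝ) (s : ℝ) (φ : ℝ → Vn n)
    (u ux ut : ℝ → ℝ → Vn n) : Prop :=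
  ContinuousOn (fun q : ℝ × ℝ => u q.1 q.2) (Set.Icc 0 1 ×ˢ Set.Ici s) ∧
  ContinuousOn (fun q : ℝ × ℝ => ux q.1 q.2) (Set.Icc 0 1 ×ˢ Set.Ici s) ∧
  ContinuousOn (fun q : ℝ × ℝ => ut q.1 q.2) (Set.Icc 0 1 ×ˢ Set.Ici s) ∧
  (∀ x ∈ Set.Icc (0:ℝ) 1, ∀ t ∈ Set.Ici s, ∀ j : Fin n,
    HasDerivWithinAt (fun y => u y t j) (ux x t j) (Set.Icc 0 1) x ∧
    HasDerivWithinAt (fun τ => u x τ j) (ut x t j) (Set.Ici s) t) ∧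
  (∀ x ∈ Set.Icc (0:ℝ) 1, ∀ t ∈ Set.Ici s, ∀ j : Fin n,
    ut x t j + a x t j * ux x t j + ∑ k : Fin n, b x t j k * u x t k = f x t j) ∧
  (∀ t ∈ Set.Ici s, BCrel n m p (u 0 t) (u 1 t)) ∧
  (∀ x ∈ Set.Icc (0:ℝ) 1, u x s = φ x)

/-- Lebesgue measure restricted to `(0,1)`. -/
abbrev μ01 : Measure ℝ := volume.restrict (Set.Ioo (0:ℝ) 1)

/-- The space `L²((0,1); ℝⁿ)`. -/
abbrev L2 (n : ℕ) := Lp (Vn n) 2 μ01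

/-- An evolution family of bounded linear operators. -/
def IsEvoFam {X : Type*} [NormedAddCommGroup X] [NormedSpace ℝ X]
    (U : ℝ → ℝ → X →L[ℝ] X) : Prop :=
  (∀ t : ℝ, U t t = ContinuousLinearMap.id ℝ X) ∧
  (∀ s r t : ℝ, s ≤ r → r ≤ t → ∀ x : X, U t r (U r s x) = U t s x)

/-- `U` is the evolution family on `L²((0,1);ℝⁿ)` generated by the linear
problem with coefficients `a`, `b`: it is a strongly continuous, exponentially
bounded evolution family which, on `C¹` data with compact support in `(0,1)`,
is given by the classical solutions. -/
def GeneratedBy (n m : ℕ) (p : Fin n → Fin n → ℝ)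
    (a : ℝ → ℝ → Fin n → ℝ) (b : ℝ → ℝ → Fin n → Fin n → ℝ)
    (U : ℝ → ℝ → L2 n →L[ℝ] L2 n) : Prop :=
  IsEvoFam U ∧
  (∀ φ : L2 n, ContinuousOn (fun q : ℝ × ℝ => U q.1 q.2 φ) {q : ℝ × ℝ | q.2 ≤ q.1}) ∧
  (∃ K : ℝ, 1 ≤ K ∧ ∃ ν : ℝ, ∀ s t : ℝ, s ≤ t →
    ‖U t s‖ ≤ K * Real.exp (ν * (t - s))) ∧
  ∀ s : ℝ, ∀ φ : ℝ → Vn n, ContDiff ℝ 1 φ → tsupport φ ⊆ Set.Ioo 0 1 →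
    ∀ φh : L2 n, (∀ᵐ x ∂μ01, φh x = φ x) →
    ∀ u ux ut : ℝ → ℝ → Vn n,
      IsLinSol n m p a b (fun _ _ _ => 0) s φ u ux ut →
      ∀ t : ℝ, s ≤ t → ∀ᵐ x ∂μ01, (U t s φh) x = u x t

/-- Exponential dichotomy on `ℝ` with exponent `α` and bound `M`. -/
def HasExpDichotomy {X : Type*} [NormedAddCommGroup X] [NormedSpace ℝ X]
    (U : ℝ → ℝ → X →L[ℝ] X) (α M : ℝ) : Prop :=
  ∃ P : ℝ → X →L[ℝ] X, ∃ W : ℝ → ℝ → X →L[ℝ] X,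
    (∀ t, (P t).comp (P t) = P t) ∧
    (∀ x : X, Continuous fun t => P t x) ∧
    (∀ x : X, ∃ C : ℝ, ∀ t, ‖P t x‖ ≤ C) ∧
    (∀ s t : ℝ, s ≤ t → (U t s).comp (P s) = (P t).comp (U t s)) ∧
    (∀ s t : ℝ, s ≤ t → ∀ x : X, W s t (U t s (x - P s x)) = x - P s x) ∧
    (∀ s t : ℝ, s ≤ t → ∀ x : X, U t s (W s t (x - P t x)) = x - P t x) ∧
    (∀ s t : ℝ, s ≤ t → ∀ x : X, P s (W s t (x - P t x)) = 0) ∧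
    (∀ s t : ℝ, s ≤ t → ‖(U t s).comp (P s)‖ ≤ M * Real.exp (-α * (t - s))) ∧
    (∀ s t : ℝ, s ≤ t →
      ‖(W s t).comp (ContinuousLinearMap.id ℝ X - P t)‖ ≤ M * Real.exp (-α * (t - s)))


section Part1
/-- A bounded speed, `C¹` in the second variable with bounded derivative. -/
structure Spd (α αt : ℝ → ℝ → ℝ) (A : ℝ) : Prop where
  ca : Continuous (fun q : ℝ × ℝ => α q.1 q.2)
  cat : Continuous (fun q : ℝ × ℝ => αt q.1 q.2)
  der : ∀ x t, HasDerivAt (α x) (αt x t) t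
  bd : ∀ x t, |α x t| ≤ A
  bdt : ∀ x t, |αt x t| ≤ A

namespace Spd
variable {α αt : ℝ → ℝ → ℝ} {A : ℝ}

lemma A0 (h : Spd α αt A) : 0 ≤ A := (abs_nonneg _).trans (h.bd 0 0)

lemma lip (h : Spd α αt A) (x : ℝ) : LipschitzWith A.toNNReal (α x) := by
  apply lipschitzWith_of_nnnorm_deriv_le (fun t => (h.der x t).differentiableAt)
  intro t
  rw [(h.der x t).deriv, ← NNReal.coe_le_coe, Real.coe_toNNReal _ h.A0]
  simpa using h.bdt x t

lemma exists_local (h : Spd α αt A) (x0 t0 : ℝ) (N : ℕ) :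
    ∃ y : ℝ → ℝ, y x0 = t0 ∧ ∀ ξ ∈ Ioo (x0 - (N + 1)) (x0 + (N + 1)),
      HasDerivAt y (α ξ (y ξ)) ξ := by
  have hN : (0:ℝ) < N + 1 := by positivity
  let tt : Icc (x0 - ((N:ℝ) + 1)) (x0 + (N + 1)) := ⟨x0, by constructor <;> linarith⟩
  have hp : IsPicardLindelof α tt t0
      (A.toNNReal * Real.toNNReal ((N:ℝ) + 1)) 0 A.toNNReal A.toNNReal := by
    constructor
    · intro t _; exact (h.lip t).lipschitzOnWith
    · intro x _
      exact (h.ca.comp (by fun_prop : Continuous fun ξ : ℝ => (ξ, x))).continuousOn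
    · intro t _ x _; rw [Real.coe_toNNReal _ h.A0]; exact h.bd t x
    · simp only [tt, NNReal.coe_mul, NNReal.coe_zero, sub_zero, Real.coe_toNNReal _ h.A0,
        Real.coe_toNNReal _ hN.le]
      simp
  obtain ⟨y, hy, hd⟩ := hp.exists_eq_forall_mem_Icc_hasDerivWithinAt₀
  refine ⟨y, hy, fun ξ hξ => ?_⟩
  exact (hd ξ (Ioo_subset_Icc_self hξ)).hasDerivAt (Icc_mem_nhds hξ.1 hξ.2)

lemma exists_global (h : Spd α αt A) (x0 t0 : ℝ) :
    ∃ y : ℝ → ℝ, y x0 = t0 ∧ ∀ ξ, HasDerivAt y (α ξ (y ξ)) ξ := by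
  choose y hy hd using h.exists_local x0 t0
  have hu : ∀ N M : ℕ, N ≤ M → EqOn (y N) (y M) (Ioo (x0 - (N + 1)) (x0 + (N + 1))) := by
    intro N M hNM
    have hNM' : (N:ℝ) ≤ M := by exact_mod_cast hNM
    have hN : (0:ℝ) < N + 1 := by positivity
    refine ODE_solution_unique_of_mem_Ioo (v := α) (K := A.toNNReal) (s := fun _ => univ) (t₀ := x0)
      (fun t _ => (h.lip t).lipschitzOnWith) (by constructor <;> linarith)
      (fun t ht => ⟨hd N t ht, trivial⟩) (fun t ht => ⟨hd M t ?_, trivial⟩) ?_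
    · constructor <;> linarith [ht.1, ht.2]
    · rw [hy, hy]
  let k : ℝ → ℕ := fun ξ => ⌈|ξ - x0|⌉₊
  have hk : ∀ ξ, |ξ - x0| ≤ k ξ := fun ξ => Nat.le_ceil _
  refine ⟨fun ξ => y (k ξ) ξ, hy _, fun ξ => ?_⟩
  have h1 : ξ ∈ Ioo (x0 - ((k ξ:ℝ) + 1)) (x0 + (k ξ + 1)) := by
    have := abs_le.1 (hk ξ)
    constructor <;> linarith
  refine (hd (k ξ) ξ h1).congr_of_eventuallyEq ?_
  filter_upwards [Ioo_mem_nhds h1.1 h1.2] with ζ hζ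
  have h2 : ζ ∈ Ioo (x0 - ((k ζ:ℝ) + 1)) (x0 + (k ζ + 1)) := by
    have := abs_le.1 (hk ζ)
    constructor <;> linarith
  rcases le_total (k ξ) (k ζ) with hh | hh
  · exact (hu _ _ hh hζ).symm
  · exact hu _ _ hh h2

/-- the characteristic through `(x,t)`, evaluated at `ξ`. -/
def tau (h : Spd α αt A) (ξ x t : ℝ) : ℝ := (h.exists_global x t).choose ξ

lemma tau_self (h : Spd α αt A) (x t : ℝ) : h.tau x x t = t :=
  (h.exists_global x t).choose_spec.1

lemma tau_der (h : Spd α αt A) (ξ x t : ℝ) :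
    HasDerivAt (fun ξ => h.tau ξ x t) (α ξ (h.tau ξ x t)) ξ :=
  (h.exists_global x t).choose_spec.2 ξ

/-- averaged slope -/
def kap (αt : ℝ → ℝ → ℝ) (η u v : ℝ) : ℝ := ∫ θ in (0:ℝ)..1, αt η (v + θ * (u - v))

lemma kap_self (η u : ℝ) : kap αt η u u = αt η u := by simp [kap]

lemma kap_cont (h : Spd α αt A) :
    Continuous (fun q : ℝ × ℝ × ℝ => kap αt q.1 q.2.1 q.2.2) := by
  unfold kap
  apply intervalIntegral.continuous_parametric_intervalIntegral_of_continuous' 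
  exact h.cat.comp (by fun_prop : Continuous fun z : (ℝ × ℝ × ℝ) × ℝ =>
    (z.1.1, z.1.2.2 + z.2 * (z.1.2.1 - z.1.2.2)))

lemma kap_bd (h : Spd α αt A) (η u v : ℝ) : |kap αt η u v| ≤ A := by
  have := intervalIntegral.norm_integral_le_of_norm_le_const (a := 0) (b := 1) (C := A)
    (f := fun θ => αt η (v + θ * (u - v))) (fun θ _ => h.bdt _ _)
  simpa [kap] using this

lemma kap_eq (h : Spd α αt A) (η u v : ℝ) : α η u - α η v = kap αt η u v * (u - v) := by
  have h1 : ∀ θ ∈ uIcc (0:ℝ) 1, HasDerivAt (fun θ => α η (v + θ * (u - v)))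
      (αt η (v + θ * (u - v)) * (u - v)) θ := by
    intro θ _
    have : HasDerivAt (fun θ : ℝ => v + θ * (u - v)) (u - v) θ := by
      simpa using ((hasDerivAt_id θ).mul_const (u - v)).const_add v
    exact (h.der η _).comp θ this
  have h2 := intervalIntegral.integral_eq_sub_of_hasDerivAt h1 (by
    apply Continuous.intervalIntegrable
    have := h.cat.comp (by fun_prop : Continuous fun θ : ℝ => (η, v + θ * (u - v)))
    exact this.mul continuous_const)
  rw [intervalIntegral.integral_mul_const] at h2
  simp only [kap]
  rw [h2]; simp

lemma diff_formula (h : Spd α αt A) {y z : ℝ → ℝ}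
    (hy : ∀ ξ, HasDerivAt y (α ξ (y ξ)) ξ) (hz : ∀ ξ, HasDerivAt z (α ξ (z ξ)) ξ) (x ξ : ℝ) :
    y ξ - z ξ = (y x - z x) * Real.exp (∫ η in x..ξ, kap αt η (y η) (z η)) := by
  have cy : Continuous y := continuous_iff_continuousAt.2 fun ξ => (hy ξ).continuousAt
  have cz : Continuous z := continuous_iff_continuousAt.2 fun ξ => (hz ξ).continuousAt
  have ck : Continuous fun η => kap αt η (y η) (z η) :=
    h.kap_cont.comp (by fun_prop : Continuous fun η => (η, y η, z η))
  have hI : ∀ ξ, HasDerivAt (fun ξ => ∫ η in x..ξ, kap αt η (y η) (z η)) (kap αt ξ (y ξ) (z ξ)) ξ :=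
    fun ξ => ck.integral_hasStrictDerivAt x ξ |>.hasDerivAt
  have hD : ∀ ξ, HasDerivAt (fun ξ => (y ξ - z ξ) *
      Real.exp (-∫ η in x..ξ, kap αt η (y η) (z η))) 0 ξ := by
    intro ξ
    refine (((hy ξ).sub (hz ξ)).mul ((hI ξ).neg.exp)).congr_deriv ?_
    rw [h.kap_eq]; simp only [Pi.sub_apply, Pi.neg_apply]; ring
  have hc := is_const_of_deriv_eq_zero (fun ξ => (hD ξ).differentiableAt) (fun ξ => (hD ξ).deriv) ξ x
  simp only [intervalIntegral.integral_same, neg_zero, Real.exp_zero, mul_one] at hc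
  rw [← hc, mul_assoc, ← Real.exp_add]; simp

lemma int_bd (h : Spd α αt A) (y z : ℝ → ℝ) (x ξ : ℝ) :
    |∫ η in x..ξ, kap αt η (y η) (z η)| ≤ A * |ξ - x| :=
  intervalIntegral.norm_integral_le_of_norm_le_const
    (f := fun η => kap αt η (y η) (z η)) (fun η _ => h.kap_bd _ _ _)

lemma unique (h : Spd α αt A) {y z : ℝ → ℝ}
    (hy : ∀ ξ, HasDerivAt y (α ξ (y ξ)) ξ) (hz : ∀ ξ, HasDerivAt z (α ξ (z ξ)) ξ) (x : ℝ)
    (hx : y x = z x) (ξ : ℝ) : y ξ = z ξ := by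
  have := h.diff_formula hy hz x ξ
  rw [hx, sub_self, zero_mul] at this
  linarith

lemma tau_group (h : Spd α αt A) (η ξ x t : ℝ) :
    h.tau η ξ (h.tau ξ x t) = h.tau η x t :=
  h.unique (fun ζ => h.tau_der ζ _ _) (fun ζ => h.tau_der ζ x t) ξ (h.tau_self _ _) η

lemma tau_lip (h : Spd α αt A) (ξ ξ' x t : ℝ) : |h.tau ξ x t - h.tau ξ' x t| ≤ A * |ξ - ξ'| := by
  have : LipschitzWith A.toNNReal (fun ξ => h.tau ξ x t) := by
    apply lipschitzWith_of_nnnorm_deriv_le (fun ζ => (h.tau_der ζ x t).differentiableAt)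
    intro ζ
    rw [(h.tau_der ζ x t).deriv, ← NNReal.coe_le_coe, Real.coe_toNNReal _ h.A0]
    simpa using h.bd _ _
  simpa [Real.dist_eq, h.A0] using this.dist_le_mul ξ ξ'

lemma tau_cont (h : Spd α αt A) :
    Continuous (fun q : ℝ × ℝ × ℝ => h.tau q.1 q.2.1 q.2.2) := by
  rw [continuous_iff_continuousAt]
  rintro ⟨ξ0, x0, t0⟩
  have key : ∀ q : ℝ × ℝ × ℝ, |h.tau q.1 q.2.1 q.2.2 - h.tau ξ0 x0 t0| ≤
      (A * |x0 - q.2.1| + |q.2.2 - t0|) * Real.exp (A * |q.1 - x0|) + A * |q.1 - ξ0| := by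
    rintro ⟨ξ, x, t⟩
    have h1 := h.diff_formula (fun ζ => h.tau_der ζ x t) (fun ζ => h.tau_der ζ x0 t0) x0 ξ
    have h2 : |h.tau ξ x t - h.tau ξ x0 t0| ≤
        (A * |x0 - x| + |t - t0|) * Real.exp (A * |ξ - x0|) := by
      rw [h1, abs_mul, Real.abs_exp]
      have hA := h.A0
      gcongr
      · rw [h.tau_self]
        have := h.tau_lip x0 x x t
        rw [h.tau_self] at this
        calc |h.tau x0 x t - t0| = |(h.tau x0 x t - t) + (t - t0)| := by ring_nf
          _ ≤ _ := abs_add_le _ _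
          _ ≤ _ := by linarith
      · exact (le_abs_self _).trans (h.int_bd _ _ _ _)
    have h3 := h.tau_lip ξ ξ0 x0 t0
    calc |h.tau ξ x t - h.tau ξ0 x0 t0|
        = |(h.tau ξ x t - h.tau ξ x0 t0) + (h.tau ξ x0 t0 - h.tau ξ0 x0 t0)| := by ring_nf
      _ ≤ _ := abs_add_le _ _
      _ ≤ _ := by linarith
  rw [ContinuousAt, tendsto_iff_dist_tendsto_zero]
  refine squeeze_zero (fun _ => dist_nonneg) key ?_
  have : Continuous fun q : ℝ × ℝ × ℝ =>
    (A * |x0 - q.2.1| + |q.2.2 - t0|) * Real.exp (A * |q.1 - x0|) + A * |q.1 - ξ0| := by fun_prop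
  have := this.tendsto (ξ0, x0, t0)
  simpa using this

@[fun_prop]
lemma tau_cont' (h : Spd α αt A) {X : Type*} [TopologicalSpace X] {f g k : X → ℝ}
    (hf : Continuous f) (hg : Continuous g) (hk : Continuous k) :
    Continuous (fun x => h.tau (f x) (g x) (k x)) :=
  h.tau_cont.comp (hf.prodMk (hg.prodMk hk))

/-- derivative of the flow w.r.t. `t` -/
def sig (h : Spd α αt A) (ξ x t : ℝ) : ℝ := Real.exp (∫ η in x..ξ, αt η (h.tau η x t))

lemma tau_der_t (h : Spd α αt A) (ξ x t : ℝ) :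
    HasDerivAt (fun t => h.tau ξ x t) (h.sig ξ x t) t := by
  have hf : ∀ s, h.tau ξ x s - h.tau ξ x t = (s - t) *
      Real.exp (∫ η in x..ξ, kap αt η (h.tau η x s) (h.tau η x t)) := by
    intro s
    have := h.diff_formula (fun ζ => h.tau_der ζ x s) (fun ζ => h.tau_der ζ x t) x ξ
    rwa [h.tau_self, h.tau_self] at this
  have hc : Continuous fun s => Real.exp (∫ η in x..ξ, kap αt η (h.tau η x s) (h.tau η x t)) := by
    apply Real.continuous_exp.comp
    apply intervalIntegral.continuous_parametric_intervalIntegral_of_continuous'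
    exact h.kap_cont.comp (f := fun z : ℝ × ℝ => (z.2, h.tau z.2 x z.1, h.tau z.2 x t))
      (by fun_prop)
  rw [hasDerivAt_iff_tendsto_slope]
  have h0 := (hc.tendsto t).mono_left (nhdsWithin_le_nhds (s := {t}ᶜ))
  simp only [kap_self] at h0
  refine h0.congr' ?_
  filter_upwards [self_mem_nhdsWithin] with s hs
  have : s - t ≠ 0 := sub_ne_zero.2 hs
  rw [slope_def_field, hf s]
  field_simp

lemma sig_cont (h : Spd α αt A) {X : Type*} [TopologicalSpace X] {f g k : X → ℝ}
    (hf : Continuous f) (hg : Continuous g) (hk : Continuous k) :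
    Continuous (fun x => h.sig (f x) (g x) (k x)) := by
  unfold sig
  apply Real.continuous_exp.comp
  have h1 : Continuous fun q : ℝ × ℝ × ℝ => ∫ η in (0:ℝ)..q.1, αt η (h.tau η q.2.1 q.2.2) := by
    apply intervalIntegral.continuous_parametric_intervalIntegral_of_continuous
      (f := fun (q : ℝ × ℝ × ℝ) η => αt η (h.tau η q.2.1 q.2.2)) _ continuous_fst
    exact h.cat.comp (f := fun z : (ℝ × ℝ × ℝ) × ℝ => (z.2, h.tau z.2 z.1.2.1 z.1.2.2))
      (by fun_prop)
  have h2 : ∀ z, ∫ η in g z..f z, αt η (h.tau η (g z) (k z)) =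
      (∫ η in (0:ℝ)..f z, αt η (h.tau η (g z) (k z))) -
       ∫ η in (0:ℝ)..g z, αt η (h.tau η (g z) (k z)) := by
    intro z
    have cc : Continuous fun η => αt η (h.tau η (g z) (k z)) :=
      h.cat.comp (f := fun η => (η, h.tau η (g z) (k z))) (by fun_prop)
    rw [intervalIntegral.integral_interval_sub_left] <;> exact cc.intervalIntegrable _ _
  simp_rw [h2]
  exact (h1.comp (hf.prodMk (hg.prodMk hk))).sub (h1.comp (hg.prodMk (hg.prodMk hk)))

lemma sig_pos (h : Spd α αt A) (ξ x t : ℝ) : 0 < h.sig ξ x t := Real.exp_pos _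

lemma sig_bd (h : Spd α αt A) {ξ x : ℝ} (t : ℝ) (hξ : 0 ≤ ξ) (hx : ξ ≤ x) (hx1 : x ≤ 1) :
    h.sig ξ x t ≤ Real.exp A := by
  unfold sig
  apply Real.exp_le_exp.2
  refine (le_abs_self _).trans ?_
  have := intervalIntegral.norm_integral_le_of_norm_le_const (a := x) (b := ξ) (C := A)
    (f := fun η => αt η (h.tau η x t)) (fun θ _ => h.bdt _ _)
  rw [Real.norm_eq_abs] at this
  refine this.trans ?_
  have : |ξ - x| ≤ 1 := by rw [abs_le]; constructor <;> linarith
  nlinarith [h.A0]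

lemma tau_le (h : Spd α αt A) {c : ℝ} (hc : ∀ x t, c ≤ α x t) {ξ x : ℝ} (t : ℝ) (hx : ξ ≤ x) :
    h.tau ξ x t ≤ t - c * (x - ξ) := by
  have : MonotoneOn (fun ζ => h.tau ζ x t - c * ζ) univ := by
    apply monotoneOn_of_deriv_nonneg convex_univ
    · have := h.tau_cont' (f := fun ζ : ℝ => ζ) (g := fun _ => x) (k := fun _ => t)
        (by fun_prop) (by fun_prop) (by fun_prop)
      exact (this.sub (by fun_prop)).continuousOn
    · intro ζ _
      exact ((h.tau_der ζ x t).sub ((hasDerivAt_id ζ).const_mul c)).differentiableAt.differentiableWithinAt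
    · intro ζ _
      have hd : HasDerivAt (fun ζ => h.tau ζ x t - c * ζ) (α ζ (h.tau ζ x t) - c * 1) ζ :=
        (h.tau_der ζ x t).sub ((hasDerivAt_id ζ).const_mul c)
      rw [hd.deriv]
      have := hc ζ (h.tau ζ x t); linarith
  have := this (mem_univ ξ) (mem_univ x) hx
  simp only [h.tau_self] at this
  linarith
end Spd

end Part1

section Part2
/-- Joint continuity of a function of two real variables. -/
def C2 (y : ℝ → ℝ → ℝ) : Prop := Continuous fun q : ℝ × ℝ => y q.1 q.2

lemma C2.comp {y : ℝ → ℝ → ℝ} (h : C2 y) {X : Type*} [TopologicalSpace X] {f g : X → ℝ}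
    (hf : Continuous f) (hg : Continuous g) : Continuous fun z => y (f z) (g z) :=
  Continuous.comp (g := fun q : ℝ × ℝ => y q.1 q.2) h (hf.prodMk hg)

lemma hasDerivAt_int {F F' : ℝ → ℝ → ℝ} (hF : C2 F) (hF' : C2 F')
    (hd : ∀ ξ t, HasDerivAt (F ξ) (F' ξ t) t) (a b t : ℝ) :
    HasDerivAt (fun t => ∫ ξ in a..b, F ξ t) (∫ ξ in a..b, F' ξ t) t := by
  have hK : IsCompact (uIcc a b ×ˢ Icc (t - 1) (t + 1)) := isCompact_uIcc.prod isCompact_Icc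
  obtain ⟨C, hC⟩ := hK.exists_bound_of_continuousOn (f := fun q : ℝ × ℝ => F' q.1 q.2)
    (Continuous.continuousOn hF')
  refine (intervalIntegral.hasDerivAt_integral_of_dominated_loc_of_deriv_le
    (F := fun t ξ => F ξ t) (F' := fun t ξ => F' ξ t) (bound := fun _ => C)
    (s := Icc (t - 1) (t + 1)) (Icc_mem_nhds (by linarith) (by linarith)) ?_ ?_ ?_ ?_ ?_ ?_).2
  · exact Eventually.of_forall fun s =>
      (hF.comp continuous_id continuous_const).aestronglyMeasurable
  · exact (hF.comp continuous_id continuous_const).intervalIntegrable _ _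
  · exact (hF'.comp continuous_id continuous_const).aestronglyMeasurable
  · refine Eventually.of_forall fun ξ hξ s hs => ?_
    exact hC (ξ, s) ⟨uIoc_subset_uIcc hξ, hs⟩
  · exact intervalIntegrable_const
  · exact Eventually.of_forall fun ξ _ s _ => hd ξ s

lemma int_exp_bd {g : ℝ} (hg : 0 < g) (x : ℝ) :
    ∫ ξ in (0:ℝ)..x, Real.exp (-(g * (x - ξ))) ≤ 1 / g := by
  have h1 : ∀ ξ ∈ uIcc 0 x, HasDerivAt (fun ξ => Real.exp (-(g * (x - ξ))) / g)
      (Real.exp (-(g * (x - ξ)))) ξ := by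
    intro ξ _
    have h0 : HasDerivAt (fun ξ => -(g * (x - ξ))) g ξ := by
      refine ((((hasDerivAt_id ξ).const_sub x).const_mul g).neg).congr_deriv (by simp)
    refine (h0.exp.div_const g).congr_deriv ?_
    field_simp
  rw [intervalIntegral.integral_eq_sub_of_hasDerivAt h1
    ((by fun_prop : Continuous fun ξ => Real.exp (-(g * (x - ξ)))).intervalIntegrable _ _)]
  have : 0 < Real.exp (-(g * (x - 0))) / g := by positivity
  simp at this ⊢
  linarith

namespace Spd
variable {α αt : ℝ → ℝ → ℝ} {A : ℝ}

/-- The solution operator of `v_x + α v_t = k`, `v(0,·) = h₀`. -/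
def L (h : Spd α αt A) (h0 : ℝ → ℝ) (k : ℝ → ℝ → ℝ) (x t : ℝ) : ℝ :=
  h0 (h.tau 0 x t) + ∫ ξ in (0:ℝ)..x, k ξ (h.tau ξ x t)

/-- Its time derivative. -/
def L' (h : Spd α αt A) (h0 : ℝ → ℝ) (k : ℝ → ℝ → ℝ) (x t : ℝ) : ℝ :=
  h0 (h.tau 0 x t) * h.sig 0 x t + ∫ ξ in (0:ℝ)..x, k ξ (h.tau ξ x t) * h.sig ξ x t

variable {h0 h0' : ℝ → ℝ} {k k' : ℝ → ℝ → ℝ}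

lemma L_cont (h : Spd α αt A) (c0 : Continuous h0) (ck : C2 k) : C2 (h.L h0 k) := by
  unfold L C2
  refine (c0.comp (by fun_prop)).add ?_
  apply intervalIntegral.continuous_parametric_intervalIntegral_of_continuous
      (f := fun (q : ℝ × ℝ) ξ => k ξ (h.tau ξ q.1 q.2)) _ continuous_fst
  exact ck.comp (X := (ℝ × ℝ) × ℝ) (by fun_prop) (by fun_prop)

lemma L'_cont (h : Spd α αt A) (c0 : Continuous h0) (ck : C2 k) : C2 (h.L' h0 k) := by
  unfold L' C2
  refine ((c0.comp (by fun_prop)).mul (h.sig_cont (by fun_prop) (by fun_prop) (by fun_prop))).add ?_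
  apply intervalIntegral.continuous_parametric_intervalIntegral_of_continuous
      (f := fun (q : ℝ × ℝ) ξ => k ξ (h.tau ξ q.1 q.2) * h.sig ξ q.1 q.2) _ continuous_fst
  exact (ck.comp (X := (ℝ × ℝ) × ℝ) (by fun_prop) (by fun_prop)).mul
    (h.sig_cont (by fun_prop) (by fun_prop) (by fun_prop))

lemma L_der (h : Spd α αt A) (c0' : ∀ t, HasDerivAt h0 (h0' t) t)
    (ck : C2 k) (ck' : C2 k') (dk : ∀ x t, HasDerivAt (k x) (k' x t) t) (x t : ℝ) :
    HasDerivAt (h.L h0 k x) (h.L' h0' k' x t) t := by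
  unfold L L'
  refine ((c0' _).comp t (h.tau_der_t 0 x t)).add ?_
  apply hasDerivAt_int (F := fun ξ t => k ξ (h.tau ξ x t))
    (F' := fun ξ t => k' ξ (h.tau ξ x t) * h.sig ξ x t)
  · exact ck.comp (by fun_prop) (by fun_prop)
  · exact (ck'.comp (X := ℝ × ℝ) (by fun_prop) (by fun_prop)).mul
      (h.sig_cont (by fun_prop) (by fun_prop) (by fun_prop))
  · exact fun ξ t => (dk ξ _).comp t (h.tau_der_t ξ x t)

lemma L_bd_aux (h : Spd α αt A) {c : ℝ} (hc0 : 0 < c) (hc : ∀ x t, c ≤ α x t) {γ H K S : ℝ}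
    (hγ : 0 < γ) (hK0 : 0 ≤ K) (hS : 0 ≤ S) (s : ℝ → ℝ → ℝ → ℝ)
    (hs : ∀ ξ x t, 0 ≤ ξ → ξ ≤ x → x ≤ 1 → |s ξ x t| ≤ S)
    (hh : ∀ t, |h0 t| ≤ H * Real.exp (γ * t))
    (hk : ∀ x ∈ Icc (0:ℝ) 1, ∀ t, |k x t| ≤ K * Real.exp (γ * t)) {x : ℝ} (hx : x ∈ Icc (0:ℝ) 1)
    (t : ℝ) :
    |h0 (h.tau 0 x t) * s 0 x t + ∫ ξ in (0:ℝ)..x, k ξ (h.tau ξ x t) * s ξ x t| ≤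
      S * (H * Real.exp (-(γ * c * x)) + K / (γ * c)) * Real.exp (γ * t) := by
  have hH0 : 0 ≤ H := by
    have := (abs_nonneg _).trans (hh 0)
    simpa using this
  have e1 : ∀ ξ ≤ x, Real.exp (γ * h.tau ξ x t) ≤
      Real.exp (-(γ * c * (x - ξ))) * Real.exp (γ * t) := by
    intro ξ hξ
    rw [← Real.exp_add]
    apply Real.exp_le_exp.2
    have := h.tau_le hc t hξ
    nlinarith
  have b1 : |h0 (h.tau 0 x t) * s 0 x t| ≤
      (H * (Real.exp (-(γ * c * x)) * Real.exp (γ * t))) * S := by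
    rw [abs_mul]
    have := e1 0 hx.1
    rw [sub_zero] at this
    exact mul_le_mul ((hh _).trans (by gcongr)) (hs 0 x t le_rfl hx.1 hx.2) (abs_nonneg _)
      (by positivity)
  have b2 : |∫ ξ in (0:ℝ)..x, k ξ (h.tau ξ x t) * s ξ x t| ≤
      ∫ ξ in (0:ℝ)..x, (K * Real.exp (γ * t) * S) * Real.exp (-(γ * c * (x - ξ))) := by
    rw [← Real.norm_eq_abs]
    apply intervalIntegral.norm_integral_le_of_norm_le hx.1
    · refine Eventually.of_forall fun ξ hξ => ?_
      rw [Real.norm_eq_abs, abs_mul]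
      have h1 := hk ξ ⟨hξ.1.le, hξ.2.trans hx.2⟩ (h.tau ξ x t)
      have h2 := hs ξ x t hξ.1.le hξ.2 hx.2
      have h3 := e1 ξ hξ.2
      calc |k ξ (h.tau ξ x t)| * |s ξ x t| ≤
          (K * (Real.exp (-(γ * c * (x - ξ))) * Real.exp (γ * t))) * S :=
            mul_le_mul (h1.trans (by gcongr)) h2 (abs_nonneg _) (by positivity)
        _ = _ := by ring
    · exact (by fun_prop : Continuous fun ξ => (K * Real.exp (γ * t) * S) *
        Real.exp (-(γ * c * (x - ξ)))).intervalIntegrable _ _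
  rw [intervalIntegral.integral_const_mul] at b2
  have b3 := int_exp_bd (mul_pos hγ hc0) x
  calc _ ≤ _ := abs_add_le _ _
    _ ≤ (H * (Real.exp (-(γ * c * x)) * Real.exp (γ * t))) * S +
        (K * Real.exp (γ * t) * S) * (1 / (γ * c)) :=
          add_le_add b1 (b2.trans (by gcongr))
    _ = _ := by ring

lemma L_bd (h : Spd α αt A) {c : ℝ} (hc0 : 0 < c) (hc : ∀ x t, c ≤ α x t) {γ H K : ℝ}
    (hγ : 0 < γ) (hK0 : 0 ≤ K)
    (hh : ∀ t, |h0 t| ≤ H * Real.exp (γ * t))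
    (hk : ∀ x ∈ Icc (0:ℝ) 1, ∀ t, |k x t| ≤ K * Real.exp (γ * t)) {x : ℝ} (hx : x ∈ Icc (0:ℝ) 1)
    (t : ℝ) :
    |h.L h0 k x t| ≤
      Real.exp A * (H * Real.exp (-(γ * c * x)) + K / (γ * c)) * Real.exp (γ * t) := by
  have := h.L_bd_aux hc0 hc hγ hK0 (Real.exp_pos A).le (fun _ _ _ => 1)
    (fun _ _ _ _ _ _ => by simpa using h.A0) hh hk hx t
  simpa [L] using this

lemma L'_bd (h : Spd α αt A) {c : ℝ} (hc0 : 0 < c) (hc : ∀ x t, c ≤ α x t) {γ H K : ℝ}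
    (hγ : 0 < γ) (hK0 : 0 ≤ K)
    (hh : ∀ t, |h0 t| ≤ H * Real.exp (γ * t))
    (hk : ∀ x ∈ Icc (0:ℝ) 1, ∀ t, |k x t| ≤ K * Real.exp (γ * t)) {x : ℝ} (hx : x ∈ Icc (0:ℝ) 1)
    (t : ℝ) :
    |h.L' h0 k x t| ≤
      Real.exp A * (H * Real.exp (-(γ * c * x)) + K / (γ * c)) * Real.exp (γ * t) := by
  exact h.L_bd_aux hc0 hc hγ hK0 (Real.exp_pos A).le (fun ξ x t => h.sig ξ x t)
    (fun ξ x t h1 h2 h3 => by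
      rw [abs_of_pos (h.sig_pos _ _ _)]; exact h.sig_bd t h1 h2 h3) hh hk hx t

lemma L_char (h : Spd α αt A) (ξ x t : ℝ) :
    h.L h0 k ξ (h.tau ξ x t) = h0 (h.tau 0 x t) + ∫ η in (0:ℝ)..ξ, k η (h.tau η x t) := by
  simp [L, h.tau_group]

lemma sig_char (h : Spd α αt A) (η ξ x t : ℝ) :
    h.sig η ξ (h.tau ξ x t) = Real.exp (∫ ζ in (0:ℝ)..η, αt ζ (h.tau ζ x t)) *
      (Real.exp (∫ ζ in (0:ℝ)..ξ, αt ζ (h.tau ζ x t)))⁻¹ := by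
  have cc : Continuous fun η => αt η (h.tau η x t) :=
    h.cat.comp (f := fun η => (η, h.tau η x t)) (by fun_prop)
  rw [← Real.exp_neg, ← Real.exp_add, sig]
  simp only [h.tau_group]
  congr 1
  rw [← sub_eq_add_neg, intervalIntegral.integral_interval_sub_left] <;>
    exact cc.intervalIntegrable _ _

/-- `v = L' h k` solves `v = L h (k - αt v)`. -/
lemma L'_eq (h : Spd α αt A) (c0 : Continuous h0) (ck : C2 k) (x t : ℝ) :
    h.L' h0 k x t = h.L h0 (fun x t => k x t - αt x t * h.L' h0 k x t) x t := by
  have cat : Continuous fun η => αt η (h.tau η x t) :=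
    h.cat.comp (f := fun η => (η, h.tau η x t)) (by fun_prop)
  have ckk : Continuous fun η => k η (h.tau η x t) := ck.comp (by fun_prop) (by fun_prop)
  set I : ℝ → ℝ := fun ξ => ∫ ζ in (0:ℝ)..ξ, αt ζ (h.tau ζ x t) with hI
  have dI : ∀ ξ, HasDerivAt I (αt ξ (h.tau ξ x t)) ξ := fun ξ =>
    intervalIntegral.integral_hasDerivAt_right (cat.intervalIntegrable _ _)
      cat.stronglyMeasurable.stronglyMeasurableAtFilter cat.continuousAt
  have cI : Continuous I := continuous_iff_continuousAt.2 fun ξ => (dI ξ).continuousAt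
  have cJ : Continuous fun η => k η (h.tau η x t) * Real.exp (I η) :=
    ckk.mul (Real.continuous_exp.comp cI)
  set J : ℝ → ℝ := fun ξ => ∫ η in (0:ℝ)..ξ, k η (h.tau η x t) * Real.exp (I η) with hJ
  have dJ : ∀ ξ, HasDerivAt J (k ξ (h.tau ξ x t) * Real.exp (I ξ)) ξ := fun ξ =>
    intervalIntegral.integral_hasDerivAt_right (cJ.intervalIntegrable _ _)
      cJ.stronglyMeasurable.stronglyMeasurableAtFilter cJ.continuousAt
  have hY : ∀ ξ, h.L' h0 k ξ (h.tau ξ x t) =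
      (h0 (h.tau 0 x t) + J ξ) * Real.exp (-(I ξ)) := by
    intro ξ
    simp only [L', h.sig_char, h.tau_group, ← mul_assoc]
    rw [intervalIntegral.integral_mul_const]
    simp only [hJ, hI, intervalIntegral.integral_same, Real.exp_zero, mul_one, Real.exp_neg]
    ring
  have dY : ∀ ξ ∈ uIcc 0 x, HasDerivAt (fun ξ => h.L' h0 k ξ (h.tau ξ x t))
      (k ξ (h.tau ξ x t) - αt ξ (h.tau ξ x t) * h.L' h0 k ξ (h.tau ξ x t)) ξ := by
    intro ξ _
    simp_rw [hY]
    refine (((dJ ξ).const_add (h0 (h.tau 0 x t))).mul (dI ξ).neg.exp).congr_deriv ?_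
    have : Real.exp (I ξ) * Real.exp (-(I ξ)) = 1 := by rw [← Real.exp_add]; simp
    linear_combination (k ξ (h.tau ξ x t)) * this
  have fin := intervalIntegral.integral_eq_sub_of_hasDerivAt dY (by
    apply Continuous.intervalIntegrable
    exact ckk.sub (cat.mul ((h.L'_cont c0 ck).comp (by fun_prop) (by fun_prop))))
  simp only [L]
  rw [fin, h.tau_self]
  have h00 := hY 0
  simp [hI, hJ] at h00
  rw [h00]; ring

lemma slope_aux {y y' : ℝ → ℝ → ℝ} (cy' : C2 y') (dy : ∀ x t, HasDerivAt (y x) (y' x t) t)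
    (h : Spd α αt A) (x t : ℝ) :
    HasDerivAt (fun ξ => y ξ (h.tau ξ x t) - y ξ t) (y' x t * α x t) x := by
  have keq : ∀ η u v, y η u - y η v = kap y' η u v * (u - v) := by
    intro η u v
    have h1 : ∀ θ ∈ uIcc (0:ℝ) 1, HasDerivAt (fun θ => y η (v + θ * (u - v)))
        (y' η (v + θ * (u - v)) * (u - v)) θ := by
      intro θ _
      have : HasDerivAt (fun θ : ℝ => v + θ * (u - v)) (u - v) θ := by
        simpa using ((hasDerivAt_id θ).mul_const (u - v)).const_add v
      exact (dy η _).comp θ this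
    have h2 := intervalIntegral.integral_eq_sub_of_hasDerivAt h1 (by
      apply Continuous.intervalIntegrable
      exact (cy'.comp (by fun_prop) (by fun_prop)).mul continuous_const)
    rw [intervalIntegral.integral_mul_const] at h2
    simp only [kap]
    rw [h2]; simp
  have kc : Continuous (fun q : ℝ × ℝ × ℝ => kap y' q.1 q.2.1 q.2.2) := by
    unfold kap
    apply intervalIntegral.continuous_parametric_intervalIntegral_of_continuous'
    exact C2.comp cy' (X := (ℝ × ℝ × ℝ) × ℝ) (by fun_prop) (by fun_prop)
  have qc : Continuous fun ξ => kap y' ξ (h.tau ξ x t) t :=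
    kc.comp (f := fun ξ => (ξ, h.tau ξ x t, t)) (by fun_prop)
  rw [hasDerivAt_iff_tendsto_slope]
  have h1 := (hasDerivAt_iff_tendsto_slope.1 (h.tau_der x x t))
  have h2 := (qc.tendsto x).mono_left (nhdsWithin_le_nhds (s := {x}ᶜ))
  have h3 := h2.mul h1
  simp only [h.tau_self, kap_self] at h3
  refine h3.congr fun ξ => ?_
  simp only [slope, vsub_eq_sub, smul_eq_mul, h.tau_self, keq]
  ring
end Spd

end Part2

section Part3
/-- Clamp to `[0,1]`. -/
def cl (x : ℝ) : ℝ := max 0 (min 1 x)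

lemma cl_mem (x : ℝ) : cl x ∈ Icc (0:ℝ) 1 := by
  unfold cl; exact ⟨le_max_left _ _, max_le zero_le_one (min_le_left _ _)⟩

lemma cl_of {x : ℝ} (hx : x ∈ Icc (0:ℝ) 1) : cl x = x := by
  unfold cl; rw [min_eq_right hx.2, max_eq_right hx.1]

@[fun_prop]
lemma cl_cont : Continuous cl := by unfold cl; fun_prop

/-- Geometry of the normalized hyperbolic system. -/
structure Geo (n : ℕ) where
  α : Fin n → ℝ → ℝ → ℝ
  αt : Fin n → ℝ → ℝ → ℝ
  p : Fin n → Fin n → ℝ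
  r : Fin n → Fin n → ℝ → ℝ
  A : ℝ
  c : ℝ
  P : ℝ
  hα : ∀ j, Spd (α j) (αt j) A
  hc0 : 0 < c
  hc : ∀ j x t, c ≤ α j x t
  hP0 : 0 ≤ P
  hP : ∀ j k, |p j k| ≤ P
  hr : ∀ j k, Continuous (r j k)
  hrI : ∀ j k x, x ∈ Icc (0:ℝ) 1 → r j k x ∈ Icc (0:ℝ) 1
  hrr : ∀ j x, r j j x = x

/-- Zeroth order coefficients. -/
structure Cf {n : ℕ} (β βt : Fin n → Fin n → ℝ → ℝ → ℝ) (B : ℝ) : Prop where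
  B0 : 0 ≤ B
  c : ∀ j k, C2 (β j k)
  c' : ∀ j k, C2 (βt j k)
  d : ∀ j k x t, HasDerivAt (β j k x) (βt j k x t) t
  b : ∀ j k x t, |β j k x t| ≤ B
  b' : ∀ j k x t, |βt j k x t| ≤ B

/-- Weighted class of functions with time derivative. -/
structure Cl {n : ℕ} (γ κ M : ℝ) (y y' : Fin n → ℝ → ℝ → ℝ) : Prop where
  c : ∀ j, C2 (y j)
  c' : ∀ j, C2 (y' j)
  d : ∀ j x t, HasDerivAt (y j x) (y' j x t) t
  b : ∀ j, ∀ x ∈ Icc (0:ℝ) 1, ∀ t, |y j x t| ≤ M * Real.exp (γ * t - κ * x)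
  b' : ∀ j, ∀ x ∈ Icc (0:ℝ) 1, ∀ t, |y' j x t| ≤ M * Real.exp (γ * t - κ * x)

lemma C2.sum {ι : Type*} (s : Finset ι) {f : ι → ℝ → ℝ → ℝ} (h : ∀ i ∈ s, C2 (f i)) :
    C2 (fun x t => ∑ i ∈ s, f i x t) := by
  unfold C2; exact continuous_finsetSum _ h

lemma sum_bd {n : ℕ} (u v : Fin n → ℝ) {a b : ℝ} (ha : 0 ≤ a) (hu : ∀ k, |u k| ≤ a)
    (hv : ∀ k, |v k| ≤ b) : |∑ k, u k * v k| ≤ n * a * b := by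
  calc |∑ k, u k * v k| ≤ ∑ k, |u k * v k| := Finset.abs_sum_le_sum_abs _ _
    _ ≤ ∑ _k : Fin n, a * b := Finset.sum_le_sum fun k _ => by
        rw [abs_mul]; exact mul_le_mul (hu k) (hv k) (abs_nonneg _) ha
    _ = n * a * b := by simp [mul_assoc]

namespace Geo
variable {n : ℕ} (G : Geo n) {β βt : Fin n → Fin n → ℝ → ℝ → ℝ} {B γ κ M : ℝ}
  {y y' z g g' : Fin n → ℝ → ℝ → ℝ}

def bd (y : Fin n → ℝ → ℝ → ℝ) (j : Fin n) (t : ℝ) : ℝ := ∑ k, G.p j k * y k 1 t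

def cp (β : Fin n → Fin n → ℝ → ℝ → ℝ) (y : Fin n → ℝ → ℝ → ℝ) (j : Fin n) (x t : ℝ) : ℝ :=
  ∑ k, β j k x t * y k (G.r j k x) t

def T (β : Fin n → Fin n → ℝ → ℝ → ℝ) (y : Fin n → ℝ → ℝ → ℝ) (j : Fin n) : ℝ → ℝ → ℝ :=
  (G.hα j).L (G.bd y j) (fun x t => - G.cp β y j x t)

def T' (β βt : Fin n → Fin n → ℝ → ℝ → ℝ) (y y' : Fin n → ℝ → ℝ → ℝ) (j : Fin n) : ℝ → ℝ → ℝ :=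
  (G.hα j).L' (G.bd y' j) (fun x t => - (G.cp βt y j x t + G.cp β y' j x t))

def S (g : Fin n → ℝ → ℝ → ℝ) (j : Fin n) : ℝ → ℝ → ℝ := (G.hα j).L (fun _ => 0) (g j)
def S' (g : Fin n → ℝ → ℝ → ℝ) (j : Fin n) : ℝ → ℝ → ℝ := (G.hα j).L' (fun _ => 0) (g j)

def IsMild (β : Fin n → Fin n → ℝ → ℝ → ℝ) (g y : Fin n → ℝ → ℝ → ℝ) : Prop :=
  ∀ j, ∀ x ∈ Icc (0:ℝ) 1, ∀ t, y j x t =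
    (G.hα j).L (G.bd y j) (fun x t => g j x t - G.cp β y j x t) x t

/-- Admissible weights. -/
structure Gd (G : Geo n) (B γ κ : ℝ) : Prop where
  κ0 : 0 ≤ κ
  γ0 : 0 < γ
  κγ : κ ≤ γ * G.c
  sm : Real.exp G.A * (n * G.P * Real.exp (-κ) + 2 * n * B * Real.exp κ / (γ * G.c)) ≤ 1 / 2

lemma exists_Gd (G : Geo n) {B : ℝ} (hB : 0 ≤ B) :
    ∃ κ γ0 : ℝ, 0 < γ0 ∧ ∀ γ, γ0 ≤ γ → Gd G B γ κ := by
  obtain ⟨κ, hκ⟩ : ∃ κ : ℝ, 0 ≤ κ ∧ Real.exp G.A * (n * G.P) * Real.exp (-κ) ≤ 1 / 4 := by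
    have h1 : Tendsto (fun κ : ℝ => Real.exp G.A * (n * G.P) * Real.exp (-κ)) atTop
        (nhds (Real.exp G.A * (n * G.P) * 0)) :=
      (Real.tendsto_exp_neg_atTop_nhds_zero).const_mul _
    rw [mul_zero] at h1
    have h2 := h1.eventually (ge_mem_nhds (by norm_num : (0:ℝ) < 1 / 4))
    exact ((eventually_ge_atTop 0).and h2).exists
  have hc := G.hc0
  set R := Real.exp G.A * (2 * n * B * Real.exp κ) with hR
  have hR0 : 0 ≤ R := by positivity
  refine ⟨κ, (κ + 4 * R + 1) / G.c, by have := hκ.1; positivity, fun γ hγ => ?_⟩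
  have h1 : κ + 4 * R + 1 ≤ γ * G.c := by rwa [div_le_iff₀ hc] at hγ
  have h2 : 0 < γ * G.c := by linarith [hκ.1]
  refine ⟨hκ.1, ?_, by linarith, ?_⟩
  · exact pos_of_mul_pos_left h2 hc.le
  · have h3 : R / (γ * G.c) ≤ 1 / 4 := by
      rw [div_le_iff₀ h2]; linarith [hκ.1]
    have : Real.exp G.A * (n * G.P * Real.exp (-κ) + 2 * n * B * Real.exp κ / (γ * G.c)) =
      Real.exp G.A * (n * G.P) * Real.exp (-κ) + R / (γ * G.c) := by rw [hR]; ring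
    rw [this]; linarith [hκ.2]

lemma Gd.fin (h : Gd G B γ κ) (hB : 0 ≤ B) (hM : 0 ≤ M) {x : ℝ} (hx : x ∈ Icc (0:ℝ) 1) (t : ℝ) {v : ℝ}
    (hv : v ≤ Real.exp G.A * ((n * G.P * (M * Real.exp (-κ))) * Real.exp (-(γ * G.c * x)) +
      (2 * n * B * M) / (γ * G.c)) * Real.exp (γ * t)) :
    v ≤ M / 2 * Real.exp (γ * t - κ * x) := by
  have hc := G.hc0
  have hP := G.hP0
  have hγ := h.γ0
  have e1 : Real.exp (-(γ * G.c * x)) ≤ Real.exp (-(κ * x)) := by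
    apply Real.exp_le_exp.2; nlinarith [h.κγ, hx.1]
  have e2 : 1 ≤ Real.exp κ * Real.exp (-(κ * x)) := by
    rw [← Real.exp_add]; apply Real.one_le_exp; nlinarith [h.κ0, hx.2]
  have e3 : Real.exp (γ * t - κ * x) = Real.exp (γ * t) * Real.exp (-(κ * x)) := by
    rw [← Real.exp_add]; congr 1
  have e4 : (2 * n * B * M) / (γ * G.c) ≤
      (2 * n * B * M) / (γ * G.c) * (Real.exp κ * Real.exp (-(κ * x))) :=
    le_mul_of_one_le_right (by positivity) e2
  calc v ≤ _ := hv
    _ ≤ Real.exp G.A * ((n * G.P * (M * Real.exp (-κ))) * Real.exp (-(κ * x)) +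
      (2 * n * B * M) / (γ * G.c) * (Real.exp κ * Real.exp (-(κ * x)))) * Real.exp (γ * t) := by
        gcongr
    _ = (Real.exp G.A * (n * G.P * Real.exp (-κ) + 2 * n * B * Real.exp κ / (γ * G.c))) *
        (M * (Real.exp (γ * t) * Real.exp (-(κ * x)))) := by ring
    _ ≤ 1 / 2 * (M * (Real.exp (γ * t) * Real.exp (-(κ * x)))) := by
        gcongr; exact h.sm
    _ = _ := by rw [e3]; ring

lemma bd_bd (hb : ∀ j, ∀ x ∈ Icc (0:ℝ) 1, ∀ t, |y j x t| ≤ M * Real.exp (γ * t - κ * x))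
    (j : Fin n) (t : ℝ) : |G.bd y j t| ≤ (n * G.P * (M * Real.exp (-κ))) * Real.exp (γ * t) := by
  have := sum_bd (fun k => G.p j k) (fun k => y k 1 t) G.hP0 (G.hP j)
    (fun k => hb k 1 (by simp) t)
  refine this.trans (le_of_eq ?_)
  rw [sub_eq_add_neg, Real.exp_add]; simp; ring

lemma cp_bd (h : Gd G B γ κ) (hB0 : 0 ≤ B) (hB : ∀ j k x t, |β j k x t| ≤ B) (hM : 0 ≤ M)
    (hb : ∀ j, ∀ x ∈ Icc (0:ℝ) 1, ∀ t, |y j x t| ≤ M * Real.exp (γ * t - κ * x))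
    (j : Fin n) {x : ℝ} (hx : x ∈ Icc (0:ℝ) 1) (t : ℝ) :
    |G.cp β y j x t| ≤ (n * B * M) * Real.exp (γ * t) := by
  have := sum_bd (fun k => β j k x t) (fun k => y k (G.r j k x) t) hB0 (fun k => hB j k x t)
    (b := M * Real.exp (γ * t)) (fun k => by
      have h1 := G.hrI j k x hx
      refine (hb k _ h1 t).trans ?_
      gcongr
      have := mul_nonneg h.κ0 h1.1
      linarith)
  refine this.trans (le_of_eq ?_)
  ring

lemma T_bd (h : Gd G B γ κ) (hB0 : 0 ≤ B) (hB : ∀ j k x t, |β j k x t| ≤ B) (hM : 0 ≤ M)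
    (hb : ∀ j, ∀ x ∈ Icc (0:ℝ) 1, ∀ t, |y j x t| ≤ M * Real.exp (γ * t - κ * x))
    (j : Fin n) (x : ℝ) (hx : x ∈ Icc (0:ℝ) 1) (t : ℝ) :
    |G.T β y j x t| ≤ M / 2 * Real.exp (γ * t - κ * x) := by
  apply h.fin G hB0 hM hx t
  refine (G.hα j).L_bd G.hc0 (G.hc j) h.γ0 (by positivity) (G.bd_bd hb j) ?_ hx t
  intro x hx t
  rw [abs_neg]
  refine (G.cp_bd h hB0 hB hM hb j hx t).trans ?_
  gcongr
  have : 0 ≤ (n:ℝ) * B := by positivity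
  linarith

lemma bd_cont (hc : ∀ j, C2 (y j)) (j : Fin n) : Continuous (G.bd y j) := by
  unfold bd
  exact continuous_finsetSum _ fun k _ =>
    continuous_const.mul ((hc k).comp continuous_const continuous_id)

lemma cp_cont (hβ : ∀ j k, C2 (β j k)) (hc : ∀ j, C2 (y j)) (j : Fin n) : C2 (G.cp β y j) := by
  unfold cp C2
  exact continuous_finsetSum _ fun k _ =>
    ((hβ j k).comp continuous_fst continuous_snd).mul
      ((hc k).comp ((G.hr j k).comp continuous_fst) continuous_snd)

lemma bd_der (hd : ∀ j x t, HasDerivAt (y j x) (y' j x t) t) (j : Fin n) (t : ℝ) :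
    HasDerivAt (G.bd y j) (G.bd y' j t) t := by
  unfold bd
  exact HasDerivAt.fun_sum fun k _ => (hd k 1 t).const_mul _

lemma cp_der (hβ : Cf β βt B) (hd : ∀ j x t, HasDerivAt (y j x) (y' j x t) t) (j : Fin n)
    (x t : ℝ) : HasDerivAt (G.cp β y j x) (G.cp βt y j x t + G.cp β y' j x t) t := by
  unfold cp
  rw [← Finset.sum_add_distrib]
  exact HasDerivAt.fun_sum fun k _ => (hβ.d j k x t).mul (hd k _ t)

lemma step (h : Gd G B γ κ) (hβ : Cf β βt B) (hM : 0 ≤ M) (hy : Cl γ κ M y y') :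
    Cl γ κ (M / 2) (G.T β y) (G.T' β βt y y') where
  c j := (G.hα j).L_cont (G.bd_cont hy.c j) (Continuous.neg (G.cp_cont hβ.c hy.c j))
  c' j := (G.hα j).L'_cont (G.bd_cont hy.c' j)
    (Continuous.neg (Continuous.add (G.cp_cont hβ.c' hy.c j) (G.cp_cont hβ.c hy.c' j)))
  d j x t := (G.hα j).L_der (k := fun x t => - G.cp β y j x t)
    (k' := fun x t => - (G.cp βt y j x t + G.cp β y' j x t)) (G.bd_der hy.d j) (Continuous.neg (G.cp_cont hβ.c hy.c j))
    (Continuous.neg (Continuous.add (G.cp_cont hβ.c' hy.c j) (G.cp_cont hβ.c hy.c' j)))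
    (fun x t => (G.cp_der hβ hy.d j x t).neg) x t
  b := G.T_bd h hβ.B0 hβ.b hM hy.b
  b' j x hx t := by
    have hB0 := hβ.B0
    apply h.fin G hB0 hM hx t
    refine (G.hα j).L'_bd G.hc0 (G.hc j) h.γ0 (by positivity) (G.bd_bd hy.b' j) ?_ hx t
    intro x hx t
    rw [abs_neg]
    refine (abs_add_le _ _).trans ?_
    have h1 := G.cp_bd h hB0 hβ.b' hM hy.b j hx t
    have h2 := G.cp_bd h hB0 hβ.b hM hy.b' j hx t
    linarith

/-- Constant of the first term. -/
def D (G : Geo n) (γ κ : ℝ) : ℝ := Real.exp G.A * Real.exp κ / (γ * G.c)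

lemma D0 (h : Gd G B γ κ) : 0 ≤ G.D γ κ := by
  have := G.hc0; have := h.γ0; unfold D; positivity

/-- Admissible right hand sides. -/
structure Rhs (γ M : ℝ) (g g' : Fin n → ℝ → ℝ → ℝ) : Prop where
  M0 : 0 ≤ M
  c : ∀ j, C2 (g j)
  c' : ∀ j, C2 (g' j)
  d : ∀ j x t, HasDerivAt (g j x) (g' j x t) t
  b : ∀ j, ∀ x ∈ Icc (0:ℝ) 1, ∀ t, |g j x t| ≤ M * Real.exp (γ * t)
  b' : ∀ j, ∀ x ∈ Icc (0:ℝ) 1, ∀ t, |g' j x t| ≤ M * Real.exp (γ * t)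

lemma first (h : Gd G B γ κ) (hg : Rhs γ M g g') :
    Cl γ κ (G.D γ κ * M) (G.S g) (G.S' g') := by
  have hc := G.hc0
  have hM := hg.M0
  have hγ := h.γ0
  have fin : ∀ x ∈ Icc (0:ℝ) 1, ∀ t, Real.exp G.A * (0 * Real.exp (-(γ * G.c * x)) + M / (γ * G.c)) *
      Real.exp (γ * t) ≤ G.D γ κ * M * Real.exp (γ * t - κ * x) := by
    intro x hx t
    have e2 : 1 ≤ Real.exp κ * Real.exp (-(κ * x)) := by
      rw [← Real.exp_add]; apply Real.one_le_exp; nlinarith [h.κ0, hx.2]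
    have e3 : Real.exp (γ * t - κ * x) = Real.exp (γ * t) * Real.exp (-(κ * x)) := by
      rw [← Real.exp_add]; congr 1
    rw [e3, D, zero_mul, zero_add]
    calc _ ≤ Real.exp G.A * (M / (γ * G.c)) * Real.exp (γ * t) *
        (Real.exp κ * Real.exp (-(κ * x))) := le_mul_of_one_le_right (by positivity) e2
      _ = _ := by ring
  refine ⟨?_, ?_, ?_, ?_, ?_⟩
  · exact fun j => (G.hα j).L_cont continuous_const (hg.c j)
  · exact fun j => (G.hα j).L'_cont continuous_const (hg.c' j)
  · exact fun j x t => (G.hα j).L_der (h0' := fun _ => 0) (fun t => hasDerivAt_const t _) (hg.c j)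
      (hg.c' j) (hg.d j) x t
  · intro j x hx t
    refine ((G.hα j).L_bd G.hc0 (G.hc j) h.γ0 hM (fun t => ?_) (hg.b j) hx t).trans (fin x hx t)
    simp
  · intro j x hx t
    refine ((G.hα j).L'_bd G.hc0 (G.hc j) h.γ0 hM (fun t => ?_) (hg.b' j) hx t).trans (fin x hx t)
    simp

lemma T_sub (hβ : ∀ j k, C2 (β j k)) (hy : ∀ j, C2 (y j)) (hz : ∀ j, C2 (z j)) (j : Fin n) (x t : ℝ) :
    G.T β (fun k x t => y k x t - z k x t) j x t = G.T β y j x t - G.T β z j x t := by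
  have cy : Continuous fun ξ => G.cp β y j ξ ((G.hα j).tau ξ x t) :=
    (G.cp_cont hβ hy j).comp (by fun_prop) (by fun_prop)
  have cz : Continuous fun ξ => G.cp β z j ξ ((G.hα j).tau ξ x t) :=
    (G.cp_cont hβ hz j).comp (by fun_prop) (by fun_prop)
  have e1 : ∀ x t, G.cp β (fun k x t => y k x t - z k x t) j x t =
      G.cp β y j x t - G.cp β z j x t := by
    intro x t; simp only [cp, mul_sub, Finset.sum_sub_distrib]
  have e2 : ∀ t, G.bd (fun k x t => y k x t - z k x t) j t = G.bd y j t - G.bd z j t := by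
    intro t; simp only [bd, mul_sub, Finset.sum_sub_distrib]
  simp only [T, Spd.L, e1, e2, intervalIntegral.integral_neg]
  rw [intervalIntegral.integral_sub (cy.intervalIntegrable _ _) (cz.intervalIntegrable _ _)]
  ring

lemma L_split (hβ : ∀ j k, C2 (β j k)) (hy : ∀ j, C2 (y j)) (hg : ∀ j, C2 (g j)) (j : Fin n) (x t : ℝ) :
    (G.hα j).L (G.bd y j) (fun x t => g j x t - G.cp β y j x t) x t =
      G.S g j x t + G.T β y j x t := by
  have cy : Continuous fun ξ => G.cp β y j ξ ((G.hα j).tau ξ x t) :=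
    (G.cp_cont hβ hy j).comp (by fun_prop) (by fun_prop)
  have cg : Continuous fun ξ => g j ξ ((G.hα j).tau ξ x t) := (hg j).comp (by fun_prop) (by fun_prop)
  simp only [S, T, Spd.L, intervalIntegral.integral_neg]
  rw [intervalIntegral.integral_sub (cg.intervalIntegrable _ _) (cy.intervalIntegrable _ _)]
  ring

lemma zero_of_half (h : Gd G B γ κ) {f : Fin n → ℝ → ℝ → ℝ} {M : ℝ} (hM : 0 ≤ M)
    (hb : ∀ j, ∀ x ∈ Icc (0:ℝ) 1, ∀ t, |f j x t| ≤ M * Real.exp (γ * t))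
    (hs : ∀ M, 0 ≤ M → (∀ j, ∀ x ∈ Icc (0:ℝ) 1, ∀ t, |f j x t| ≤ M * Real.exp (γ * t - κ * x)) →
      (∀ j, ∀ x ∈ Icc (0:ℝ) 1, ∀ t, |f j x t| ≤ M / 2 * Real.exp (γ * t - κ * x))) :
    ∀ j, ∀ x ∈ Icc (0:ℝ) 1, ∀ t, f j x t = 0 := by
  have key : ∀ N : ℕ, ∀ j, ∀ x ∈ Icc (0:ℝ) 1, ∀ t, |f j x t| ≤
      (M * Real.exp κ) * (1 / 2) ^ N * Real.exp (γ * t - κ * x) := by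
    intro N
    induction N with
    | zero =>
      intro j x hx t
      refine (hb j x hx t).trans ?_
      rw [pow_zero, mul_one, mul_assoc, ← Real.exp_add]
      gcongr
      nlinarith [h.κ0, hx.2]
    | succ N ih =>
      have := hs _ (by positivity) ih
      intro j x hx t
      refine (this j x hx t).trans (le_of_eq ?_)
      rw [pow_succ]; ring
  intro j x hx t
  have lim : Tendsto (fun N : ℕ => (M * Real.exp κ) * (1 / 2) ^ N * Real.exp (γ * t - κ * x)) atTop
      (nhds ((M * Real.exp κ) * 0 * Real.exp (γ * t - κ * x))) :=
    ((tendsto_pow_atTop_nhds_zero_of_lt_one (by norm_num) (by norm_num)).const_mul _).mul_const _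
  have := ge_of_tendsto' lim (fun N => key N j x hx t)
  simp at this
  exact this

theorem uniq (h : Gd G B γ κ) (hβ : Cf β βt B) (hg : ∀ j, C2 (g j)) (cy : ∀ j, C2 (y j))
    (cz : ∀ j, C2 (z j)) (my : G.IsMild β g y) (mz : G.IsMild β g z) {M : ℝ}
    (hby : ∀ j, ∀ x ∈ Icc (0:ℝ) 1, ∀ t, |y j x t| ≤ M * Real.exp (γ * t))
    (bz : ∀ j, ∀ x ∈ Icc (0:ℝ) 1, ∀ t, |z j x t| ≤ M * Real.exp (γ * t)) :
    ∀ j, ∀ x ∈ Icc (0:ℝ) 1, ∀ t, y j x t = z j x t := by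
  intro j x hx t
  have hM : 0 ≤ M := by
    have := (abs_nonneg _).trans (hby j x hx 0)
    simpa using this
  refine sub_eq_zero.1 (G.zero_of_half h (f := fun j x t => y j x t - z j x t) (M := 2 * M)
    (by linarith) ?_ ?_ j x hx t)
  · intro j x hx t
    refine (abs_sub _ _).trans ?_
    linarith [hby j x hx t, bz j x hx t]
  · intro M hM hb j x hx t
    have e : y j x t - z j x t = G.T β (fun k x t => y k x t - z k x t) j x t := by
      rw [G.T_sub hβ.c cy cz, my j x hx t, mz j x hx t, G.L_split hβ.c cy hg, G.L_split hβ.c cz hg]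
      ring
    rw [e]
    exact G.T_bd h hβ.B0 hβ.b hM hb j x hx t

end Geo

end Part3

section Part4
namespace Geo
variable {n : ℕ} (G : Geo n) {β βt : Fin n → Fin n → ℝ → ℝ → ℝ} {B γ κ M : ℝ}
  {y y' z g g' : Fin n → ℝ → ℝ → ℝ}

/-- Terms of the Neumann series, with time derivatives. -/
def dd (β βt : Fin n → Fin n → ℝ → ℝ → ℝ) (g g' : Fin n → ℝ → ℝ → ℝ) :
    ℕ → (Fin n → ℝ → ℝ → ℝ) × (Fin n → ℝ → ℝ → ℝ)
  | 0 => (G.S g, G.S' g')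
  | N + 1 => (G.T β (dd β βt g g' N).1, G.T' β βt (dd β βt g g' N).1 (dd β βt g g' N).2)

lemma dd_Cl (h : Gd G B γ κ) (hβ : Cf β βt B) (hg : Rhs γ M g g') (N : ℕ) :
    Cl γ κ (G.D γ κ * M * (1 / 2) ^ N) (G.dd β βt g g' N).1 (G.dd β βt g g' N).2 := by
  have := G.D0 h
  have := hg.M0
  induction N with
  | zero => simpa [dd] using G.first h hg
  | succ N ih =>
    have := G.step h hβ (by positivity) ih
    rw [pow_succ]
    simp only [dd]
    convert! this using 1
    ring

/-- A set which is backward closed for the characteristic geometry. -/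
structure Zcl (Z : ℝ → ℝ → Prop) : Prop where
  z1 : ∀ j, ∀ x ∈ Icc (0:ℝ) 1, ∀ t, Z x t → ∀ ξ ∈ Icc 0 x, Z ξ ((G.hα j).tau ξ x t)
  z2 : ∀ t, Z 0 t → Z 1 t
  z3 : ∀ j k, ∀ x ∈ Icc (0:ℝ) 1, ∀ t, Z x t → Z (G.r j k x) t

lemma L_zero {Z : ℝ → ℝ → Prop} (hZ : G.Zcl Z) {h0 : ℝ → ℝ} {k : ℝ → ℝ → ℝ} (j : Fin n)
    (hh : ∀ t, Z 0 t → h0 t = 0) (hk : ∀ x ∈ Icc (0:ℝ) 1, ∀ t, Z x t → k x t = 0)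
    {x : ℝ} (hx : x ∈ Icc (0:ℝ) 1) {t : ℝ} (hz : Z x t) : (G.hα j).L h0 k x t = 0 := by
  have h1 := hh _ (hZ.z1 j x hx t hz 0 ⟨le_rfl, hx.1⟩)
  have h2 : ∫ ξ in (0:ℝ)..x, k ξ ((G.hα j).tau ξ x t) = ∫ ξ in (0:ℝ)..x, (0:ℝ) := by
    apply intervalIntegral.integral_congr
    intro ξ hξ
    rw [uIcc_of_le hx.1] at hξ
    exact hk ξ ⟨hξ.1, hξ.2.trans hx.2⟩ _ (hZ.z1 j x hx t hz ξ hξ)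
  rw [Spd.L, h1, h2]; simp

lemma dd_zero {Z : ℝ → ℝ → Prop} (hZ : G.Zcl Z)
    (hg : ∀ j, ∀ x ∈ Icc (0:ℝ) 1, ∀ t, Z x t → g j x t = 0) (N : ℕ) :
    ∀ j, ∀ x ∈ Icc (0:ℝ) 1, ∀ t, Z x t → (G.dd β βt g g' N).1 j x t = 0 := by
  induction N with
  | zero => exact fun j x hx t hz => G.L_zero hZ j (fun _ _ => rfl) (hg j) hx hz
  | succ N ih =>
    intro j x hx t hz
    simp only [dd, T]
    refine G.L_zero hZ j (fun t ht => ?_) (fun x hx t ht => ?_) hx hz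
    · simp only [bd]
      exact Finset.sum_eq_zero fun k _ => by rw [ih k 1 (by simp) t (hZ.z2 t ht), mul_zero]
    · simp only [cp, neg_eq_zero]
      exact Finset.sum_eq_zero fun k _ => by
        rw [ih k _ (G.hrI j k x hx) t (hZ.z3 j k x hx t ht), mul_zero]

theorem core (h : Gd G B γ κ) (hβ : Cf β βt B) (hg : Rhs γ M g g') :
    ∃ w w' : Fin n → ℝ → ℝ → ℝ, Cl γ κ (2 * (G.D γ κ * M)) w w' ∧ G.IsMild β g w ∧
      (∀ Z, G.Zcl Z → (∀ j, ∀ x ∈ Icc (0:ℝ) 1, ∀ t, Z x t → g j x t = 0) →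
        ∀ j, ∀ x ∈ Icc (0:ℝ) 1, ∀ t, Z x t → w j x t = 0) := by
  have hD := G.D0 h
  have hM := hg.M0
  set Q := G.D γ κ * M with hQ
  have hQ0 : 0 ≤ Q := by positivity
  set d := fun N => (G.dd β βt g g' N).1 with hd
  set d' := fun N => (G.dd β βt g g' N).2 with hd'
  have hC : ∀ N, Cl γ κ (Q * (1 / 2) ^ N) (d N) (d' N) := G.dd_Cl h hβ hg
  have sg : Summable fun N : ℕ => Q * (1 / 2 : ℝ) ^ N := summable_geometric_two.mul_left Q
  have sg2 : ∑' N : ℕ, Q * (1 / 2 : ℝ) ^ N = 2 * Q := by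
    rw [tsum_mul_left, tsum_geometric_two]; ring
  have kx : ∀ x ∈ Icc (0:ℝ) 1, ∀ t, Real.exp (γ * t - κ * x) ≤ Real.exp (γ * t) := by
    intro x hx t
    apply Real.exp_le_exp.2
    have := mul_nonneg h.κ0 hx.1
    linarith
  have sb : ∀ j, ∀ x ∈ Icc (0:ℝ) 1, ∀ t, Summable (fun N => d N j x t) := fun j x hx t =>
    Summable.of_norm_bounded (sg.mul_right (Real.exp (γ * t - κ * x))) fun N => (hC N).b j x hx t
  let w : Fin n → ℝ → ℝ → ℝ := fun j x t => ∑' N, d N j (cl x) t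
  let w' : Fin n → ℝ → ℝ → ℝ := fun j x t => ∑' N, d' N j (cl x) t
  have contaux : ∀ (e : ℕ → ℝ → ℝ → ℝ), (∀ N, C2 (e N)) →
      (∀ N, ∀ x ∈ Icc (0:ℝ) 1, ∀ t, |e N x t| ≤ Q * (1 / 2) ^ N * Real.exp (γ * t - κ * x)) →
      C2 (fun x t => ∑' N, e N (cl x) t) := by
    intro e he hb
    unfold C2
    rw [continuous_iff_continuousAt]
    rintro ⟨x0, t0⟩
    have hO : IsOpen (Prod.snd ⁻¹' Iio (t0 + 1) : Set (ℝ × ℝ)) :=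
      isOpen_Iio.preimage continuous_snd
    have : ContinuousOn (fun q : ℝ × ℝ => ∑' N, e N (cl q.1) q.2) (Prod.snd ⁻¹' Iio (t0 + 1)) := by
      apply continuousOn_tsum (u := fun N => Q * (1 / 2) ^ N * Real.exp (γ * (t0 + 1)))
      · intro N
        exact ((he N).comp (by fun_prop) (by fun_prop)).continuousOn
      · exact sg.mul_right _
      · intro N q hq
        refine (hb N _ (cl_mem _) _).trans ?_
        refine mul_le_mul_of_nonneg_left ((kx _ (cl_mem _) _).trans ?_) (by positivity)
        apply Real.exp_le_exp.2
        have : q.2 < t0 + 1 := hq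
        nlinarith [h.γ0]
    exact this.continuousAt (hO.mem_nhds (by simp))
  have cw : ∀ j, C2 (w j) := fun j => contaux (fun N => d N j) (fun N => (hC N).c j)
    (fun N => (hC N).b j)
  have cw' : ∀ j, C2 (w' j) := fun j => contaux (fun N => d' N j) (fun N => (hC N).c' j)
    (fun N => (hC N).b' j)
  have bdaux : ∀ (e : ℕ → ℝ) (E : ℝ), (∀ N, |e N| ≤ Q * (1 / 2) ^ N * E) →
      |∑' N, e N| ≤ 2 * Q * E := by
    intro e E he
    have h1 := (sg.hasSum.mul_right E)
    rw [sg2] at h1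
    exact tsum_of_norm_bounded (f := e) h1 he
  have bw : ∀ j, ∀ x ∈ Icc (0:ℝ) 1, ∀ t, |w j x t| ≤ 2 * Q * Real.exp (γ * t - κ * x) := by
    intro j x hx t
    simp only [w, cl_of hx]
    exact bdaux _ _ fun N => (hC N).b j x hx t
  have bw' : ∀ j, ∀ x ∈ Icc (0:ℝ) 1, ∀ t, |w' j x t| ≤ 2 * Q * Real.exp (γ * t - κ * x) := by
    intro j x hx t
    simp only [w', cl_of hx]
    exact bdaux _ _ fun N => (hC N).b' j x hx t
  refine ⟨w, w', ⟨cw, cw', ?_, bw, bw'⟩, ?_, ?_⟩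
  · intro j x t
    refine hasDerivAt_tsum_of_isPreconnected (u := fun N => Q * (1 / 2) ^ N * Real.exp (γ * (t + 1)))
      (g := fun N t => d N j (cl x) t) (g' := fun N t => d' N j (cl x) t)
      (sg.mul_right _) (isOpen_Iio (a := t + 1)) isPreconnected_Iio
      (fun N s _ => (hC N).d j (cl x) s) ?_ (y₀ := t) (by simp) (sb j _ (cl_mem x) t) (by simp)
    intro N s hs
    refine ((hC N).b' j _ (cl_mem _) _).trans ?_
    refine mul_le_mul_of_nonneg_left ((kx _ (cl_mem _) _).trans ?_) (by positivity)
    apply Real.exp_le_exp.2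
    have : s < t + 1 := hs
    nlinarith [h.γ0]
  · -- mild equation
    let W : ℕ → Fin n → ℝ → ℝ → ℝ := fun N j x t => ∑ i ∈ Finset.range N, d i j x t
    have cW : ∀ N j, C2 (W N j) := fun N j => C2.sum _ fun i _ => (hC i).c j
    have WT : ∀ N j x t, W (N + 1) j x t = G.S g j x t + G.T β (W N) j x t := by
      intro N
      induction N with
      | zero =>
        intro j x t
        have : G.T β (W 0) j x t = 0 := by
          simp [T, Spd.L, W, bd, cp]
        rw [this]; simp [W, hd, dd]
      | succ N ih =>
        intro j x t
        have e1 : G.T β (W (N + 1)) j x t - G.T β (W N) j x t = d (N + 1) j x t := by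
          rw [← G.T_sub hβ.c (cW _) (cW _)]
          have : (fun k x t => W (N + 1) k x t - W N k x t) = d N := by
            funext k x t
            simp only [W, Finset.sum_range_succ]; ring
          rw [this]; rfl
        have e2 : W (N + 1 + 1) j x t = W (N + 1) j x t + d (N + 1) j x t := by
          simp only [W]; rw [Finset.sum_range_succ _ (N + 1)]
        rw [e2, ih, ← e1]; ring
    have diff : ∀ N j, ∀ x ∈ Icc (0:ℝ) 1, ∀ t, |w j x t - W N j x t| ≤
        (2 * Q * (1 / 2) ^ N) * Real.exp (γ * t - κ * x) := by
      intro N j x hx t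
      simp only [w, W, cl_of hx]
      have e := (sb j x hx t).sum_add_tsum_nat_add N
      have : ∑' i, d i j x t - ∑ i ∈ Finset.range N, d i j x t = ∑' i, d (i + N) j x t := by
        rw [← e]; ring
      rw [this, mul_assoc]
      apply bdaux
      intro i
      refine ((hC (i + N)).b j x hx t).trans (le_of_eq ?_)
      rw [pow_add]; ring
    intro j x hx t
    rw [G.L_split hβ.c cw hg.c]
    have key : ∀ N : ℕ, |w j x t - (G.S g j x t + G.T β w j x t)| ≤
        (4 * Q * Real.exp (γ * t - κ * x)) * (1 / 2) ^ N := by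
      intro N
      have h1 := diff (N + 1) j x hx t
      have h2 := G.T_bd h hβ.B0 hβ.b (by positivity) (diff N) j x hx t
      rw [G.T_sub hβ.c cw (cW N)] at h2
      have h3 := WT N j x t
      have : w j x t - (G.S g j x t + G.T β w j x t) =
        (w j x t - W (N + 1) j x t) - (G.T β w j x t - G.T β (W N) j x t) := by rw [h3]; ring
      rw [this]
      refine (abs_sub _ _).trans ((add_le_add h1 h2).trans ?_)
      rw [pow_succ]
      have : 0 ≤ Q * Real.exp (γ * t - κ * x) * (1 / 2) ^ N := by positivity
      nlinarith
    have lim : Tendsto (fun N : ℕ => (4 * Q * Real.exp (γ * t - κ * x)) * (1 / 2 : ℝ) ^ N) atTop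
        (nhds ((4 * Q * Real.exp (γ * t - κ * x)) * 0)) :=
      (tendsto_pow_atTop_nhds_zero_of_lt_one (by norm_num) (by norm_num)).const_mul _
    have := ge_of_tendsto' lim key
    rw [mul_zero] at this
    exact sub_eq_zero.1 (abs_eq_zero.1 (le_antisymm this (abs_nonneg _)))
  · intro Z hZ hgZ j x hx t hz
    simp only [w, cl_of hx]
    have : ∀ N, d N j x t = 0 := fun N => G.dd_zero hZ hgZ N j x hx t hz
    simp [this]

/-- The coefficients of the differentiated problem. -/
def β1 (β : Fin n → Fin n → ℝ → ℝ → ℝ) (j k : Fin n) (x t : ℝ) : ℝ :=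
  β j k x t + if j = k then G.αt j x t else 0

/-- The time derivative of a mild solution is a mild solution. -/
theorem mild_der (hβ : Cf β βt B) (hg : ∀ j, C2 (g j)) (hg' : ∀ j, C2 (g' j))
    (hgd : ∀ j x t, HasDerivAt (g j x) (g' j x t) t)
    (cy : ∀ j, C2 (y j)) (cy' : ∀ j, C2 (y' j))
    (dy : ∀ j x t, HasDerivAt (y j x) (y' j x t) t) (hm : G.IsMild β g y) :
    G.IsMild (G.β1 β) (fun j x t => g' j x t - G.cp βt y j x t) y' := by
  set k' := fun j x t => g' j x t - (G.cp βt y j x t + G.cp β y' j x t) with hk'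
  have ck' : ∀ j, C2 (k' j) := fun j => Continuous.sub (hg' j)
    (Continuous.add (G.cp_cont hβ.c' cy j) (G.cp_cont hβ.c cy' j))
  have e1 : ∀ j, ∀ x ∈ Icc (0:ℝ) 1, ∀ t, y' j x t = (G.hα j).L' (G.bd y' j) (k' j) x t := by
    intro j x hx t
    have h1 := (G.hα j).L_der (k := fun x t => g j x t - G.cp β y j x t) (k' := k' j)
      (G.bd_der dy j) (Continuous.sub (hg j) (G.cp_cont hβ.c cy j)) (ck' j)
      (fun x t => (hgd j x t).sub (G.cp_der hβ dy j x t)) x t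
    have h2 : (G.hα j).L (G.bd y j) (fun x t => g j x t - G.cp β y j x t) x = y j x := by
      funext t; exact (hm j x hx t).symm
    rw [h2] at h1
    exact (dy j x t).unique h1
  intro j x hx t
  rw [e1 j x hx t, (G.hα j).L'_eq (G.bd_cont cy' j) (ck' j)]
  simp only [Spd.L]
  congr 1
  apply intervalIntegral.integral_congr
  intro ξ hξ
  rw [uIcc_of_le hx.1] at hξ
  have hξI : ξ ∈ Icc (0:ℝ) 1 := ⟨hξ.1, hξ.2.trans hx.2⟩
  simp only
  rw [← e1 j ξ hξI]
  simp only [hk', cp, β1, add_mul, Finset.sum_add_distrib, ite_mul, zero_mul, Finset.sum_ite_eq,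
    Finset.mem_univ, if_true, G.hrr]
  ring

/-- A mild solution is differentiable in `x`. -/
theorem mild_x (hβ : ∀ j k, C2 (β j k)) (hg : ∀ j, C2 (g j))
    (cy : ∀ j, C2 (y j)) (cy' : ∀ j, C2 (y' j))
    (dy : ∀ j x t, HasDerivAt (y j x) (y' j x t) t) (hm : G.IsMild β g y) (j : Fin n)
    {x : ℝ} (hx : x ∈ Icc (0:ℝ) 1) (t : ℝ) :
    HasDerivWithinAt (fun ξ => y j ξ t)
      (g j x t - G.cp β y j x t - y' j x t * G.α j x t) (Icc 0 1) x := by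
  have h1 := (G.hα j).slope_aux (cy' j) (dy j) x t
  set k := fun x t => g j x t - G.cp β y j x t with hk
  have ck : C2 k := Continuous.sub (hg j) (G.cp_cont hβ cy j)
  have ckc : Continuous fun η => k η ((G.hα j).tau η x t) := ck.comp (by fun_prop) (by fun_prop)
  have h2 : HasDerivAt (fun ξ => G.bd y j ((G.hα j).tau 0 x t) +
      ∫ η in (0:ℝ)..ξ, k η ((G.hα j).tau η x t)) (k x ((G.hα j).tau x x t)) x :=
    (intervalIntegral.integral_hasDerivAt_right (ckc.intervalIntegrable _ _)
      ckc.stronglyMeasurable.stronglyMeasurableAtFilter ckc.continuousAt).const_add _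
  rw [(G.hα j).tau_self] at h2
  refine (h2.sub h1).hasDerivWithinAt.congr_of_mem ?_ hx
  intro ξ hξ
  have h3 := hm j ξ hξ ((G.hα j).tau ξ x t)
  rw [(G.hα j).L_char] at h3
  simp only [Pi.sub_apply]
  rw [← h3]; ring

lemma β1_Cf (hβ : Cf β βt B) {αtt : Fin n → ℝ → ℝ → ℝ} (ctt : ∀ j, C2 (αtt j))
    (dtt : ∀ j x t, HasDerivAt (G.αt j x) (αtt j x t) t) {A2 : ℝ} (hA2 : G.A ≤ A2)
    (btt : ∀ j x t, |αtt j x t| ≤ A2) :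
    Cf (G.β1 β) (fun j k x t => βt j k x t + if j = k then αtt j x t else 0) (B + |A2|) := by
  have hB := hβ.B0
  refine ⟨by positivity, ?_, ?_, ?_, ?_, ?_⟩
  · intro j k; unfold β1
    by_cases e : j = k
    · simp only [e, if_true]; exact Continuous.add (hβ.c _ _) (G.hα _).cat
    · simpa only [e, if_false, add_zero] using hβ.c j k
  · intro j k
    by_cases e : j = k
    · simp only [e, if_true]; exact Continuous.add (hβ.c' _ _) (ctt _)
    · simpa only [e, if_false, add_zero] using hβ.c' j k
  · intro j k x t; unfold β1
    by_cases e : j = k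
    · simp only [e, if_true]; exact (hβ.d _ _ _ _).add (dtt _ _ _)
    · simpa only [e, if_false, add_zero] using hβ.d j k x t
  · intro j k x t; unfold β1
    refine (abs_add_le _ _).trans (add_le_add (hβ.b j k x t) ?_)
    split_ifs
    · exact ((G.hα j).bdt x t).trans (hA2.trans (le_abs_self _))
    · simp
  · intro j k x t
    refine (abs_add_le _ _).trans (add_le_add (hβ.b' j k x t) ?_)
    split_ifs
    · exact (btt j x t).trans (le_abs_self _)
    · simp
end Geo

end Part4

section Part5
/-- Weighted regularity in time. -/
structure Rg (γ C : ℝ) (g gt : ℝ → ℝ → ℝ) : Prop where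
  c : C2 g
  ct : C2 gt
  d : ∀ x t, HasDerivAt (g x) (gt x t) t
  b : ∀ x t, |g x t| ≤ C * Real.exp (γ * t)
  bt : ∀ x t, |gt x t| ≤ C * Real.exp (γ * t)

structure Sc1 (γ C : ℝ) (g gx gt : ℝ → ℝ → ℝ) : Prop where
  r : Rg γ C g gt
  cx : C2 gx
  dx : ∀ x ∈ Icc (0:ℝ) 1, ∀ t, HasDerivWithinAt (fun y => g y t) (gx x t) (Icc 0 1) x
  bx : ∀ x t, |gx x t| ≤ C * Real.exp (γ * t)

structure Sc2 (γ C : ℝ) (g gx gt gtt : ℝ → ℝ → ℝ) : Prop where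
  s : Sc1 γ C g gx gt
  r2 : Rg γ C gt gtt

namespace Rg
variable {γ γ' C C' : ℝ} {f ft g gt : ℝ → ℝ → ℝ}

lemma C0 (h : Rg γ C f ft) : 0 ≤ C := by
  have := (abs_nonneg _).trans (h.b 0 0); simpa using this

lemma mono (h : Rg γ C f ft) (hC : C ≤ C') : Rg γ C' f ft :=
  ⟨h.c, h.ct, h.d, fun x t => (h.b x t).trans (by gcongr), fun x t => (h.bt x t).trans (by gcongr)⟩

lemma mul_bd {a b C C' : ℝ} {t : ℝ} (hC : 0 ≤ C) (ha : |a| ≤ C * Real.exp (γ * t))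
    (hb : |b| ≤ C' * Real.exp (γ' * t)) : |a * b| ≤ C * C' * Real.exp ((γ + γ') * t) := by
  rw [abs_mul]
  refine (mul_le_mul ha hb (abs_nonneg _) (by positivity)).trans (le_of_eq ?_)
  rw [add_mul, Real.exp_add]; ring

lemma mul (hf : Rg γ C f ft) (hg : Rg γ' C' g gt) :
    Rg (γ + γ') (2 * (C * C')) (fun x t => f x t * g x t)
      (fun x t => ft x t * g x t + f x t * gt x t) := by
  have := hf.C0
  have := hg.C0
  refine ⟨Continuous.mul hf.c hg.c, (Continuous.mul hf.ct hg.c).add (Continuous.mul hf.c hg.ct),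
    fun x t => (hf.d x t).mul (hg.d x t), fun x t => ?_, fun x t => ?_⟩
  · have := mul_bd hf.C0 (hf.b x t) (hg.b x t)
    have : 0 ≤ C * C' * Real.exp ((γ + γ') * t) := by positivity
    linarith
  · have h1 := mul_bd hf.C0 (hf.bt x t) (hg.b x t)
    have h2 := mul_bd hf.C0 (hf.b x t) (hg.bt x t)
    have := abs_add_le (ft x t * g x t) (f x t * gt x t)
    linarith

lemma add (hf : Rg γ C f ft) (hg : Rg γ C' g gt) :
    Rg γ (C + C') (fun x t => f x t + g x t) (fun x t => ft x t + gt x t) := by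
  refine ⟨Continuous.add hf.c hg.c, Continuous.add hf.ct hg.ct,
    fun x t => (hf.d x t).add (hg.d x t), fun x t => ?_, fun x t => ?_⟩
  · rw [add_mul]; exact (abs_add_le _ _).trans (add_le_add (hf.b x t) (hg.b x t))
  · rw [add_mul]; exact (abs_add_le _ _).trans (add_le_add (hf.bt x t) (hg.bt x t))

lemma comp (hf : Rg γ C f ft) {ρ : ℝ → ℝ} (hρ : Continuous ρ) :
    Rg γ C (fun x t => f (ρ x) t) (fun x t => ft (ρ x) t) :=
  ⟨hf.c.comp (hρ.comp continuous_fst) continuous_snd,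
   hf.ct.comp (hρ.comp continuous_fst) continuous_snd,
   fun _ t => hf.d _ t, fun _ t => hf.b _ t, fun _ t => hf.bt _ t⟩
end Rg

lemma Sc1.mul {γ γ' C C' : ℝ} {f fx ft g gx gt : ℝ → ℝ → ℝ} (hf : Sc1 γ C f fx ft)
    (hg : Sc1 γ' C' g gx gt) :
    Sc1 (γ + γ') (2 * (C * C')) (fun x t => f x t * g x t)
      (fun x t => fx x t * g x t + f x t * gx x t)
      (fun x t => ft x t * g x t + f x t * gt x t) := by
  refine ⟨hf.r.mul hg.r, (Continuous.mul hf.cx hg.r.c).add (Continuous.mul hf.r.c hg.cx),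
    fun x hx t => (hf.dx x hx t).mul (hg.dx x hx t), fun x t => ?_⟩
  have h1 := Rg.mul_bd hf.r.C0 (hf.bx x t) (hg.r.b x t)
  have h2 := Rg.mul_bd hf.r.C0 (hf.r.b x t) (hg.bx x t)
  have := abs_add_le (fx x t * g x t) (f x t * gx x t)
  linarith

lemma Sc1.mono {γ C C' : ℝ} {f fx ft : ℝ → ℝ → ℝ} (hf : Sc1 γ C f fx ft) (hC : C ≤ C') :
    Sc1 γ C' f fx ft :=
  ⟨hf.r.mono hC, hf.cx, hf.dx, fun x t => (hf.bx x t).trans (by gcongr)⟩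

lemma Sc2.mono {γ C C' : ℝ} {f fx ft ftt : ℝ → ℝ → ℝ} (hf : Sc2 γ C f fx ft ftt) (hC : C ≤ C') :
    Sc2 γ C' f fx ft ftt := ⟨hf.s.mono hC, hf.r2.mono hC⟩

lemma Sc2.mul {γ γ' C C' : ℝ} {f fx ft ftt g gx gt gtt : ℝ → ℝ → ℝ} (hf : Sc2 γ C f fx ft ftt)
    (hg : Sc2 γ' C' g gx gt gtt) :
    Sc2 (γ + γ') (4 * (C * C')) (fun x t => f x t * g x t)
      (fun x t => fx x t * g x t + f x t * gx x t)
      (fun x t => ft x t * g x t + f x t * gt x t)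
      (fun x t => (ftt x t * g x t + ft x t * gt x t) + (ft x t * gt x t + f x t * gtt x t)) := by
  have h1 := hf.s.r.C0
  have h2 := hg.s.r.C0
  have h3 := mul_nonneg h1 h2
  refine ⟨(hf.s.mul hg.s).mono (by linarith), ?_⟩
  exact ((hf.r2.mul hg.s.r).add (hf.s.r.mul hg.r2)).mono (by linarith)

lemma strip_unique : UniqueDiffOn ℝ strip :=
  (uniqueDiffOn_Icc zero_lt_one).prod uniqueDiffOn_univ

lemma ext1 {G : ℝ × ℝ → ℝ} {C : ℝ} (hG : ContDiffOn ℝ 1 G strip) (b0 : ∀ q ∈ strip, |G q| ≤ C)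
    (b1 : ∀ q ∈ strip, ‖fderivWithin ℝ G strip q‖ ≤ C) :
    Sc1 0 C (fun x t => G (cl x, t)) (fun x t => fderivWithin ℝ G strip (cl x, t) (1, 0))
      (fun x t => fderivWithin ℝ G strip (cl x, t) (0, 1)) := by
  have hm : ∀ x t, (cl x, t) ∈ strip := fun x t => ⟨cl_mem x, mem_univ _⟩
  have hD : ∀ q ∈ strip, HasFDerivWithinAt G (fderivWithin ℝ G strip q) strip q := fun q hq =>
    (hG.differentiableOn (by norm_num) q hq).hasFDerivWithinAt
  have hc := hG.continuousOn_fderivWithin strip_unique (by norm_num)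
  have hcc : Continuous fun q : ℝ × ℝ => fderivWithin ℝ G strip (cl q.1, q.2) :=
    hc.comp_continuous (by fun_prop) fun q => hm _ _
  have bb : ∀ v : ℝ × ℝ, ‖v‖ ≤ 1 → ∀ x t, |fderivWithin ℝ G strip (cl x, t) v| ≤ C := by
    intro v hv x t
    have h1 := (fderivWithin ℝ G strip (cl x, t)).le_opNorm v
    have h2 := b1 _ (hm x t)
    rw [Real.norm_eq_abs] at h1
    have := norm_nonneg (fderivWithin ℝ G strip (cl x, t))
    nlinarith [norm_nonneg v]
  refine ⟨⟨?_, ?_, ?_, ?_, ?_⟩, ?_, ?_, ?_⟩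
  · exact hG.continuousOn.comp_continuous (by fun_prop) fun q => hm _ _
  · exact hcc.clm_apply continuous_const
  · intro x t
    have h1 : HasDerivWithinAt (fun t : ℝ => (cl x, t)) ((0:ℝ), (1:ℝ)) univ t :=
      ((hasDerivAt_const t (cl x)).prodMk (hasDerivAt_id t)).hasDerivWithinAt
    have := (hD _ (hm x t)).comp_hasDerivWithinAt t h1 (fun s _ => hm x s)
    exact this.hasDerivAt univ_mem
  · intro x t; simpa using b0 _ (hm x t)
  · intro x t; simpa using bb (0, 1) (by simp [Prod.norm_def]) x t
  · exact hcc.clm_apply continuous_const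
  · intro x hx t
    have h1 : HasDerivWithinAt (fun y : ℝ => (y, t)) ((1:ℝ), (0:ℝ)) (Icc 0 1) x :=
      ((hasDerivAt_id x).prodMk (hasDerivAt_const x t)).hasDerivWithinAt
    have hs : (x, t) ∈ strip := ⟨hx, mem_univ _⟩
    have := (hD _ hs).comp_hasDerivWithinAt x h1
      (show MapsTo (fun y : ℝ => (y, t)) (Icc 0 1) strip from fun s hs => ⟨hs, mem_univ _⟩)
    rw [cl_of hx]
    refine this.congr_of_mem (fun y hy => ?_) hx
    simp [cl_of hy]
  · intro x t; simpa using bb (1, 0) (by simp [Prod.norm_def]) x t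

lemma BCle.ext1 {g : ℝ → ℝ → ℝ} {C : ℝ} (h : BCle 1 g C) :
    ∃ gx gt, Sc1 0 C (fun x t => g (cl x) t) gx gt := by
  refine ⟨_, _, _root_.ext1 (G := fun q => g q.1 q.2) (by exact_mod_cast h.1) ?_ ?_⟩
  · intro q hq; simpa using h.2 0 (by norm_num) q hq
  · intro q hq
    have := h.2 1 le_rfl q hq
    rwa [norm_iteratedFDerivWithin_one _ (strip_unique q hq)] at this

lemma BCle.ext2 {g : ℝ → ℝ → ℝ} {C : ℝ} (h : BCle 2 g C) :
    ∃ gx gt gtt, Sc2 0 C (fun x t => g (cl x) t) gx gt gtt := by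
  have h2 : ContDiffOn ℝ 2 (fun q : ℝ × ℝ => g q.1 q.2) strip := by exact_mod_cast h.1
  have hb1 : ∀ q ∈ strip, ‖fderivWithin ℝ (fun q : ℝ × ℝ => g q.1 q.2) strip q‖ ≤ C := by
    intro q hq
    have := h.2 1 (by norm_num) q hq
    rwa [norm_iteratedFDerivWithin_one _ (strip_unique q hq)] at this
  have h1 := _root_.ext1 (G := fun q => g q.1 q.2) (h2.of_le (by norm_num))
    (fun q hq => by simpa using h.2 0 (by norm_num) q hq) hb1
  have hD : ContDiffOn ℝ 1 (fderivWithin ℝ (fun q : ℝ × ℝ => g q.1 q.2) strip) strip :=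
    h2.fderivWithin strip_unique (by norm_num)
  have h3 := _root_.ext1 (G := fun q => fderivWithin ℝ (fun q : ℝ × ℝ => g q.1 q.2) strip q (0, 1))
    (C := C) (hD.clm_apply contDiffOn_const) (fun q hq => by
      have h1 := (fderivWithin ℝ (fun q : ℝ × ℝ => g q.1 q.2) strip q).le_opNorm (0, 1)
      rw [Real.norm_eq_abs] at h1
      have : ‖((0:ℝ), (1:ℝ))‖ = 1 := by simp [Prod.norm_def]
      rw [this, mul_one] at h1
      exact h1.trans (hb1 q hq)) (fun q hq => by
      have hd := (hD.differentiableOn (by norm_num) q hq).hasFDerivWithinAt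
      have hd2 := hd.clm_apply (hasFDerivWithinAt_const ((0:ℝ), (1:ℝ)) q strip)
      rw [hd2.fderivWithin (strip_unique q hq)]
      have hC0 : 0 ≤ C := (norm_nonneg _).trans (hb1 q hq)
      apply ContinuousLinearMap.opNorm_le_bound _ hC0
      intro v
      have e := h.2 2 le_rfl q hq
      rw [← norm_iteratedFDerivWithin_fderivWithin strip_unique hq,
        norm_iteratedFDerivWithin_one _ (strip_unique q hq)] at e
      simp only [ContinuousLinearMap.comp_zero, zero_add]
      have h4 := (fderivWithin ℝ (fderivWithin ℝ (fun q : ℝ × ℝ => g q.1 q.2) strip) strip q).le_opNorm v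
      have h5 := (fderivWithin ℝ (fderivWithin ℝ (fun q : ℝ × ℝ => g q.1 q.2) strip) strip q v).le_opNorm
        (0, 1)
      have : ‖((0:ℝ), (1:ℝ))‖ = 1 := by simp [Prod.norm_def]
      rw [this, mul_one] at h5
      refine h5.trans (h4.trans ?_)
      gcongr)
  exact ⟨_, _, _, h1, h3.r⟩

lemma Sc2.inv {c C : ℝ} (hc : 0 < c) {g gx gt gtt : ℝ → ℝ → ℝ} (h : Sc2 0 C g gx gt gtt)
    (hg : ∀ x t, c ≤ g x t) :
    ∃ C' gx' gt' gtt', Sc2 0 C' (fun x t => (g x t)⁻¹) gx' gt' gtt' := by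
  have hp : ∀ x t, 0 < g x t := fun x t => hc.trans_le (hg x t)
  have hne : ∀ x t, g x t ≠ 0 := fun x t => (hp x t).ne'
  have ci : C2 (fun x t => (g x t)⁻¹) := Continuous.inv₀ h.s.r.c fun q => hne _ _
  have bi : ∀ x t, |(g x t)⁻¹| ≤ c⁻¹ := by
    intro x t
    rw [abs_of_pos (inv_pos.2 (hp x t))]
    exact inv_anti₀ hc (hg x t)
  have C0 := h.s.r.C0
  -- first order data
  have S1 : Sc1 0 (c⁻¹ + c⁻¹ ^ 2 * C) (fun x t => (g x t)⁻¹)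
      (fun x t => -gx x t / (g x t) ^ 2) (fun x t => -gt x t / (g x t) ^ 2) := by
    have bb : ∀ u : ℝ → ℝ → ℝ, (∀ x t, |u x t| ≤ C * Real.exp (0 * t)) → ∀ x t,
        |-u x t / (g x t) ^ 2| ≤ (c⁻¹ + c⁻¹ ^ 2 * C) * Real.exp (0 * t) := by
      intro u hu x t
      have h1 := hu x t
      simp only [zero_mul, Real.exp_zero, mul_one] at h1 ⊢
      rw [neg_div, abs_neg, div_eq_mul_inv, ← inv_pow, abs_mul, abs_pow]
      have h2 := pow_le_pow_left₀ (abs_nonneg _) (bi x t) 2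
      have h3 := mul_le_mul h1 h2 (by positivity) C0
      have : 0 < c⁻¹ := inv_pos.2 hc
      linarith
    refine ⟨⟨ci, ?_, ?_, ?_, ?_⟩, ?_, ?_, ?_⟩
    · exact (Continuous.neg h.s.r.ct).div₀ (Continuous.pow h.s.r.c 2) fun q => pow_ne_zero _ (hne _ _)
    · exact fun x t => (h.s.r.d x t).inv (hne x t)
    · intro x t
      simp only [zero_mul, Real.exp_zero, mul_one]
      have : 0 ≤ c⁻¹ ^ 2 * C := by positivity
      linarith [bi x t]
    · exact bb gt h.s.r.bt
    · exact (Continuous.neg h.s.cx).div₀ (Continuous.pow h.s.r.c 2) fun q => pow_ne_zero _ (hne _ _)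
    · exact fun x hx t => (h.s.dx x hx t).inv (hne x t)
    · exact bb gx h.s.bx
  have hng : Rg 0 C (fun x t => -gt x t) (fun x t => -gtt x t) :=
    ⟨Continuous.neg h.r2.c, Continuous.neg h.r2.ct, fun x t => (h.r2.d x t).neg,
      fun x t => by rw [abs_neg]; exact h.r2.b x t, fun x t => by rw [abs_neg]; exact h.r2.bt x t⟩
  have R2 := hng.mul (S1.r.mul S1.r)
  simp only [add_zero] at R2
  have e : (fun x t => -gt x t * ((g x t)⁻¹ * (g x t)⁻¹)) = fun x t => -gt x t / (g x t) ^ 2 := by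
    funext x t; rw [div_eq_mul_inv, sq, mul_inv]
  rw [e] at R2
  exact ⟨_, _, _, _, (S1.mono (le_max_left _ _)), R2.mono (le_max_right _ _)⟩

end Part5

section Part6
/-- Second order regularity in time of mild solutions. -/
theorem Geo.core2 {n : ℕ} (G : Geo n) {β βt βtt : Fin n → Fin n → ℝ → ℝ → ℝ} {B γ κ M : ℝ}
    {g g' g'' αtt : Fin n → ℝ → ℝ → ℝ} {A2 : ℝ}
    (h : Geo.Gd G (B + |A2|) γ κ) (hβ : Cf β βt B) (hβt : Cf βt βtt B)
    (ctt : ∀ j, C2 (αtt j)) (dtt : ∀ j x t, HasDerivAt (G.αt j x) (αtt j x t) t)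
    (hA2 : G.A ≤ A2) (btt : ∀ j x t, |αtt j x t| ≤ A2)
    {w w' : Fin n → ℝ → ℝ → ℝ} (hw : Cl γ κ (2 * (G.D γ κ * M)) w w') (hm : G.IsMild β g w)
    (hg : Geo.Rhs γ M g g') (hg' : Geo.Rhs γ M g' g'') :
    ∃ M1 : ℝ, M1 = M + 2 * (n * (B + |A2|) * (2 * (G.D γ κ * M))) ∧
    ∃ v v' : Fin n → ℝ → ℝ → ℝ, Cl γ κ (2 * (G.D γ κ * M1)) v v' ∧
      G.IsMild (G.β1 β) (fun j x t => g' j x t - G.cp βt w j x t) v ∧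
      (∀ j, C2 (fun x t => g' j x t - G.cp βt w j x t)) ∧
      (∀ j k, C2 (G.β1 β j k)) ∧
      (∀ j k x t, |G.β1 β j k x t| ≤ B + |A2|) ∧
      (∀ j, ∀ x ∈ Icc (0:ℝ) 1, ∀ t, |g' j x t - G.cp βt w j x t| ≤ M1 * Real.exp (γ * t)) ∧
      (∀ j, ∀ x ∈ Icc (0:ℝ) 1, ∀ t, v j x t = w' j x t) := by
  have hB0 := hβ.B0
  have hD := G.D0 h
  have hM := hg.M0
  have hBA : 0 ≤ B + |A2| := by positivity
  have hBt : ∀ j k x t, |βt j k x t| ≤ B + |A2| := fun j k x t =>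
    (hβt.b j k x t).trans (by linarith [abs_nonneg A2])
  have hBtt : ∀ j k x t, |βtt j k x t| ≤ B + |A2| := fun j k x t =>
    (hβt.b' j k x t).trans (by linarith [abs_nonneg A2])
  have hCf := G.β1_Cf hβ ctt dtt hA2 btt
  set M1 := M + 2 * (n * (B + |A2|) * (2 * (G.D γ κ * M))) with hM1
  have hM10 : 0 ≤ n * (B + |A2|) * (2 * (G.D γ κ * M)) := by positivity
  have R1 : Geo.Rhs γ M1 (fun j x t => g' j x t - G.cp βt w j x t)
      (fun j x t => g'' j x t - (G.cp βtt w j x t + G.cp βt w' j x t)) := by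
    refine ⟨by linarith, ?_, ?_, ?_, ?_, ?_⟩
    · exact fun j => Continuous.sub (hg'.c j) (G.cp_cont hβ.c' hw.c j)
    · exact fun j => Continuous.sub (hg'.c' j)
        (Continuous.add (G.cp_cont hβt.c' hw.c j) (G.cp_cont hβt.c hw.c' j))
    · exact fun j x t => (hg'.d j x t).sub (G.cp_der hβt hw.d j x t)
    · intro j x hx t
      have h1 := hg'.b j x hx t
      have h2 := G.cp_bd h hBA hBt (by positivity) hw.b j hx t
      refine (abs_sub _ _).trans ((add_le_add h1 h2).trans ?_)
      rw [← add_mul]; gcongr; linarith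
    · intro j x hx t
      have h1 := hg'.b' j x hx t
      have h2 := G.cp_bd h hBA hBtt (by positivity) hw.b j hx t
      have h3 := G.cp_bd h hBA hBt (by positivity) hw.b' j hx t
      refine (abs_sub _ _).trans ((add_le_add h1 ((abs_add_le _ _).trans (add_le_add h2 h3))).trans ?_)
      rw [← add_mul, ← add_mul]; gcongr; linarith
  obtain ⟨v, v', hv, hvm, -⟩ := G.core h hCf R1
  refine ⟨M1, rfl, v, v', hv, hvm, R1.c, hCf.c, hCf.b, R1.b, ?_⟩
  have hmd := G.mild_der hβ hg.c hg.c' hg.d hw.c hw.c' hw.d hm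
  have kx : ∀ x ∈ Icc (0:ℝ) 1, ∀ t, Real.exp (γ * t - κ * x) ≤ Real.exp (γ * t) := by
    intro x hx t
    apply Real.exp_le_exp.2
    have := mul_nonneg h.κ0 hx.1
    linarith
  have hMM : 0 ≤ M1 := by linarith
  refine G.uniq h hCf R1.c hv.c hw.c' hvm hmd
    (M := 2 * (G.D γ κ * M1) + 2 * (G.D γ κ * M)) ?_ ?_
  · intro j x hx t
    refine (hv.b j x hx t).trans ?_
    have h1 := kx x hx t
    have : 0 ≤ 2 * (G.D γ κ * M) := by positivity
    exact mul_le_mul (by linarith) h1 (by positivity) (by positivity)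
  · intro j x hx t
    refine (hw.b' j x hx t).trans ?_
    have h1 := kx x hx t
    have : 0 ≤ 2 * (G.D γ κ * M1) := by positivity
    exact mul_le_mul (by linarith) h1 (by positivity) (by positivity)

/-- Reflection. -/
def rho (m j : ℕ) (x : ℝ) : ℝ := if j < m then x else 1 - x
def sg (m j : ℕ) : ℝ := if j < m then 1 else -1

lemma rho_rho (m j : ℕ) (x : ℝ) : rho m j (rho m j x) = x := by unfold rho; split_ifs <;> ring
@[fun_prop]
lemma rho_cont (m j : ℕ) : Continuous (rho m j) := by unfold rho; split_ifs <;> fun_prop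
lemma rho_mem (m j : ℕ) {x : ℝ} (hx : x ∈ Icc (0:ℝ) 1) : rho m j x ∈ Icc (0:ℝ) 1 := by
  unfold rho; split_ifs
  · exact hx
  · exact ⟨by linarith [hx.2], by linarith [hx.1]⟩
lemma sg_sq (m j : ℕ) : sg m j * sg m j = 1 := by unfold sg; split_ifs <;> norm_num
lemma sg_abs (m j : ℕ) : |sg m j| = 1 := by unfold sg; split_ifs <;> norm_num
lemma rho_der (m j : ℕ) (x : ℝ) : HasDerivAt (rho m j) (sg m j) x := by
  unfold rho sg; split_ifs
  · exact hasDerivAt_id x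
  · exact (hasDerivAt_id x).const_sub 1

lemma rho_comp_der (m j : ℕ) {y : ℝ → ℝ} {d x : ℝ}
    (h : HasDerivWithinAt y d (Icc 0 1) (rho m j x)) :
    HasDerivWithinAt (fun ξ => y (rho m j ξ)) (sg m j * d) (Icc 0 1) x := by
  have := h.scomp x (rho_der m j x).hasDerivWithinAt (fun ξ hξ => rho_mem m j hξ)
  exact this

/-- Normalized data of the hyperbolic system, in the original coordinates. -/
structure Sys (n m : ℕ) (p : Fin n → Fin n → ℝ)
    (a : ℝ → ℝ → Fin n → ℝ) (b : ℝ → ℝ → Fin n → Fin n → ℝ) where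
  α : Fin n → ℝ → ℝ → ℝ
  αx : Fin n → ℝ → ℝ → ℝ
  αt : Fin n → ℝ → ℝ → ℝ
  αtt : Fin n → ℝ → ℝ → ℝ
  β : Fin n → Fin n → ℝ → ℝ → ℝ
  βx : Fin n → Fin n → ℝ → ℝ → ℝ
  βt : Fin n → Fin n → ℝ → ℝ → ℝ
  βtt : Fin n → Fin n → ℝ → ℝ → ℝ
  C : ℝ
  c : ℝ
  P : ℝ
  C0 : 0 ≤ C
  hα : ∀ j, Sc2 0 C (α j) (αx j) (αt j) (αtt j)
  hβ : ∀ j k, Sc2 0 C (β j k) (βx j k) (βt j k) (βtt j k)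
  hc0 : 0 < c
  hc : ∀ j x t, c ≤ α j x t
  hP0 : 0 ≤ P
  hP : ∀ j k, |p j k| ≤ P
  haα : ∀ j, ∀ x ∈ Icc (0:ℝ) 1, ∀ t, a x t j * α j x t = sg m j
  hbβ : ∀ j k, ∀ x ∈ Icc (0:ℝ) 1, ∀ t, β j k x t = α j x t * b x t j k

/-- Classical solutions on the whole strip. -/
structure CSol {n : ℕ} (m : ℕ) (p : Fin n → Fin n → ℝ)
    (a : ℝ → ℝ → Fin n → ℝ) (b : ℝ → ℝ → Fin n → Fin n → ℝ)
    (f w wx wt : Fin n → ℝ → ℝ → ℝ) : Prop where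
  c : ∀ j, C2 (w j)
  cx : ∀ j, C2 (wx j)
  ct : ∀ j, C2 (wt j)
  dx : ∀ j, ∀ x ∈ Icc (0:ℝ) 1, ∀ t, HasDerivWithinAt (fun y => w j y t) (wx j x t) (Icc 0 1) x
  dt : ∀ j x t, HasDerivAt (w j x) (wt j x t) t
  pde : ∀ j, ∀ x ∈ Icc (0:ℝ) 1, ∀ t,
    wt j x t + a x t j * wx j x t + ∑ k, b x t j k * w k x t = f j x t
  bc : ∀ t, BCrel n m p (WithLp.toLp 2 fun j => w j 0 t) (WithLp.toLp 2 fun j => w j 1 t)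

namespace Sys
variable {n m : ℕ} {p : Fin n → Fin n → ℝ} {a : ℝ → ℝ → Fin n → ℝ} {b : ℝ → ℝ → Fin n → Fin n → ℝ}

theorem exists_sys (hab : ∃ C : ℝ, ∀ j : Fin n, BCle 2 (fun x t => a x t j) C ∧
      ∀ k : Fin n, BCle 2 (fun x t => b x t j k) C)
    {Λ₀ : ℝ} (hΛ₀ : 0 < Λ₀) (hLam : LamCond n m Λ₀ a) : Nonempty (Sys n m p a b) := by
  obtain ⟨C, hC⟩ := hab
  have ha : ∀ j, ∃ gx gt gtt, Sc2 0 C (fun x t => a (cl x) t j) gx gt gtt := fun j => (hC j).1.ext2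
  have hb : ∀ j k, ∃ gx gt gtt, Sc2 0 C (fun x t => b (cl x) t j k) gx gt gtt :=
    fun j k => ((hC j).2 k).ext2
  have hconst : ∀ j : Fin n, Sc2 0 1 (fun _ _ => sg m j) (fun _ _ => 0) (fun _ _ => 0) (fun _ _ => 0) := by
    intro j
    refine ⟨⟨⟨continuous_const, continuous_const, fun x t => hasDerivAt_const _ _, ?_, ?_⟩,
      continuous_const, fun x _ t => hasDerivWithinAt_const _ _ _, ?_⟩,
      ⟨continuous_const, continuous_const, fun x t => hasDerivAt_const _ _, ?_, ?_⟩⟩ <;>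
    intro x t <;> simp [sg_abs]
  have hlow : ∀ (j : Fin n) x t, Λ₀ ≤ sg m j * a (cl x) t j := by
    intro j x t
    have := (hLam (cl x) (cl_mem x) t).1 j
    unfold sg
    split_ifs with hj
    · simpa using this.1 hj
    · have := this.2 (by omega); linarith
  have hA : ∀ j : Fin n, ∃ C' gx gt gtt, Sc2 0 C' (fun x t => (sg m j * a (cl x) t j)⁻¹) gx gt gtt := by
    intro j
    obtain ⟨gx, gt, gtt, h⟩ := ha j
    have h2 := (hconst j).mul h
    simp only [add_zero] at h2
    exact h2.inv hΛ₀ (hlow j)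
  choose CA αx αt αtt hA using hA
  have hB : ∀ j k : Fin n, ∃ C' gx gt gtt, Sc2 0 C'
      (fun x t => (sg m j * a (cl x) t j)⁻¹ * b (cl x) t j k) gx gt gtt := by
    intro j k
    obtain ⟨gx, gt, gtt, h⟩ := hb j k
    have h2 := (hA j).mul h
    simp only [add_zero] at h2
    exact ⟨_, _, _, _, h2⟩
  choose CB βx βt βtt hB using hB
  have CA0 : ∀ j, 0 ≤ CA j := fun j => (hA j).s.r.C0
  have CB0 : ∀ j k, 0 ≤ CB j k := fun j k => (hB j k).s.r.C0
  set Ct := ∑ j, CA j + ∑ j, ∑ k, CB j k with hCt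
  have s1 : 0 ≤ ∑ j, CA j := Finset.sum_nonneg fun j _ => CA0 j
  have s2 : 0 ≤ ∑ j, ∑ k, CB j k := Finset.sum_nonneg fun j _ => Finset.sum_nonneg fun k _ => CB0 j k
  have l1 : ∀ j, CA j ≤ Ct := fun j => by
    have := Finset.single_le_sum (f := CA) (fun j _ => CA0 j) (Finset.mem_univ j)
    linarith
  have l2 : ∀ j k, CB j k ≤ Ct := fun j k => by
    have h1 := Finset.single_le_sum (f := fun j => ∑ k, CB j k)
      (fun j _ => Finset.sum_nonneg fun k _ => CB0 j k) (Finset.mem_univ j)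
    have h2 := Finset.single_le_sum (f := CB j) (fun k _ => CB0 j k) (Finset.mem_univ k)
    linarith
  refine ⟨{ α := fun j x t => (sg m j * a (cl x) t j)⁻¹, αx := αx, αt := αt, αtt := αtt,
            β := fun j k x t => (sg m j * a (cl x) t j)⁻¹ * b (cl x) t j k, βx := βx, βt := βt,
            βtt := βtt, C := Ct, c := (|C| + 1)⁻¹, P := ∑ j, ∑ k, |p j k|,
            C0 := by linarith, hα := fun j => (hA j).mono (l1 j),
            hβ := fun j k => (hB j k).mono (l2 j k), hc0 := by positivity, hc := ?_,
            hP0 := by positivity, hP := ?_, haα := ?_, hbβ := ?_ }⟩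
  · intro j x t
    apply inv_anti₀ (hΛ₀.trans_le (hlow j x t))
    obtain ⟨gx, gt, gtt, h⟩ := ha j
    have h1 := h.s.r.b x t
    simp only [zero_mul, Real.exp_zero, mul_one] at h1
    have h2 : sg m j * a (cl x) t j ≤ |sg m j * a (cl x) t j| := le_abs_self _
    rw [abs_mul, sg_abs, one_mul] at h2
    linarith [le_abs_self C]
  · intro j k
    have h1 := Finset.single_le_sum (f := fun j => ∑ k, |p j k|)
      (fun j _ => Finset.sum_nonneg fun k _ => abs_nonneg _) (Finset.mem_univ j)
    have h2 := Finset.single_le_sum (f := fun k => |p j k|) (fun k _ => abs_nonneg _) (Finset.mem_univ k)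
    linarith
  · intro j x hx t
    have h1 := hlow j x t
    rw [cl_of hx] at h1 ⊢
    have h2 : a x t j ≠ 0 := by rintro e; rw [e, mul_zero] at h1; linarith
    have h3 := sg_sq m j
    have h4 : sg m j ≠ 0 := by rintro e; rw [e] at h3; simp at h3
    field_simp
    linarith
  · intro j k x hx t
    rw [cl_of hx]

variable (S : Sys n m p a b)

/-- The normalized geometry. -/
def geo : Geo n where
  α j x t := S.α j (rho m j x) t
  αt j x t := S.αt j (rho m j x) t
  p := p
  r j k x := rho m k (rho m j x)
  A := S.C
  c := S.c
  P := S.P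
  hα j := by
    have := (S.hα j).s.r.comp (rho_cont m j)
    exact ⟨this.c, this.ct, this.d, fun x t => by simpa using this.b x t,
      fun x t => by simpa using this.bt x t⟩
  hc0 := S.hc0
  hc j x t := S.hc j _ t
  hP0 := S.hP0
  hP := S.hP
  hr j k := by fun_prop
  hrI j k x hx := rho_mem m k (rho_mem m j hx)
  hrr j x := rho_rho m j x

def wx (f w wt : Fin n → ℝ → ℝ → ℝ) (j : Fin n) (x t : ℝ) : ℝ :=
  sg m j * (S.α j x t * f j x t - ∑ k, S.β j k x t * w k x t - wt j x t * S.α j x t)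

/-- backward closed sets -/
def Zs (t0 δ x t : ℝ) : Prop := t ≤ t0 ∨ min x (1 - x) ≤ δ - (t - t0) / S.c

lemma Zs_cl (t0 δ : ℝ) : S.geo.Zcl (S.Zs t0 δ) := by
  have hsym : ∀ (j : ℕ) x, min (rho m j x) (1 - rho m j x) = min x (1 - x) := by
    intro j x; unfold rho; split_ifs
    · rfl
    · rw [min_comm]; congr 1; ring
  refine ⟨?_, ?_, ?_⟩
  · intro j x hx t hz ξ hξ
    have h1 := (S.geo.hα j).tau_le (S.geo.hc j) t hξ.2
    have hc : S.geo.c = S.c := rfl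
    rw [hc] at h1
    have hc0 := S.hc0
    have h2 : 0 ≤ S.c * (x - ξ) := mul_nonneg hc0.le (by linarith [hξ.2])
    rcases hz with hz | hz
    · left; linarith
    · right
      have h3 : min ξ (1 - ξ) ≤ min x (1 - x) + (x - ξ) := by
        rw [min_add]
        apply min_le_min <;> linarith [hξ.2]
      have h4 : (x - ξ) ≤ (t - (S.geo.hα j).tau ξ x t) / S.c := by
        rw [le_div_iff₀ hc0]; linarith
      have h5 : (t - t0) / S.c - (t - (S.geo.hα j).tau ξ x t) / S.c =
        ((S.geo.hα j).tau ξ x t - t0) / S.c := by ring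
      linarith
  · intro t hz
    unfold Zs at hz ⊢
    rcases hz with hz | hz
    · exact Or.inl hz
    · right; rw [min_comm] at hz; simpa using hz
  · intro j k x hx t hz
    unfold Zs at hz ⊢
    show t ≤ t0 ∨ min (rho m k (rho m j x)) (1 - rho m k (rho m j x)) ≤ _
    rw [hsym, hsym]; exact hz

lemma cp_rho (w : Fin n → ℝ → ℝ → ℝ) (β : Fin n → Fin n → ℝ → ℝ → ℝ) (j : Fin n) (x t : ℝ) :
    S.geo.cp (fun j k x t => β j k (rho m j x) t) w j (rho m j x) t =
      ∑ k, β j k x t * w k (rho m k x) t := by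
  simp only [Geo.cp, geo, rho_rho]

end Sys

end Part6

section Part7
namespace Sys
variable {n m : ℕ} {p : Fin n → Fin n → ℝ} {a : ℝ → ℝ → Fin n → ℝ} {b : ℝ → ℝ → Fin n → Fin n → ℝ}
  (S : Sys n m p a b)

lemma abs_sg_mul (j : ℕ) (x : ℝ) : |sg m j * x| = |x| := by rw [abs_mul, sg_abs, one_mul]

/-- Normalized coupling. -/
def bt (β : Fin n → Fin n → ℝ → ℝ → ℝ) (m : ℕ) : Fin n → Fin n → ℝ → ℝ → ℝ :=
  fun j k x t => β j k (rho m j x) t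

lemma bt_Cf {β βt : Fin n → Fin n → ℝ → ℝ → ℝ} {C B : ℝ} (hB : C ≤ B) (hC : 0 ≤ C)
    (h : ∀ j k, Rg 0 C (β j k) (βt j k)) : Cf (bt β m) (bt βt m) B := by
  have h' := fun j k => (h j k).comp (rho_cont m j)
  refine ⟨hC.trans hB, fun j k => (h' j k).c, fun j k => (h' j k).ct, fun j k => (h' j k).d, ?_, ?_⟩
  · intro j k x t
    have := (h' j k).b x t
    simp only [zero_mul, Real.exp_zero, mul_one] at this
    exact this.trans hB
  · intro j k x t
    have := (h' j k).bt x t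
    simp only [zero_mul, Real.exp_zero, mul_one] at this
    exact this.trans hB

lemma C2_wx {f w wt : Fin n → ℝ → ℝ → ℝ} (hf : ∀ j, C2 (f j)) (hw : ∀ j, C2 (w j))
    (hwt : ∀ j, C2 (wt j)) (j : Fin n) : C2 (S.wx f w wt j) := by
  have h1 : C2 (S.α j) := (S.hα j).s.r.c
  have h2 : ∀ k, C2 (S.β j k) := fun k => (S.hβ j k).s.r.c
  have h3 := hf j
  have h4 := hwt j
  have h5 : C2 (fun x t => ∑ k, S.β j k x t * w k x t) :=
    C2.sum _ fun k _ => Continuous.mul (h2 k) (hw k)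
  unfold C2 at *
  unfold wx
  exact continuous_const.mul (((h1.mul h3).sub h5).sub (h4.mul h1))

lemma wx_bd {f w wt : Fin n → ℝ → ℝ → ℝ} {M K e x t : ℝ} (he : 0 ≤ e) (hM : 0 ≤ M) (hK : 0 ≤ K)
    (hf : ∀ j, |f j x t| ≤ M * e)
    (hw : ∀ j, |w j x t| ≤ K * M * e) (hwt : ∀ j, |wt j x t| ≤ K * M * e) (j : Fin n) :
    |S.wx f w wt j x t| ≤ (S.C + n * S.C * K + S.C * K) * M * e := by
  have hC := S.C0
  have ha : |S.α j x t| ≤ S.C := by simpa using (S.hα j).s.r.b x t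
  have hb : ∀ k, |S.β j k x t| ≤ S.C := fun k => by simpa using (S.hβ j k).s.r.b x t
  unfold wx
  rw [abs_sg_mul]
  have h1 : |S.α j x t * f j x t| ≤ S.C * (M * e) := by
    rw [abs_mul]; exact mul_le_mul ha (hf j) (abs_nonneg _) hC
  have h2 := sum_bd (fun k => S.β j k x t) (fun k => w k x t) hC hb hw
  have h3 : |wt j x t * S.α j x t| ≤ (K * M * e) * S.C := by
    rw [abs_mul]; exact mul_le_mul (hwt j) ha (abs_nonneg _) (by positivity)
  have := abs_sub (S.α j x t * f j x t - ∑ k, S.β j k x t * w k x t) (wt j x t * S.α j x t)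
  have := abs_sub (S.α j x t * f j x t) (∑ k, S.β j k x t * w k x t)
  nlinarith

/-- Existence in original coordinates. -/
theorem exist : ∃ γ0 : ℝ, 0 < γ0 ∧ ∀ γ, γ0 ≤ γ → ∃ K : ℝ, 0 ≤ K ∧
    ∀ (M : ℝ) (f ft : Fin n → ℝ → ℝ → ℝ), 0 ≤ M → (∀ j, Rg γ M (f j) (ft j)) →
    ∃ W Wt : Fin n → ℝ → ℝ → ℝ, CSol m p a b f W (S.wx f W Wt) Wt ∧
      (∀ j, ∀ x ∈ Icc (0:ℝ) 1, ∀ t, |W j x t| ≤ K * M * Real.exp (γ * t) ∧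
        |Wt j x t| ≤ K * M * Real.exp (γ * t) ∧ |S.wx f W Wt j x t| ≤ K * M * Real.exp (γ * t)) ∧
      (∀ t0 δ, (∀ j, ∀ x ∈ Icc (0:ℝ) 1, ∀ t, S.Zs t0 δ x t → f j x t = 0) →
        ∀ j, ∀ x ∈ Icc (0:ℝ) 1, ∀ t, S.Zs t0 δ x t → W j x t = 0) ∧
      (∀ (fx ftt : Fin n → ℝ → ℝ → ℝ), (∀ j, Sc2 γ M (f j) (fx j) (ft j) (ftt j)) →
        ∃ Wxx : Fin n → ℝ → ℝ → ℝ, (∀ j, C2 (Wxx j)) ∧ ∀ j, ∀ x ∈ Icc (0:ℝ) 1, ∀ t,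
          HasDerivWithinAt (fun y => S.wx f W Wt j y t) (Wxx j x t) (Icc 0 1) x ∧
          |Wxx j x t| ≤ K * M * Real.exp (γ * t)) := by
  have hC := S.C0
  obtain ⟨κ, γ0, hγ0, hGd⟩ := Geo.exists_Gd S.geo (B := S.C + |S.C|) (by positivity)
  refine ⟨γ0, hγ0, fun γ hγ => ?_⟩
  have h := hGd γ hγ
  have hD := S.geo.D0 h
  set D := S.geo.D γ κ with hDd
  set c := S.C with hc
  set k0 := 2 * (D * (4 * c)) with hk0
  set k1 := c + n * c * k0 + c * k0 with hk1
  set k2 := 2 * (D * (4 * c + 2 * (n * (c + |c|) * (2 * (D * (4 * c)))))) with hk2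
  set k3 := (4 * c + 2 * (n * (c + |c|) * (2 * (D * (4 * c))))) + n * (c + |c|) * k2 + k2 * c with hk3
  set k4 := c + c + n * c * k0 + n * c * k1 + k3 * c + k0 * c with hk4
  have k00 : 0 ≤ k0 := by positivity
  have k10 : 0 ≤ k1 := by positivity
  have k20 : 0 ≤ k2 := by positivity
  have k30 : 0 ≤ k3 := by positivity
  have k40 : 0 ≤ k4 := by positivity
  refine ⟨k0 + k1 + k4, by positivity, fun M f ft hM hf => ?_⟩
  have kx : ∀ x ∈ Icc (0:ℝ) 1, ∀ t, Real.exp (γ * t - κ * x) ≤ Real.exp (γ * t) := by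
    intro x hx t
    apply Real.exp_le_exp.2
    have := mul_nonneg h.κ0 hx.1
    linarith
  -- normalized right-hand side
  have hR : ∀ j : Fin n, Rg γ (4 * (c * M)) (fun x t => S.α j (rho m j x) t * f j (rho m j x) t)
      (fun x t => S.αt j (rho m j x) t * f j (rho m j x) t +
        S.α j (rho m j x) t * ft j (rho m j x) t) := by
    intro j
    have := ((S.hα j).s.r.mul (hf j)).comp (rho_cont m j)
    simp only [zero_add] at this
    exact this.mono (by have := mul_nonneg hC hM; linarith)
  set g : Fin n → ℝ → ℝ → ℝ := fun j x t => S.α j (rho m j x) t * f j (rho m j x) t with hg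
  set g' : Fin n → ℝ → ℝ → ℝ := fun j x t => S.αt j (rho m j x) t * f j (rho m j x) t +
        S.α j (rho m j x) t * ft j (rho m j x) t with hg'
  have hRhs : Geo.Rhs γ (4 * (c * M)) g g' := ⟨by positivity, fun j => (hR j).c, fun j => (hR j).ct,
    fun j => (hR j).d, fun j x _ t => (hR j).b x t, fun j x _ t => (hR j).bt x t⟩
  have hβ : Cf (bt S.β m) (bt S.βt m) c := bt_Cf le_rfl hC fun j k => (S.hβ j k).s.r
  have hβt : Cf (bt S.βt m) (bt S.βtt m) c := bt_Cf le_rfl hC fun j k => (S.hβ j k).r2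
  have hβ2 : Cf (bt S.β m) (bt S.βt m) (c + |c|) :=
    bt_Cf (by linarith [abs_nonneg c]) hC fun j k => (S.hβ j k).s.r
  obtain ⟨w, w', hw, hm, hZ⟩ := S.geo.core h hβ2 hRhs
  set W : Fin n → ℝ → ℝ → ℝ := fun j x t => w j (rho m j x) t with hW
  set Wt : Fin n → ℝ → ℝ → ℝ := fun j x t => w' j (rho m j x) t with hWt
  have cW : ∀ j, C2 (W j) := fun j =>
    (hw.c j).comp ((rho_cont m j).comp continuous_fst) continuous_snd
  have cWt : ∀ j, C2 (Wt j) := fun j =>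
    (hw.c' j).comp ((rho_cont m j).comp continuous_fst) continuous_snd
  have cf : ∀ j, C2 (f j) := fun j => (hf j).c
  have bW : ∀ j, ∀ x ∈ Icc (0:ℝ) 1, ∀ t, |W j x t| ≤ k0 * M * Real.exp (γ * t) := by
    intro j x hx t
    refine (hw.b j _ (rho_mem m j hx) t).trans ?_
    have := kx _ (rho_mem m j hx) t
    calc _ ≤ 2 * (D * (4 * (c * M))) * Real.exp (γ * t) := by gcongr
      _ = _ := by rw [hk0]; ring
  have bWt : ∀ j, ∀ x ∈ Icc (0:ℝ) 1, ∀ t, |Wt j x t| ≤ k0 * M * Real.exp (γ * t) := by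
    intro j x hx t
    refine (hw.b' j _ (rho_mem m j hx) t).trans ?_
    have := kx _ (rho_mem m j hx) t
    calc _ ≤ 2 * (D * (4 * (c * M))) * Real.exp (γ * t) := by gcongr
      _ = _ := by rw [hk0]; ring
  have bWx : ∀ j, ∀ x ∈ Icc (0:ℝ) 1, ∀ t, |S.wx f W Wt j x t| ≤ k1 * M * Real.exp (γ * t) :=
    fun j x hx t => S.wx_bd (Real.exp_pos _).le hM k00 (fun j => (hf j).b x t)
      (fun j => bW j x hx t) (fun j => bWt j x hx t) j
  have dWx : ∀ j, ∀ x ∈ Icc (0:ℝ) 1, ∀ t,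
      HasDerivWithinAt (fun y => W j y t) (S.wx f W Wt j x t) (Icc 0 1) x := by
    intro j x hx t
    have h1 := S.geo.mild_x hβ.c hRhs.c hw.c hw.c' hw.d hm j (rho_mem m j hx) t
    have h2 := rho_comp_der m j h1
    refine h2.congr_deriv ?_
    have h3 := S.cp_rho w S.β j x t
    unfold bt
    rw [h3]
    simp only [hg, rho_rho, wx, geo, hW, hWt]
  have hbc0 : ∀ j t, w j 0 t = ∑ k, p j k * w k 1 t := by
    intro j t
    rw [hm j 0 (by simp) t]
    simp [Spd.L, Geo.bd, Spd.tau_self, geo]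
  refine ⟨W, Wt, ⟨cW, S.C2_wx cf cW cWt, cWt, dWx, fun j x t => hw.d j _ t, ?_, ?_⟩, ?_, ?_, ?_⟩
  · intro j x hx t
    have h1 := S.haα j x hx t
    have h2 := sg_sq m j
    have h0 : S.α j x t ≠ 0 := (S.hc0.trans_le (S.hc j x t)).ne'
    have h3 : ∑ k, S.β j k x t * W k x t = S.α j x t * ∑ k, b x t j k * W k x t := by
      rw [Finset.mul_sum]
      exact Finset.sum_congr rfl fun k _ => by rw [S.hbβ j k x hx t]; ring
    unfold wx
    rw [h3]
    have : a x t j * (sg m j * (S.α j x t * f j x t - S.α j x t * ∑ k, b x t j k * W k x t -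
      Wt j x t * S.α j x t)) = (sg m j * (a x t j * S.α j x t)) *
        (f j x t - ∑ k, b x t j k * W k x t - Wt j x t) := by ring
    rw [this, h1, h2]; ring
  · intro t j
    have key : ∀ k : Fin n, (if m ≤ (k:ℕ) then p j k * W k 0 t else p j k * W k 1 t) =
        p j k * w k 1 t := by
      intro k
      simp only [hW, rho]
      split_ifs <;> first | omega | simp
    constructor
    · intro hj
      simp only [key]
      simp only [hW, rho, hj, if_true]
      exact hbc0 j t
    · intro hj
      simp only [key]
      simp only [hW, rho, not_lt.2 hj, if_false, sub_self]
      exact hbc0 j t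
  · intro j x hx t
    have e : 0 ≤ M * Real.exp (γ * t) := by positivity
    refine ⟨(bW j x hx t).trans ?_, (bWt j x hx t).trans ?_, (bWx j x hx t).trans ?_⟩ <;>
    · gcongr
      linarith
  · intro t0 δ hz j x hx t hzt
    have hcl := S.Zs_cl t0 δ
    have hsym : ∀ (j : ℕ) x t, S.Zs t0 δ x t → S.Zs t0 δ (rho m j x) t := by
      intro j x t h
      unfold Zs rho at *
      split_ifs
      · exact h
      · rw [min_comm]; simpa using h
    exact hZ _ hcl (fun j x hx t hz' => by
      simp only [hg]
      rw [hz j _ (rho_mem m j hx) t (hsym j x t hz'), mul_zero]) j _ (rho_mem m j hx) t (hsym j x t hzt)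
  · intro fx ftt hf2
    have hR2 : ∃ g'' : Fin n → ℝ → ℝ → ℝ, Geo.Rhs γ (4 * (c * M)) g' g'' := by
      have := fun j => ((S.hα j).mul (hf2 j)).r2.comp (rho_cont m j)
      simp only [zero_add] at this
      exact ⟨_, by positivity, fun j => (this j).c, fun j => (this j).ct,
        fun j => (this j).d, fun j x _ t => (this j).b x t, fun j x _ t => (this j).bt x t⟩
    obtain ⟨g'', hRhs2⟩ := hR2
    have ra := fun j => (S.hα j).r2.comp (rho_cont m j)
    obtain ⟨M1, hM1, v, v', hv, hvm, cr, cb, bb, br, hvw⟩ := S.geo.core2 (A2 := c) h hβ hβt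
      (αtt := fun j x t => S.αtt j (rho m j x) t)
      (fun j => (ra j).ct) (fun j => (ra j).d) le_rfl
      (fun j x t => by simpa using (ra j).bt x t) hw hm hRhs hRhs2
    rw [← hDd] at hM1 hv
    have hM1' : M1 = (4 * c + 2 * (n * (c + |c|) * (2 * (D * (4 * c))))) * M := by rw [hM1]; ring
    have hM10 : 0 ≤ M1 := by rw [hM1']; positivity
    set r : Fin n → ℝ → ℝ → ℝ := fun j x t => g' j x t - S.geo.cp (bt S.βt m) w j x t with hr
    set vx : Fin n → ℝ → ℝ → ℝ := fun j x t =>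
      r j x t - S.geo.cp (S.geo.β1 (bt S.β m)) v j x t - v' j x t * S.geo.α j x t with hvx
    have cvx : ∀ j, C2 (vx j) := fun j => Continuous.sub (Continuous.sub (cr j)
      (S.geo.cp_cont cb hv.c j)) (Continuous.mul (hv.c' j) (S.geo.hα j).ca)
    have hv2 : 2 * (D * M1) = k2 * M := by rw [hM1', hk2]; ring
    rw [hv2] at hv
    have bvx : ∀ j, ∀ x ∈ Icc (0:ℝ) 1, ∀ t, |vx j x t| ≤ k3 * M * Real.exp (γ * t) := by
      intro j x hx t
      have h1 := br j x hx t
      have h2 := S.geo.cp_bd h (by positivity) bb (by positivity) hv.b j hx t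
      have h3 : |v' j x t * S.geo.α j x t| ≤ (k2 * M * Real.exp (γ * t)) * c := by
        rw [abs_mul]
        refine mul_le_mul ((hv.b' j x hx t).trans ?_) ?_ (abs_nonneg _) (by positivity)
        · have := kx x hx t; gcongr
        · exact (S.geo.hα j).bd x t
      have := abs_sub (r j x t - S.geo.cp (S.geo.β1 (bt S.β m)) v j x t) (v' j x t * S.geo.α j x t)
      have := abs_sub (r j x t) (S.geo.cp (S.geo.β1 (bt S.β m)) v j x t)
      have e : k3 * M * Real.exp (γ * t) = M1 * Real.exp (γ * t) +
        n * (c + |c|) * (k2 * M) * Real.exp (γ * t) + k2 * M * Real.exp (γ * t) * c := by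
        rw [hk3, hM1']; ring
      rw [e]
      show |r j x t - S.geo.cp (S.geo.β1 (bt S.β m)) v j x t - v' j x t * S.geo.α j x t| ≤ _
      linarith
    have dWt : ∀ j, ∀ x ∈ Icc (0:ℝ) 1, ∀ t, HasDerivWithinAt (fun y => Wt j y t)
        (sg m j * vx j (rho m j x) t) (Icc 0 1) x := by
      intro j x hx t
      have h1 := S.geo.mild_x cb cr hv.c hv.c' hv.d hvm j (rho_mem m j hx) t
      have h2 := rho_comp_der m j h1
      refine h2.congr_of_mem (fun y hy => ?_) hx
      exact (hvw j _ (rho_mem m j hy) t).symm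
    refine ⟨fun j x t => sg m j * ((S.αx j x t * f j x t + S.α j x t * fx j x t) -
      (∑ k, (S.βx j k x t * W k x t + S.β j k x t * S.wx f W Wt k x t)) -
      (sg m j * vx j (rho m j x) t * S.α j x t + Wt j x t * S.αx j x t)), ?_, ?_⟩
    · intro j
      have c1 : C2 (S.αx j) := (S.hα j).s.cx
      have c2 : C2 (S.α j) := (S.hα j).s.r.c
      have c3 : C2 (f j) := cf j
      have c4 : C2 (fx j) := (hf2 j).s.cx
      have c5 : C2 (fun x t => ∑ k, (S.βx j k x t * W k x t + S.β j k x t * S.wx f W Wt k x t)) :=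
        C2.sum _ fun k _ => Continuous.add (Continuous.mul (S.hβ j k).s.cx (cW k))
          (Continuous.mul (S.hβ j k).s.r.c (S.C2_wx cf cW cWt k))
      have c6 : C2 (fun x t => vx j (rho m j x) t) :=
        (cvx j).comp ((rho_cont m j).comp continuous_fst) continuous_snd
      have c7 := cWt j
      unfold C2 at *
      exact continuous_const.mul ((((c1.mul c3).add (c2.mul c4)).sub c5).sub
        (((continuous_const.mul c6).mul c2).add (c7.mul c1)))
    · intro j x hx t
      constructor
      · unfold wx
        refine HasDerivWithinAt.const_mul _ (HasDerivWithinAt.sub (HasDerivWithinAt.sub ?_ ?_) ?_)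
        · exact ((S.hα j).s.dx x hx t).mul ((hf2 j).s.dx x hx t)
        · exact HasDerivWithinAt.fun_sum fun k _ =>
            ((S.hβ j k).s.dx x hx t).mul (dWx k x hx t)
        · exact (dWt j x hx t).mul ((S.hα j).s.dx x hx t)
      · set e := Real.exp (γ * t) with he
        have e0 : 0 ≤ e := (Real.exp_pos _).le
        rw [abs_sg_mul]
        have m1 : ∀ {x y p q : ℝ}, |x| ≤ p → |y| ≤ q → |x * y| ≤ p * q := fun h1 h2 => by
          rw [abs_mul]; exact mul_le_mul h1 h2 (abs_nonneg _) ((abs_nonneg _).trans h1)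
        have b1 : |S.αx j x t| ≤ c := by simpa using (S.hα j).s.bx x t
        have b2 : |S.α j x t| ≤ c := by simpa using (S.hα j).s.r.b x t
        have b3 := (hf j).b x t
        have b4 := (hf2 j).s.bx x t
        have b5 := sum_bd (fun k => S.βx j k x t) (fun k => W k x t) hC
          (fun k => by simpa using (S.hβ j k).s.bx x t) (fun k => bW k x hx t)
        have b6 := sum_bd (fun k => S.β j k x t) (fun k => S.wx f W Wt k x t) hC
          (fun k => by simpa using (S.hβ j k).s.r.b x t) (fun k => bWx k x hx t)
        have b7 : |sg m j * vx j (rho m j x) t| ≤ k3 * M * e := by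
          rw [abs_sg_mul]; exact bvx j _ (rho_mem m j hx) t
        have b8 := bWt j x hx t
        rw [Finset.sum_add_distrib]
        have q1 := m1 b1 b3
        have q2 := m1 b2 b4
        have q3 := m1 b7 b2
        have q4 := m1 b8 b1
        refine ((abs_sub _ _).trans (add_le_add ((abs_sub _ _).trans (add_le_add
          ((abs_add_le _ _).trans (add_le_add q1 q2)) ((abs_add_le _ _).trans (add_le_add b5 b6))))
          ((abs_add_le _ _).trans (add_le_add q3 q4)))).trans ?_
        have : k4 * M * e ≤ (k0 + k1 + k4) * M * e := by gcongr; linarith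
        refine le_trans (le_of_eq ?_) this
        rw [hk4]; ring

end Sys

end Part7

section Part8
lemma gron {E E' : ℝ → ℝ} {s h k q : ℝ} (hk : 0 ≤ k) (hq : 0 ≤ q)
    (hd : ∀ t, HasDerivAt E (E' t) t) (hE : ∀ t ∈ Icc s (s + h), E' t ≤ k * E t + q) :
    ∀ t ∈ Icc s (s + h), E t ≤ Real.exp (k * (t - s)) * (E s + q * (t - s)) := by
  intro t ht
  have hF : ∀ τ, HasDerivAt (fun τ => Real.exp (-k * (τ - s)) * E τ - q * (τ - s))
      (Real.exp (-k * (τ - s)) * (-k) * E τ + Real.exp (-k * (τ - s)) * E' τ - q) τ := by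
    intro τ
    have h1 : HasDerivAt (fun τ => -k * (τ - s)) (-k) τ := by
      have := ((hasDerivAt_id τ).sub_const s).const_mul (-k)
      exact this.congr_deriv (by ring)
    have h2 : HasDerivAt (fun τ => q * (τ - s)) q τ := by
      have := ((hasDerivAt_id τ).sub_const s).const_mul q
      exact this.congr_deriv (by ring)
    exact ((h1.exp).mul (hd τ)).sub h2
  have hanti : AntitoneOn (fun τ => Real.exp (-k * (τ - s)) * E τ - q * (τ - s)) (Icc s (s + h)) := by
    apply antitoneOn_of_deriv_nonpos (convex_Icc _ _)
    · exact fun τ _ => (hF τ).continuousAt.continuousWithinAt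
    · exact fun τ _ => (hF τ).differentiableAt.differentiableWithinAt
    · intro τ hτ
      rw [(hF τ).deriv]
      have h1 := hE τ (interior_subset hτ)
      have h2 := (interior_subset hτ).1
      have h3 : Real.exp (-k * (τ - s)) ≤ 1 := by
        apply Real.exp_le_one_iff.2; nlinarith
      have h4 := Real.exp_pos (-k * (τ - s))
      nlinarith
  have h1 := hanti (left_mem_Icc.2 (ht.1.trans ht.2)) ht ht.1
  simp only [sub_self, mul_zero, Real.exp_zero, one_mul, sub_zero] at h1
  have h2 : Real.exp (k * (t - s)) * Real.exp (-k * (t - s)) = 1 := by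
    rw [← Real.exp_add]; simp
  have h3 := Real.exp_pos (k * (t - s))
  calc E t = Real.exp (k * (t - s)) * (Real.exp (-k * (t - s)) * E t) := by
        rw [← mul_assoc, h2, one_mul]
    _ ≤ _ := by gcongr; linarith

/-- Squared `L²` norm. -/
def Q {n : ℕ} (z : Fin n → ℝ → ℝ) : ℝ := ∫ x in (0:ℝ)..1, ∑ j, z j x ^ 2

lemma Q_nonneg {n : ℕ} (z : Fin n → ℝ → ℝ) : 0 ≤ Q z := by
  unfold Q
  exact intervalIntegral.integral_nonneg zero_le_one fun x _ => Finset.sum_nonneg fun j _ => sq_nonneg _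

namespace Sys
variable {n m : ℕ} {p : Fin n → Fin n → ℝ} {a : ℝ → ℝ → Fin n → ℝ} {b : ℝ → ℝ → Fin n → Fin n → ℝ}
  (S : Sys n m p a b)

def Aa (j : Fin n) (x t : ℝ) : ℝ := sg m j / S.α j x t
def Ax (j : Fin n) (x t : ℝ) : ℝ := - sg m j * S.αx j x t / S.α j x t ^ 2

lemma α_pos (j : Fin n) (x t : ℝ) : 0 < S.α j x t := S.hc0.trans_le (S.hc j x t)

lemma α_le (j : Fin n) (x t : ℝ) : S.α j x t ≤ S.C := by
  have := (S.hα j).s.r.b x t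
  simp only [zero_mul, Real.exp_zero, mul_one] at this
  exact (le_abs_self _).trans this

lemma Aa_c (j : Fin n) : C2 (S.Aa j) := by
  have h : C2 (S.α j) := (S.hα j).s.r.c
  unfold C2 at *
  exact continuous_const.div h fun q => (S.α_pos j _ _).ne'

lemma Ax_c (j : Fin n) : C2 (S.Ax j) := by
  have h : C2 (S.α j) := (S.hα j).s.r.c
  have h' : C2 (S.αx j) := (S.hα j).s.cx
  unfold C2 at *
  exact (continuous_const.mul h').div (h.pow 2) fun q => (pow_pos (S.α_pos j _ _) 2).ne'

lemma Aa_der (j : Fin n) {x : ℝ} (hx : x ∈ Icc (0:ℝ) 1) (t : ℝ) :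
    HasDerivWithinAt (fun y => S.Aa j y t) (S.Ax j x t) (Icc 0 1) x := by
  have h := (hasDerivWithinAt_const x (Icc (0:ℝ) 1) (sg m j)).div ((S.hα j).s.dx x hx t)
    (S.α_pos j x t).ne'
  exact h.congr_deriv (by unfold Ax; ring)

lemma a_eq (j : Fin n) {x : ℝ} (hx : x ∈ Icc (0:ℝ) 1) (t : ℝ) : a x t j = S.Aa j x t := by
  unfold Aa; rw [eq_div_iff (S.α_pos j x t).ne', S.haα j x hx t]

lemma Aa_bd (j : Fin n) (x t : ℝ) : |S.Aa j x t| ≤ 1 / S.c := by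
  unfold Aa
  rw [abs_div, sg_abs, abs_of_pos (S.α_pos j x t)]
  exact one_div_le_one_div_of_le S.hc0 (S.hc j x t)

lemma Ax_bd (j : Fin n) (x t : ℝ) : |S.Ax j x t| ≤ S.C / S.c ^ 2 := by
  unfold Ax
  rw [abs_div, abs_mul, abs_neg, sg_abs, one_mul, abs_of_pos (pow_pos (S.α_pos j x t) 2)]
  have h1 : |S.αx j x t| ≤ S.C := by simpa using (S.hα j).s.bx x t
  have h2 := S.hc j x t
  have h3 := S.hc0
  exact div_le_div₀ S.C0 h1 (by positivity) (by gcongr)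

lemma b_bd (j k : Fin n) {x : ℝ} (hx : x ∈ Icc (0:ℝ) 1) (t : ℝ) : |b x t j k| ≤ S.C / S.c := by
  have h1 := S.hbβ j k x hx t
  have h2 : |S.β j k x t| ≤ S.C := by simpa using (S.hβ j k).s.r.b x t
  rw [h1, abs_mul, abs_of_pos (S.α_pos j x t)] at h2
  rw [le_div_iff₀ S.hc0, mul_comm]
  exact (mul_le_mul_of_nonneg_right (S.hc j x t) (abs_nonneg _)).trans h2

def ep : ℝ := min 1 (S.c / ((S.C + 1) * (n ^ 2 * S.P ^ 2 + 1)))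

lemma ep_pos : 0 < S.ep := by
  have := S.hc0; have := S.C0
  unfold ep; apply lt_min one_pos; positivity

lemma ep_le : S.ep ≤ 1 := min_le_left _ _

lemma ep_sm : S.ep / S.c * (n ^ 2 * S.P ^ 2) ≤ 1 / (S.C + 1) := by
  have hc := S.hc0; have hC := S.C0
  have h1 : S.ep ≤ S.c / ((S.C + 1) * (n ^ 2 * S.P ^ 2 + 1)) := min_le_right _ _
  have h2 : (0:ℝ) ≤ n ^ 2 * S.P ^ 2 := by positivity
  calc _ ≤ (S.c / ((S.C + 1) * (n ^ 2 * S.P ^ 2 + 1))) / S.c * (n ^ 2 * S.P ^ 2) := by gcongr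
    _ = 1 / (S.C + 1) * ((n ^ 2 * S.P ^ 2) / (n ^ 2 * S.P ^ 2 + 1)) := by field_simp
    _ ≤ 1 / (S.C + 1) * 1 := by
      gcongr
      rw [div_le_one (by positivity)]; linarith
    _ = _ := mul_one _

def th (j : Fin n) (x : ℝ) : ℝ := S.ep + rho m j x

lemma bdry {z0 z1 : Fin n → ℝ} (h : BCrel n m p (WithLp.toLp 2 z0) (WithLp.toLp 2 z1)) (t : ℝ) :
    0 ≤ ∑ j, (S.th j 1 * S.Aa j 1 t * z1 j ^ 2 - S.th j 0 * S.Aa j 0 t * z0 j ^ 2) := by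
  have hC := S.C0
  have hc := S.hc0
  have hε := S.ep_pos
  set o : Fin n → ℝ := fun k => if m ≤ (k:ℕ) then z0 k else z1 k with ho
  set i : Fin n → ℝ := fun k => if m ≤ (k:ℕ) then z1 k else z0 k with hi
  have hjo : ∀ j, i j = ∑ k, p j k * o k := by
    intro j
    have e : ∀ k : Fin n, (if m ≤ (k:ℕ) then p j k * z0 k else p j k * z1 k) = p j k * o k := by
      intro k; simp only [ho]; split_ifs <;> rfl
    have := h j
    simp only [e] at this
    simp only [hi]
    split_ifs with hj
    · exact this.2 hj
    · exact this.1 (not_le.1 hj)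
  have hisq : ∀ j, i j ^ 2 ≤ n * S.P ^ 2 * ∑ k, o k ^ 2 := by
    intro j
    rw [hjo j]
    refine (Finset.sum_mul_sq_le_sq_mul_sq _ _ _).trans ?_
    gcongr
    calc ∑ k, p j k ^ 2 ≤ ∑ _k : Fin n, S.P ^ 2 := Finset.sum_le_sum fun k _ => by
          rw [← sq_abs]; exact pow_le_pow_left₀ (abs_nonneg _) (S.hP j k) 2
      _ = _ := by simp
  have hinv : ∀ j x, 1 / (S.C + 1) ≤ 1 / S.α j x t := fun j x =>
    one_div_le_one_div_of_le (S.α_pos j x t) (by linarith [S.α_le j x t])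
  have hinv2 : ∀ j x, 1 / S.α j x t ≤ 1 / S.c := fun j x =>
    one_div_le_one_div_of_le hc (S.hc j x t)
  have key : ∀ j, 1 / (S.C + 1) * o j ^ 2 - S.ep / S.c * i j ^ 2 ≤
      S.th j 1 * S.Aa j 1 t * z1 j ^ 2 - S.th j 0 * S.Aa j 0 t * z0 j ^ 2 := by
    intro j
    have aux : ∀ u v x y : ℝ, 1 / (S.C + 1) * u ^ 2 - S.ep / S.c * v ^ 2 ≤
        (S.ep + 1) * (1 / S.α j x t) * u ^ 2 - S.ep * (1 / S.α j y t) * v ^ 2 := by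
      intro u v x y
      have h1 := hinv j x
      have h2 := hinv2 j y
      have h3 : 0 ≤ 1 / (S.C + 1) := by positivity
      have h4 : 1 / (S.C + 1) ≤ (S.ep + 1) * (1 / S.α j x t) := by nlinarith
      have h5 : S.ep * (1 / S.α j y t) ≤ S.ep / S.c := by
        rw [div_eq_mul_one_div S.ep]; gcongr
      have := mul_le_mul_of_nonneg_right h4 (sq_nonneg u)
      have := mul_le_mul_of_nonneg_right h5 (sq_nonneg v)
      linarith
    simp only [ho, hi, th, Aa, rho, sg]
    by_cases hj : m ≤ (j:ℕ)
    · have hj' : ¬ (j:ℕ) < m := by omega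
      simp only [hj, hj', if_true, if_false]
      have := aux (z0 j) (z1 j) 0 1
      refine this.trans (le_of_eq ?_)
      ring
    · have hj' : (j:ℕ) < m := by omega
      simp only [hj, hj', if_true, if_false]
      have := aux (z1 j) (z0 j) 1 0
      refine this.trans (le_of_eq ?_)
      ring
  refine le_trans ?_ (Finset.sum_le_sum fun j _ => key j)
  rw [Finset.sum_sub_distrib, ← Finset.mul_sum, ← Finset.mul_sum]
  have h1 : ∑ j, i j ^ 2 ≤ n * (n * S.P ^ 2 * ∑ k, o k ^ 2) := by
    refine (Finset.sum_le_sum fun j _ => hisq j).trans (le_of_eq ?_)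
    simp
  have h2 := S.ep_sm
  have h3 : 0 ≤ ∑ k, o k ^ 2 := Finset.sum_nonneg fun k _ => sq_nonneg _
  have h4 : S.ep / S.c * ∑ j, i j ^ 2 ≤ S.ep / S.c * (n * (n * S.P ^ 2 * ∑ k, o k ^ 2)) := by gcongr
  have h5 := mul_le_mul_of_nonneg_right h2 h3
  nlinarith

end Sys

end Part8

section Part9
lemma C2.slice {y : ℝ → ℝ → ℝ} (h : C2 y) (t : ℝ) : Continuous fun x => y x t :=
  h.comp continuous_id continuous_const

namespace Sys
variable {n m : ℕ} {p : Fin n → Fin n → ℝ} {a : ℝ → ℝ → Fin n → ℝ} {b : ℝ → ℝ → Fin n → Fin n → ℝ}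
  (S : Sys n m p a b)

lemma th_cont (j : Fin n) : Continuous (S.th j) := by unfold th; fun_prop

lemma th_bd (j : Fin n) {x : ℝ} (hx : x ∈ Icc (0:ℝ) 1) : S.ep ≤ S.th j x ∧ S.th j x ≤ 2 := by
  have h := rho_mem m j hx
  have := S.ep_le
  unfold th
  exact ⟨by linarith [h.1], by linarith [h.2]⟩

lemma en_pt {z g u : Fin n → ℝ} {x t h : ℝ} (hx : x ∈ Icc (0:ℝ) 1) (hh : 0 < h)
    (hu : ∀ j, u j = g j - ∑ k, b x t j k * z k) :
    ∑ j, (2 * S.th j x * z j * u j + (sg m j * S.Aa j x t + S.th j x * S.Ax j x t) * z j ^ 2) ≤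
      ((4 * n * (S.C / S.c) + 1 / S.c + 2 * (S.C / S.c ^ 2)) / S.ep + 1 / h) *
        (∑ j, S.th j x * z j ^ 2) + h * (2 * ∑ j, g j ^ 2) := by
  have hC := S.C0
  have hc := S.hc0
  have hε := S.ep_pos
  have hb := fun j k => S.b_bd j k hx t
  set B := S.C / S.c with hB
  have hB0 : 0 ≤ B := by positivity
  have h1 : ∀ j, -(2 * S.th j x * z j * ∑ k, b x t j k * z k) ≤ 2 * B * ∑ k, (z j ^ 2 + z k ^ 2) := by
    intro j
    rw [Finset.mul_sum, Finset.mul_sum, ← Finset.sum_neg_distrib]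
    refine Finset.sum_le_sum fun k _ => ?_
    obtain ⟨t1, t2⟩ := S.th_bd j hx
    refine (neg_le_abs _).trans ?_
    have e : |2 * S.th j x * z j * (b x t j k * z k)| = 2 * S.th j x * |b x t j k| * (|z j| * |z k|) := by
      rw [abs_mul, abs_mul, abs_mul, abs_mul, abs_of_pos (by norm_num : (0:ℝ) < 2),
        abs_of_pos (by linarith : 0 < S.th j x)]; ring
    rw [e]
    have h2 : |z j| * |z k| ≤ (z j ^ 2 + z k ^ 2) / 2 := by
      nlinarith [sq_nonneg (|z j| - |z k|), sq_abs (z j), sq_abs (z k)]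
    calc 2 * S.th j x * |b x t j k| * (|z j| * |z k|)
        ≤ 2 * 2 * B * ((z j ^ 2 + z k ^ 2) / 2) := by
          have := hb j k
          gcongr
      _ = _ := by ring
  have h2 : ∑ j, ∑ k, (z j ^ 2 + z k ^ 2) = 2 * n * ∑ j, z j ^ 2 := by
    simp only [Finset.sum_add_distrib, Finset.sum_const, Finset.card_univ, Fintype.card_fin,
      nsmul_eq_mul, ← Finset.mul_sum]
    ring
  have h3 : ∀ j : Fin n, (sg m j * S.Aa j x t + S.th j x * S.Ax j x t) * z j ^ 2 ≤
      (1 / S.c + 2 * (S.C / S.c ^ 2)) * z j ^ 2 := by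
    intro j
    obtain ⟨t1, t2⟩ := S.th_bd j hx
    gcongr ?_ * _
    have q1 : sg m j * S.Aa j x t ≤ 1 / S.c :=
      (le_abs_self _).trans (by rw [abs_sg_mul]; exact S.Aa_bd j x t)
    have q2 : S.th j x * S.Ax j x t ≤ 2 * (S.C / S.c ^ 2) := by
      have := S.Ax_bd j x t
      have h0 := le_abs_self (S.Ax j x t)
      calc S.th j x * S.Ax j x t ≤ S.th j x * |S.Ax j x t| := by
            gcongr
            linarith
        _ ≤ _ := by gcongr
    linarith
  have h4 : ∀ j, 2 * S.th j x * z j * g j ≤ 1 / h * (S.th j x * z j ^ 2) + h * (2 * g j ^ 2) := by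
    intro j
    obtain ⟨t1, t2⟩ := S.th_bd j hx
    have q : 2 * z j * g j ≤ 1 / h * z j ^ 2 + h * g j ^ 2 := by
      have : 0 ≤ 1 / h * (z j - h * g j) ^ 2 := by positivity
      have e : 1 / h * (z j - h * g j) ^ 2 = 1 / h * z j ^ 2 - 2 * z j * g j + h * g j ^ 2 := by
        field_simp; ring
      linarith
    have q2 := mul_le_mul_of_nonneg_left q (by linarith : 0 ≤ S.th j x)
    have q3 : S.th j x * (h * g j ^ 2) ≤ 2 * (h * g j ^ 2) := by gcongr
    nlinarith
  have h5 : ∑ j, z j ^ 2 ≤ 1 / S.ep * ∑ j, S.th j x * z j ^ 2 := by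
    rw [Finset.mul_sum]
    refine Finset.sum_le_sum fun j _ => ?_
    obtain ⟨t1, t2⟩ := S.th_bd j hx
    rw [one_div, inv_mul_eq_div, le_div_iff₀ hε, mul_comm]
    gcongr
  have tot : ∑ j, (2 * S.th j x * z j * u j + (sg m j * S.Aa j x t + S.th j x * S.Ax j x t) * z j ^ 2)
      ≤ ∑ j, (1 / h * (S.th j x * z j ^ 2) + h * (2 * g j ^ 2) + 2 * B * ∑ k, (z j ^ 2 + z k ^ 2) +
        (1 / S.c + 2 * (S.C / S.c ^ 2)) * z j ^ 2) := by
    refine Finset.sum_le_sum fun j _ => ?_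
    rw [hu j]
    have := h1 j; have := h3 j; have := h4 j
    nlinarith
  refine tot.trans ?_
  rw [Finset.sum_add_distrib, Finset.sum_add_distrib, Finset.sum_add_distrib, ← Finset.mul_sum,
    ← Finset.mul_sum, ← Finset.mul_sum, ← Finset.mul_sum, ← Finset.mul_sum, h2]
  have h6 : (4 * n * B + 1 / S.c + 2 * (S.C / S.c ^ 2)) * ∑ j, z j ^ 2 ≤
    (4 * n * B + 1 / S.c + 2 * (S.C / S.c ^ 2)) * (1 / S.ep * ∑ j, S.th j x * z j ^ 2) := by gcongr
  have e : (4 * n * B + 1 / S.c + 2 * (S.C / S.c ^ 2)) * (1 / S.ep * ∑ j, S.th j x * z j ^ 2) =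
    (4 * n * B + 1 / S.c + 2 * (S.C / S.c ^ 2)) / S.ep * ∑ j, S.th j x * z j ^ 2 := by ring
  rw [e] at h6
  linarith

/-- Energy estimate. -/
theorem energy (S : Sys n m p a b) : ∃ K : ℝ, 1 ≤ K ∧ ∀ (h s G : ℝ) (z zx zt g : Fin n → ℝ → ℝ → ℝ), 0 < h → h ≤ 1 →
    (∀ j, C2 (g j)) → CSol m p a b g z zx zt →
    (∀ t ∈ Icc s (s + h), Q (fun j x => g j x t) ≤ G) →
    ∀ t ∈ Icc s (s + h), Q (fun j x => z j x t) ≤ K * (Q (fun j x => z j x s) + h ^ 2 * G) := by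
  have hC := S.C0
  have hc := S.hc0
  have hε := S.ep_pos
  set ν := (4 * n * (S.C / S.c) + 1 / S.c + 2 * (S.C / S.c ^ 2)) / S.ep with hν
  have hν0 : 0 ≤ ν := by positivity
  have hexp : 1 ≤ Real.exp (ν + 1) := Real.one_le_exp (by linarith)
  refine ⟨Real.exp (ν + 1) * (2 / S.ep), ?_, ?_⟩
  · have : 1 ≤ 2 / S.ep := by rw [le_div_iff₀ hε]; linarith [S.ep_le]
    nlinarith
  intro h s G z zx zt g hh hh1 cg hz hG t ht
  have cz : ∀ j t, Continuous fun x => z j x t := fun j t => (hz.c j).slice t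
  have czx : ∀ j t, Continuous fun x => zx j x t := fun j t => (hz.cx j).slice t
  have czt : ∀ j t, Continuous fun x => zt j x t := fun j t => (hz.ct j).slice t
  have cgs : ∀ j t, Continuous fun x => g j x t := fun j t => (cg j).slice t
  have cA : ∀ j t, Continuous fun x => S.Aa j x t := fun j t => (S.Aa_c j).slice t
  have cAx : ∀ j t, Continuous fun x => S.Ax j x t := fun j t => (S.Ax_c j).slice t
  have cth := S.th_cont
  set E : ℝ → ℝ := fun t => ∫ x in (0:ℝ)..1, ∑ j, S.th j x * z j x t ^ 2 with hE
  have dE : ∀ t, HasDerivAt E (∫ x in (0:ℝ)..1, ∑ j, S.th j x * (2 * z j x t * zt j x t)) t := by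
    intro t
    refine hasDerivAt_int (F := fun x t => ∑ j, S.th j x * z j x t ^ 2)
      (F' := fun x t => ∑ j, S.th j x * (2 * z j x t * zt j x t)) ?_ ?_ ?_ 0 1 t
    · refine C2.sum _ fun j _ => ?_
      exact ((cth j).comp continuous_fst).mul (Continuous.pow (hz.c j) 2)
    · refine C2.sum _ fun j _ => ?_
      exact ((cth j).comp continuous_fst).mul ((continuous_const.mul (hz.c j)).mul (hz.ct j))
    · intro x t
      refine HasDerivAt.fun_sum fun j _ => ?_
      have := ((hz.dt j x t).pow 2).const_mul (S.th j x)
      exact this.congr_deriv (by simp)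
  have hG0 : 0 ≤ G := (Q_nonneg _).trans (hG s ⟨le_rfl, by linarith⟩)
  have bE : ∀ t ∈ Icc s (s + h), (∫ x in (0:ℝ)..1, ∑ j, S.th j x * (2 * z j x t * zt j x t)) ≤
      (ν + 1 / h) * E t + h * (2 * G) := by
    intro t ht
    set F' : ℝ → ℝ := fun x => ∑ j : Fin n, ((sg m j * S.Aa j x t + S.th j x * S.Ax j x t) * z j x t ^ 2 +
      S.th j x * S.Aa j x t * (2 * z j x t * zx j x t)) with hF'
    have cF' : Continuous F' := by
      refine continuous_finsetSum _ fun j _ => ?_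
      have := cz j t; have := czx j t; have := cA j t; have := cAx j t; have := cth j
      fun_prop
    have hbd : ∫ x in (0:ℝ)..1, F' x = ∑ j, (S.th j 1 * S.Aa j 1 t * z j 1 t ^ 2 -
        S.th j 0 * S.Aa j 0 t * z j 0 t ^ 2) := by
      rw [Finset.sum_sub_distrib]
      refine intervalIntegral.integral_eq_sub_of_hasDerivAt_of_le
        (f := fun x => ∑ j, S.th j x * S.Aa j x t * z j x t ^ 2) zero_le_one ?_ ?_
        (cF'.intervalIntegrable _ _)
      · refine (continuous_finsetSum _ fun j _ => ?_).continuousOn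
        have := cz j t; have := cA j t; have := cth j
        fun_prop
      · intro x hx
        have hx' := Ioo_subset_Icc_self hx
        refine HasDerivAt.fun_sum fun j _ => ?_
        have n1 := Icc_mem_nhds hx.1 hx.2
        have d1 : HasDerivAt (S.th j) (sg m j) x := (rho_der m j x).const_add _
        have d2 := (S.Aa_der j hx' t).hasDerivAt n1
        have d3 := (hz.dx j x hx' t).hasDerivAt n1
        have := (d1.mul d2).mul (d3.pow 2)
        exact this.congr_deriv (by simp)
    have hpos : 0 ≤ ∫ x in (0:ℝ)..1, F' x := by
      rw [hbd]; exact S.bdry (hz.bc t) t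
    have c1 : Continuous fun x => ∑ j, S.th j x * (2 * z j x t * zt j x t) := by
      refine continuous_finsetSum _ fun j _ => ?_
      have := cz j t; have := czt j t; have := cth j
      fun_prop
    have c2 : Continuous fun x => ∑ j, S.th j x * z j x t ^ 2 := by
      refine continuous_finsetSum _ fun j _ => ?_
      have := cz j t; have := cth j
      fun_prop
    have c3 : Continuous fun x => ∑ j, g j x t ^ 2 := by
      refine continuous_finsetSum _ fun j _ => ?_
      have := cgs j t
      fun_prop
    have hintg : (∫ x in (0:ℝ)..1, (∑ j, S.th j x * (2 * z j x t * zt j x t)) + F' x) ≤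
        ∫ x in (0:ℝ)..1, ((ν + 1 / h) * (∑ j, S.th j x * z j x t ^ 2) +
          h * (2 * ∑ j, g j x t ^ 2)) := by
      apply intervalIntegral.integral_mono_on zero_le_one
      · exact (c1.add cF').intervalIntegrable _ _
      · exact ((c2.const_mul _).add ((c3.const_mul _).const_mul _)).intervalIntegrable _ _
      · intro x hx
        refine le_trans (le_of_eq ?_) (S.en_pt (z := fun j => z j x t) (g := fun j => g j x t)
          (u := fun j => zt j x t + S.Aa j x t * zx j x t) (t := t) hx hh ?_)
        · simp only [hF']
          rw [← Finset.sum_add_distrib]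
          exact Finset.sum_congr rfl fun j _ => by ring
        · intro j
          have := hz.pde j x hx t
          rw [S.a_eq j hx t] at this
          linarith
    rw [intervalIntegral.integral_add (c1.intervalIntegrable _ _) (cF'.intervalIntegrable _ _),
      intervalIntegral.integral_add ((c2.const_mul _).intervalIntegrable _ _)
        (((c3.const_mul _).const_mul _).intervalIntegrable _ _),
      intervalIntegral.integral_const_mul, intervalIntegral.integral_const_mul,
      intervalIntegral.integral_const_mul] at hintg
    have hGt := hG t ht
    unfold Q at hGt
    have : h * (2 * ∫ x in (0:ℝ)..1, ∑ j, g j x t ^ 2) ≤ h * (2 * G) := by gcongr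
    simp only [hE]
    linarith
  have hgr := gron (by positivity) (by positivity) dE bE t ht
  have cs : ∀ t, Continuous fun x => ∑ j, z j x t ^ 2 := by
    intro t
    refine continuous_finsetSum _ fun j _ => ?_
    have := cz j t
    fun_prop
  have ct : ∀ t, Continuous fun x => ∑ j, S.th j x * z j x t ^ 2 := by
    intro t
    refine continuous_finsetSum _ fun j _ => ?_
    have := cz j t; have := cth j
    fun_prop
  have lo : ∀ t, S.ep * Q (fun j x => z j x t) ≤ E t := by
    intro t
    unfold Q
    rw [← intervalIntegral.integral_const_mul]
    apply intervalIntegral.integral_mono_on zero_le_one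
    · exact ((cs t).const_mul _).intervalIntegrable _ _
    · exact (ct t).intervalIntegrable _ _
    · intro x hx
      rw [Finset.mul_sum]
      exact Finset.sum_le_sum fun j _ => mul_le_mul_of_nonneg_right (S.th_bd j hx).1 (sq_nonneg _)
  have hi : ∀ t, E t ≤ 2 * Q (fun j x => z j x t) := by
    intro t
    unfold Q
    rw [← intervalIntegral.integral_const_mul]
    apply intervalIntegral.integral_mono_on zero_le_one
    · exact (ct t).intervalIntegrable _ _
    · exact ((cs t).const_mul _).intervalIntegrable _ _
    · intro x hx
      rw [Finset.mul_sum]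
      exact Finset.sum_le_sum fun j _ => mul_le_mul_of_nonneg_right (S.th_bd j hx).2 (sq_nonneg _)
  have hts : t - s ≤ h := by linarith [ht.2]
  have hts0 : 0 ≤ t - s := by linarith [ht.1]
  have e1 : (ν + 1 / h) * (t - s) ≤ ν + 1 := by
    have : (ν + 1 / h) * (t - s) ≤ (ν + 1 / h) * h := by gcongr
    have e : (ν + 1 / h) * h = ν * h + 1 := by field_simp
    nlinarith
  have hQ0 := Q_nonneg (fun j x => z j x s)
  have e2 : E t ≤ Real.exp (ν + 1) * (2 * (Q (fun j x => z j x s) + h ^ 2 * G)) := by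
    refine hgr.trans ?_
    have : h * (2 * G) * (t - s) ≤ h * (2 * G) * h := by gcongr
    have h3 : E s + h * (2 * G) * (t - s) ≤ 2 * (Q (fun j x => z j x s) + h ^ 2 * G) := by
      have := hi s; nlinarith
    have h4 : 0 ≤ 2 * (Q (fun j x => z j x s) + h ^ 2 * G) := by positivity
    have h5 := Real.exp_le_exp.2 e1
    have h6 := Real.exp_pos ((ν + 1 / h) * (t - s))
    calc _ ≤ Real.exp ((ν + 1 / h) * (t - s)) * (2 * (Q (fun j x => z j x s) + h ^ 2 * G)) := by gcongr
      _ ≤ _ := by gcongr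
  have e3 := (lo t).trans e2
  have : Real.exp (ν + 1) * (2 / S.ep) * (Q (fun j x => z j x s) + h ^ 2 * G) =
    Real.exp (ν + 1) * (2 * (Q (fun j x => z j x s) + h ^ 2 * G)) / S.ep := by ring
  rw [this, le_div_iff₀ hε]
  linarith

end Sys

end Part9

section Part10
def vec {n : ℕ} (z : Fin n → ℝ → ℝ) : ℝ → Vn n := fun x => WithLp.toLp 2 fun j => z j x

lemma vec_cont {n : ℕ} {z : Fin n → ℝ → ℝ} (hz : ∀ j, Continuous (z j)) : Continuous (vec z) := by
  unfold vec
  exact (PiLp.continuous_toLp 2 _).comp (continuous_pi hz)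

lemma vec_sq {n : ℕ} (z : Fin n → ℝ → ℝ) (x : ℝ) : ‖vec z x‖ ^ 2 = ∑ j, z j x ^ 2 := by
  simp [vec, EuclideanSpace.norm_sq_eq]

lemma vec_memLp {n : ℕ} {z : Fin n → ℝ → ℝ} (hz : ∀ j, Continuous (z j)) : MemLp (vec z) 2 μ01 := by
  have hc := vec_cont hz
  obtain ⟨C, hC⟩ := (isCompact_Icc (a := (0:ℝ)) (b := 1)).exists_bound_of_continuousOn hc.continuousOn
  refine MemLp.of_bound hc.aestronglyMeasurable C ?_
  refine (ae_restrict_iff' measurableSet_Ioo).2 (Eventually.of_forall fun x hx => ?_)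
  exact hC x (Ioo_subset_Icc_self hx)

open Classical in
/-- The class in `L²` of a continuous function. -/
def Li {n : ℕ} (z : Fin n → ℝ → ℝ) : L2 n :=
  if h : MemLp (vec z) 2 μ01 then h.toLp _ else 0

variable {n : ℕ} {y z : Fin n → ℝ → ℝ}

lemma Li_ae (hz : ∀ j, Continuous (z j)) : ∀ᵐ x ∂μ01, (Li z) x = vec z x := by
  unfold Li
  rw [dif_pos (vec_memLp hz)]
  exact (vec_memLp hz).coeFn_toLp

lemma Li_eq (hz : ∀ j, Continuous (z j)) {φ : L2 n} (h : ∀ᵐ x ∂μ01, φ x = vec z x) : φ = Li z := by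
  apply Lp.ext
  filter_upwards [h, Li_ae hz] with x h1 h2
  rw [h1, h2]

lemma ae_of_Icc {P : ℝ → Prop} (h : ∀ x ∈ Icc (0:ℝ) 1, P x) : ∀ᵐ x ∂μ01, P x :=
  (ae_restrict_iff' measurableSet_Ioo).2 (Eventually.of_forall fun x hx => h x (Ioo_subset_Icc_self hx))

lemma Li_congr (hy : ∀ j, Continuous (y j)) (hz : ∀ j, Continuous (z j))
    (h : ∀ j, ∀ x ∈ Icc (0:ℝ) 1, y j x = z j x) : Li y = Li z := by
  apply Li_eq hz
  filter_upwards [Li_ae hy, ae_of_Icc (P := fun x => vec y x = vec z x) (fun x hx => by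
    unfold vec; congr 1; funext j; exact h j x hx)] with x h1 h2
  rw [h1, h2]

lemma Li_sub (hy : ∀ j, Continuous (y j)) (hz : ∀ j, Continuous (z j)) :
    Li (fun j x => y j x - z j x) = Li y - Li z := by
  symm
  apply Li_eq fun j => (hy j).sub (hz j)
  filter_upwards [Li_ae hy, Li_ae hz, Lp.coeFn_sub (Li y) (Li z)] with x h1 h2 h3
  rw [h3, Pi.sub_apply, h1, h2]
  rfl

lemma Li_smul (hy : ∀ j, Continuous (y j)) (c : ℝ) :
    Li (fun j x => c * y j x) = c • Li y := by
  symm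
  apply Li_eq fun j => continuous_const.mul (hy j)
  filter_upwards [Li_ae hy, Lp.coeFn_smul c (Li y)] with x h1 h3
  rw [h3, Pi.smul_apply, h1]
  rfl

lemma Li_norm (hz : ∀ j, Continuous (z j)) : ‖Li z‖ ^ 2 = Q z := by
  rw [← real_inner_self_eq_norm_sq, L2.inner_def]
  unfold Q
  rw [intervalIntegral.integral_of_le zero_le_one, integral_Ioc_eq_integral_Ioo]
  apply integral_congr_ae
  filter_upwards [Li_ae hz] with x hx
  rw [hx, real_inner_self_eq_norm_sq, vec_sq]

lemma Li_norm_le {C : ℝ} (hC : 0 ≤ C) (hz : ∀ j, Continuous (z j)) (h : Q z ≤ C ^ 2) : ‖Li z‖ ≤ C := by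
  rw [← Li_norm hz] at h
  exact le_of_sq_le_sq h hC

lemma Li_cont {y : Fin n → ℝ → ℝ → ℝ} (hy : ∀ j, C2 (y j)) :
    Continuous fun t => Li (fun j x => y j x t) := by
  rw [continuous_iff_continuousAt]
  intro t0
  have hs : ∀ t j, Continuous fun x => y j x t := fun t j => (hy j).slice t
  have hc : Continuous fun t => Q (fun j x => y j x t - y j x t0) := by
    unfold Q
    apply intervalIntegral.continuous_parametric_intervalIntegral_of_continuous'
    refine continuous_finsetSum _ fun j _ => ?_
    exact (((hy j).comp continuous_snd continuous_fst).sub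
      ((hy j).comp continuous_snd continuous_const)).pow 2
  rw [ContinuousAt, tendsto_iff_norm_sub_tendsto_zero]
  have e : ∀ t, ‖Li (fun j x => y j x t) - Li (fun j x => y j x t0)‖ =
      Real.sqrt (Q (fun j x => y j x t - y j x t0)) := by
    intro t
    rw [← Li_sub (hs t) (hs t0), ← Li_norm (z := fun j x => y j x t - y j x t0) fun j => (hs t j).sub (hs t0 j)]
    exact (Real.sqrt_sq (norm_nonneg _)).symm
  simp only [e]
  have h2 := (Real.continuous_sqrt.comp hc).tendsto t0
  have e0 : Real.sqrt (Q (fun j x => y j x t0 - y j x t0)) = 0 := by simp [Q]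
  rw [Function.comp_apply, e0] at h2
  exact h2

namespace Sys
variable {m : ℕ} {p : Fin n → Fin n → ℝ} {a : ℝ → ℝ → Fin n → ℝ} {b : ℝ → ℝ → Fin n → Fin n → ℝ}

theorem energy' (S : Sys n m p a b) : ∃ K : ℝ, 1 ≤ K ∧ ∀ (h s G : ℝ) (z zx zt g : Fin n → ℝ → ℝ → ℝ), 0 < h → h ≤ 1 →
    0 ≤ G → (∀ j, C2 (g j)) → CSol m p a b g z zx zt →
    (∀ t ∈ Icc s (s + h), ‖Li (fun j x => g j x t)‖ ≤ G) →
    ‖Li (fun j x => z j x (s + h))‖ ≤ K * (‖Li (fun j x => z j x s)‖ + h * G) := by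
  obtain ⟨K, hK, H⟩ := S.energy
  refine ⟨K, hK, fun h s G z zx zt g hh hh1 hG cg hz hgG => ?_⟩
  have cz : ∀ t j, Continuous fun x => z j x t := fun t j => (hz.c j).slice t
  have cgs : ∀ t j, Continuous fun x => g j x t := fun t j => (cg j).slice t
  have h1 := H h s (G ^ 2) z zx zt g hh hh1 cg hz (fun t ht => by
    rw [← Li_norm (cgs t)]; exact pow_le_pow_left₀ (norm_nonneg _) (hgG t ht) 2) (s + h)
    ⟨by linarith, le_rfl⟩
  rw [← Li_norm (cz s)] at h1
  have h0 := norm_nonneg (Li (fun j x => z j x s))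
  apply Li_norm_le (by positivity) (cz _)
  refine h1.trans ?_
  set N := ‖Li (fun j x => z j x s)‖
  have h2 : N ^ 2 + h ^ 2 * G ^ 2 ≤ (N + h * G) ^ 2 := by
    have : 0 ≤ N * (h * G) := by positivity
    nlinarith
  calc K * (N ^ 2 + h ^ 2 * G ^ 2) ≤ K * (N + h * G) ^ 2 := by gcongr
    _ ≤ K * K * (N + h * G) ^ 2 := by
      gcongr; nlinarith
    _ = _ := by ring

end Sys

end Part10

section Part11
lemma flat_left {g : ℝ → ℝ} {g' k t0 t : ℝ} (h : HasDerivAt g g' t) (hk : ∀ t ≤ t0, g t = k) (ht : t ≤ t0) :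
    g' = 0 := by
  have h1 : HasDerivWithinAt g g' (Iic t0) t := h.hasDerivWithinAt
  have h2 : HasDerivWithinAt g 0 (Iic t0) t :=
    (hasDerivWithinAt_const t (Iic t0) k).congr_of_mem (fun y hy => hk y hy) ht
  exact (uniqueDiffOn_Iic t0 t ht).eq_deriv _ h1 h2

lemma flat_right {g : ℝ → ℝ} {g' k t0 t : ℝ} (h : HasDerivAt g g' t) (hk : ∀ t, t0 ≤ t → g t = k) (ht : t0 ≤ t) :
    g' = 0 := by
  have h1 : HasDerivWithinAt g g' (Ici t0) t := h.hasDerivWithinAt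
  have h2 : HasDerivWithinAt g 0 (Ici t0) t :=
    (hasDerivWithinAt_const t (Ici t0) k).congr_of_mem (fun y hy => hk y hy) ht
  exact (uniqueDiffOn_Ici t0 t ht).eq_deriv _ h1 h2

/-- smooth step from `0` (for `t ≤ t0`) to `1` (for `t ≥ t1`) -/
lemma stepfn {t0 t1 : ℝ} (h : t0 < t1) : ∃ Θ Θ1 Θ2 : ℝ → ℝ,
    (∀ t, HasDerivAt Θ (Θ1 t) t) ∧ (∀ t, HasDerivAt Θ1 (Θ2 t) t) ∧ Continuous Θ2 ∧
    (∀ t, t ≤ t0 → Θ t = 0) ∧ (∀ t, t1 ≤ t → Θ t = 1) ∧ (∀ t, |Θ t| ≤ 1) ∧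
    (∀ t, t ≤ t0 → Θ1 t = 0) ∧ (∀ t, t1 ≤ t → Θ1 t = 0) ∧
    (∀ t, t ≤ t0 → Θ2 t = 0) ∧ (∀ t, t1 ≤ t → Θ2 t = 0) := by
  have h' : 0 < t1 - t0 := sub_pos.2 h
  set Θ : ℝ → ℝ := fun t => Real.smoothTransition ((t - t0) / (t1 - t0)) with hΘ
  have cd : ContDiff ℝ 2 Θ := Real.smoothTransition.contDiff.comp (by fun_prop)
  have e2 : (2 : WithTop ℕ∞) = 1 + 1 := by norm_num
  rw [e2, contDiff_succ_iff_deriv] at cd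
  obtain ⟨d0, -, cd1⟩ := cd
  rw [contDiff_one_iff_deriv] at cd1
  have H1 : ∀ t, HasDerivAt Θ (deriv Θ t) t := fun t => (d0 t).hasDerivAt
  have H2 : ∀ t, HasDerivAt (deriv Θ) (deriv (deriv Θ) t) t := fun t => (cd1.1 t).hasDerivAt
  have z0 : ∀ t, t ≤ t0 → Θ t = 0 := fun t ht =>
    Real.smoothTransition.zero_of_nonpos (div_nonpos_of_nonpos_of_nonneg (by linarith) h'.le)
  have z1 : ∀ t, t1 ≤ t → Θ t = 1 := fun t ht =>
    Real.smoothTransition.one_of_one_le ((one_le_div h').2 (by linarith))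
  have y0 : ∀ t, t ≤ t0 → deriv Θ t = 0 := fun t ht => flat_left (H1 t) z0 ht
  have y1 : ∀ t, t1 ≤ t → deriv Θ t = 0 := fun t ht => flat_right (H1 t) z1 ht
  refine ⟨Θ, deriv Θ, deriv (deriv Θ), H1, H2, cd1.2, z0, z1, fun t => ?_, y0, y1,
    fun t ht => flat_left (H2 t) y0 ht, fun t ht => flat_right (H2 t) y1 ht⟩
  rw [abs_of_nonneg (Real.smoothTransition.nonneg _)]
  exact Real.smoothTransition.le_one _

lemma cs_bd {g : ℝ → ℝ} (hg : Continuous g) {u v : ℝ} (h0 : ∀ t, t ≤ u → g t = 0) (h1 : ∀ t, v ≤ t → g t = 0) :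
    ∃ C, 0 ≤ C ∧ ∀ t, |g t| ≤ C := by
  obtain ⟨C, hC⟩ := (isCompact_Icc (a := u) (b := v)).exists_bound_of_continuousOn hg.continuousOn
  refine ⟨|C|, abs_nonneg _, fun t => ?_⟩
  rcases le_total t u with h | h
  · rw [h0 t h]; simp
  rcases le_total v t with h' | h'
  · rw [h1 t h']; simp
  · exact (hC t ⟨h, h'⟩).trans (le_abs_self _)

open Classical in
def cut (y : ℝ → ℝ) (x : ℝ) : ℝ := if x ∈ Icc (0:ℝ) 1 then y x else 0

lemma cut_in (y : ℝ → ℝ) {x : ℝ} (hx : x ∈ Icc (0:ℝ) 1) : cut y x = y x := if_pos hx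

lemma cut_zero {y : ℝ → ℝ} {η : ℝ} (hz : ∀ x ∈ Icc (0:ℝ) 1, min x (1 - x) ≤ η → y x = 0)
    {x : ℝ} (hx : min x (1 - x) ≤ η) : cut y x = 0 := by
  unfold cut; split_ifs with h
  · exact hz x h hx
  · rfl

lemma cutC1 {y yx : ℝ → ℝ} {η : ℝ} (hη : 0 < η) (cy : Continuous yx)
    (hd : ∀ x ∈ Icc (0:ℝ) 1, HasDerivWithinAt y (yx x) (Icc 0 1) x)
    (hz : ∀ x ∈ Icc (0:ℝ) 1, min x (1 - x) ≤ η → y x = 0) : ContDiff ℝ 1 (cut y) := by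
  have loc : ∀ x ∉ Ioo (0:ℝ) 1, cut y =ᶠ[nhds x] fun _ => 0 := by
    intro x hx
    have ho : IsOpen {x : ℝ | min x (1 - x) < η} := isOpen_lt (by fun_prop) continuous_const
    have hm : x ∈ {x : ℝ | min x (1 - x) < η} := by
      simp only [mem_Ioo, not_and_or, not_lt] at hx
      show min x (1 - x) < η
      rcases hx with h | h
      · exact (min_le_left _ _).trans_lt (by linarith)
      · exact (min_le_right _ _).trans_lt (by linarith)
    filter_upwards [ho.mem_nhds hm] with z hz'
    exact cut_zero hz (le_of_lt hz')
  have locI : ∀ x ∈ Ioo (0:ℝ) 1, HasDerivAt (cut y) (yx x) x := by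
    intro x hx
    have h1 : HasDerivAt y (yx x) x :=
      (hd x (Ioo_subset_Icc_self hx)).hasDerivAt (Icc_mem_nhds hx.1 hx.2)
    refine h1.congr_of_eventuallyEq ?_
    filter_upwards [Icc_mem_nhds hx.1 hx.2] with z hz'
    exact cut_in y hz'
  rw [contDiff_one_iff_deriv]
  constructor
  · intro x
    by_cases hx : x ∈ Ioo (0:ℝ) 1
    · exact (locI x hx).differentiableAt
    · exact (differentiableAt_const (0:ℝ)).congr_of_eventuallyEq (loc x hx)
  · rw [continuous_iff_continuousAt]
    intro x
    by_cases hx : x ∈ Ioo (0:ℝ) 1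
    · refine cy.continuousAt.congr ?_
      filter_upwards [isOpen_Ioo.mem_nhds hx] with z hz'
      exact (locI z hz').deriv.symm
    · have := (loc x hx).deriv
      refine ContinuousAt.congr (f := fun _ => (0:ℝ)) continuousAt_const ?_
      filter_upwards [this] with z hz'
      rw [hz', deriv_const]

structure Good {n : ℕ} (δ : ℝ) (φ : Fin n → ℝ → ℝ) : Prop where
  pos : 0 < δ
  cd : ∀ j, ContDiff ℝ 1 (φ j)
  z : ∀ j x, min x (1 - x) ≤ δ → φ j x = 0

namespace Good
variable {n : ℕ} {δ : ℝ} {φ : Fin n → ℝ → ℝ}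

lemma c (h : Good δ φ) (j) : Continuous (φ j) := (h.cd j).continuous
lemma cx (h : Good δ φ) (j) : Continuous (deriv (φ j)) := (contDiff_one_iff_deriv.1 (h.cd j)).2
lemma dx (h : Good δ φ) (j x) : HasDerivAt (φ j) (deriv (φ j) x) x :=
  ((contDiff_one_iff_deriv.1 (h.cd j)).1 x).hasDerivAt
lemma zl (h : Good δ φ) (j x) (hx : x ≤ 0) : φ j x = 0 :=
  h.z j x ((min_le_left _ _).trans (hx.trans h.pos.le))
lemma zr (h : Good δ φ) (j x) (hx : 1 ≤ x) : φ j x = 0 :=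
  h.z j x ((min_le_right _ _).trans (by linarith [h.pos]))
lemma bd (h : Good δ φ) : ∃ C, 0 ≤ C ∧ ∀ j x, |φ j x| ≤ C ∧ |deriv (φ j) x| ≤ C := by
  choose C hC0 hC using fun j => cs_bd (h.c j) (h.zl j) (h.zr j)
  choose D hD0 hD using fun j => cs_bd (h.cx j) (u := 0) (v := 1)
    (fun t ht => flat_left (h.dx j t) (h.zl j) ht) (fun t ht => flat_right (h.dx j t) (h.zr j) ht)
  refine ⟨∑ j, C j + ∑ j, D j, add_nonneg (Finset.sum_nonneg fun j _ => hC0 j) (Finset.sum_nonneg fun j _ => hD0 j), fun j x => ⟨?_, ?_⟩⟩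
  · have := Finset.single_le_sum (fun j _ => hC0 j) (Finset.mem_univ j)
    have h2 := Finset.sum_nonneg fun j (_ : j ∈ Finset.univ) => hD0 j
    linarith [hC j x]
  · have := Finset.single_le_sum (fun j _ => hD0 j) (Finset.mem_univ j)
    have h2 := Finset.sum_nonneg fun j (_ : j ∈ Finset.univ) => hC0 j
    linarith [hD j x]
lemma vcd (h : Good δ φ) : ContDiff ℝ 1 (vec φ) := by
  rw [contDiff_euclidean]
  exact h.cd
lemma vsupp (h : Good δ φ) : tsupport (vec φ) ⊆ Ioo 0 1 := by
  have hc : IsClosed {x : ℝ | δ ≤ min x (1 - x)} := isClosed_le continuous_const (by fun_prop)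
  have : Function.support (vec φ) ⊆ {x : ℝ | δ ≤ min x (1 - x)} := by
    intro x hx
    by_contra hh
    apply hx
    have hh' : min x (1 - x) ≤ δ := (not_le.1 hh).le
    have : (fun j => φ j x) = 0 := by funext j; exact h.z j x hh'
    unfold vec; rw [this]; rfl
  intro x hx
  have h1 := closure_minimal this hc hx
  have h2 : δ ≤ min x (1 - x) := h1
  rw [le_min_iff] at h2
  have := h.pos
  constructor <;> linarith [h2.1, h2.2]
end Good

/-- Step B: approximation by good data. -/
lemma stepB {n : ℕ} {y yx : Fin n → ℝ → ℝ} (cy : ∀ j, Continuous (y j)) (cyx : ∀ j, Continuous (yx j))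
    (hd : ∀ j, ∀ x ∈ Icc (0:ℝ) 1, HasDerivWithinAt (y j) (yx j x) (Icc 0 1) x) {ε : ℝ} (hε : 0 < ε) :
    ∃ δ φ, Good δ φ ∧ ‖Li y - Li φ‖ ≤ ε := by
  obtain ⟨T, T1, T2, hT, hT1, -, Tz, To, Tb, -, -, -, -⟩ := stepfn (zero_lt_one (α := ℝ))
  have cT : Continuous T := continuous_iff_continuousAt.2 fun t => (hT t).continuousAt
  have cT1 : Continuous T1 := continuous_iff_continuousAt.2 fun t => (hT1 t).continuousAt
  set χ : ℕ → ℝ → ℝ := fun k x => T (k * x - 1) * T (k * (1 - x) - 1) with hχ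
  set χ1 : ℕ → ℝ → ℝ := fun k x => T1 (k * x - 1) * k * T (k * (1 - x) - 1) +
    T (k * x - 1) * (T1 (k * (1 - x) - 1) * (-k)) with hχ1
  have cχ : ∀ k, Continuous (χ k) := fun k => by simp only [hχ]; fun_prop
  have cχ1 : ∀ k, Continuous (χ1 k) := fun k => by simp only [hχ1]; fun_prop
  have dχ : ∀ k x, HasDerivAt (χ k) (χ1 k x) x := by
    intro k x
    have a1 : HasDerivAt (fun x : ℝ => (k:ℝ) * x - 1) (k:ℝ) x :=
      (((hasDerivAt_id x).const_mul (k:ℝ)).sub_const 1).congr_deriv (by simp)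
    have a2 : HasDerivAt (fun x : ℝ => (k:ℝ) * (1 - x) - 1) (-k:ℝ) x :=
      ((((hasDerivAt_id x).const_sub 1).const_mul (k:ℝ)).sub_const 1).congr_deriv (by simp)
    exact ((hT _).comp x a1).mul ((hT _).comp x a2)
  have bχ : ∀ k x, |χ k x| ≤ 1 := fun k x => by
    simp only [hχ, abs_mul]
    exact mul_le_one₀ (Tb _) (abs_nonneg _) (Tb _)
  have lim : Tendsto (fun k : ℕ => Q (fun j x => y j x - χ k x * y j x)) atTop (nhds 0) := by
    have e0 : (0:ℝ) = ∫ x in (0:ℝ)..1, (fun _ => (0:ℝ)) x := by simp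
    rw [e0]
    unfold Q
    refine intervalIntegral.tendsto_integral_filter_of_dominated_convergence
      (fun x => ∑ j, (2 * |y j x|) ^ 2) ?_ ?_ ?_ ?_
    · refine Eventually.of_forall fun k => Continuous.aestronglyMeasurable ?_
      exact continuous_finsetSum _ fun j _ => ((cy j).sub ((cχ k).mul (cy j))).pow 2
    · refine Eventually.of_forall fun k => Eventually.of_forall fun x _ => ?_
      rw [Real.norm_eq_abs, abs_of_nonneg (Finset.sum_nonneg fun j _ => sq_nonneg _)]
      refine Finset.sum_le_sum fun j _ => ?_
      rw [← sq_abs (y j x - _)]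
      refine pow_le_pow_left₀ (abs_nonneg _) ?_ 2
      refine (abs_sub _ _).trans ?_
      rw [abs_mul]
      nlinarith [bχ k x, abs_nonneg (y j x)]
    · apply Continuous.intervalIntegrable
      exact continuous_finsetSum _ fun j _ => (continuous_const.mul (cy j).abs).pow 2
    · have h1 : ∀ᵐ x : ℝ, x ≠ 1 := by simp [ae_iff]
      filter_upwards [h1] with x hx1 hx
      rw [uIoc_of_le zero_le_one] at hx
      have hx2 : x < 1 := lt_of_le_of_ne hx.2 hx1
      apply tendsto_const_nhds.congr'
      have t1 : ∀ᶠ k : ℕ in atTop, 2 / x ≤ k := tendsto_natCast_atTop_atTop.eventually_ge_atTop _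
      have t2 : ∀ᶠ k : ℕ in atTop, 2 / (1 - x) ≤ k := tendsto_natCast_atTop_atTop.eventually_ge_atTop _
      filter_upwards [t1, t2] with k h1 h2
      rw [div_le_iff₀ hx.1] at h1
      rw [div_le_iff₀ (by linarith)] at h2
      have : χ k x = 1 := by
        simp only [hχ]; rw [To _ (by linarith), To _ (by linarith)]; norm_num
      simp [this]
  have ev := (lim.eventually (gt_mem_nhds (show (0:ℝ) < ε ^ 2 by positivity))).and (eventually_gt_atTop 0)
  obtain ⟨k, hk, hk0⟩ := ev.exists
  have hk0' : (0:ℝ) < k := by exact_mod_cast hk0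
  have zz : ∀ j, ∀ x ∈ Icc (0:ℝ) 1, min x (1 - x) ≤ 1 / k → χ k x * y j x = 0 := by
    intro j x _ hm
    have : χ k x = 0 := by
      simp only [hχ]
      rcases min_le_iff.1 hm with h | h
      · rw [le_div_iff₀ hk0'] at h
        rw [Tz _ (by linarith), zero_mul]
      · rw [le_div_iff₀ hk0'] at h
        rw [Tz (k * (1 - x) - 1) (by linarith), mul_zero]
    rw [this, zero_mul]
  have hG : Good (1 / (k:ℝ)) (fun j => cut (fun x => χ k x * y j x)) := by
    refine ⟨by positivity, fun j => ?_, fun j x hx => cut_zero (zz j) hx⟩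
    refine cutC1 (η := 1 / k) (yx := fun x => χ1 k x * y j x + χ k x * yx j x) (by positivity) ?_ ?_ (zz j)
    · exact ((cχ1 k).mul (cy j)).add ((cχ k).mul (cyx j))
    · intro x hx
      exact (dχ k x).hasDerivWithinAt.mul (hd j x hx)
  refine ⟨_, _, hG, ?_⟩
  have cχy : ∀ j, Continuous fun x => χ k x * y j x := fun j => (cχ k).mul (cy j)
  rw [Li_congr hG.c (z := fun j x => χ k x * y j x) cχy fun j x hx => cut_in _ hx, ← Li_sub cy cχy]
  exact Li_norm_le hε.le (fun j => (cy j).sub (cχy j)) hk.le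

end Part11

section Part12
section
variable {n m : ℕ} {p : Fin n → Fin n → ℝ} {a : ℝ → ℝ → Fin n → ℝ} {b : ℝ → ℝ → Fin n → Fin n → ℝ}

lemma CSol.sub {f w wx wt f' w' wx' wt' : Fin n → ℝ → ℝ → ℝ} (h : CSol m p a b f w wx wt)
    (h' : CSol m p a b f' w' wx' wt') :
    CSol m p a b (fun j x t => f j x t - f' j x t) (fun j x t => w j x t - w' j x t)
      (fun j x t => wx j x t - wx' j x t) (fun j x t => wt j x t - wt' j x t) where
  c j := Continuous.sub (h.c j) (h'.c j)
  cx j := Continuous.sub (h.cx j) (h'.cx j)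
  ct j := Continuous.sub (h.ct j) (h'.ct j)
  dx j x hx t := (h.dx j x hx t).sub (h'.dx j x hx t)
  dt j x t := (h.dt j x t).sub (h'.dt j x t)
  pde j x hx t := by
    have h1 := h.pde j x hx t
    have h2 := h'.pde j x hx t
    simp only [mul_sub, Finset.sum_sub_distrib]
    linarith
  bc t j := by
    obtain ⟨h1, h2⟩ := h.bc t j
    obtain ⟨h3, h4⟩ := h'.bc t j
    have e : ∀ k : Fin n, (if m ≤ (k : ℕ) then p j k * (w k 0 t - w' k 0 t) else p j k * (w k 1 t - w' k 1 t))
        = (if m ≤ (k : ℕ) then p j k * w k 0 t else p j k * w k 1 t) -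
          (if m ≤ (k : ℕ) then p j k * w' k 0 t else p j k * w' k 1 t) := by
      intro k; split_ifs <;> ring
    refine ⟨fun hj => ?_, fun hj => ?_⟩
    · have h1 := h1 hj
      have h3 := h3 hj
      simp only [e, Finset.sum_sub_distrib] at h1 h3 ⊢
      rw [h1, h3]
    · have h1 := h2 hj
      have h3 := h4 hj
      simp only [e, Finset.sum_sub_distrib] at h1 h3 ⊢
      rw [h1, h3]

namespace Sys
variable (S : Sys n m p a b)

def Bb (j k : Fin n) (x t : ℝ) : ℝ := S.β j k x t / S.α j x t

lemma Bb_c (j k : Fin n) : C2 (S.Bb j k) := by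
  have h : C2 (S.α j) := (S.hα j).s.r.c
  have h' : C2 (S.β j k) := (S.hβ j k).s.r.c
  unfold C2 at *
  exact h'.div h fun q => (S.α_pos j _ _).ne'

lemma Bb_bd (j k : Fin n) (x t : ℝ) : |S.Bb j k x t| ≤ S.C / S.c := by
  unfold Bb
  have h2 : |S.β j k x t| ≤ S.C := by simpa using (S.hβ j k).s.r.b x t
  rw [abs_div, abs_of_pos (S.α_pos j x t)]
  exact div_le_div₀ S.C0 h2 S.hc0 (S.hc j x t)

lemma b_eq (j k : Fin n) {x : ℝ} (hx : x ∈ Icc (0:ℝ) 1) (t : ℝ) : b x t j k = S.Bb j k x t := by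
  unfold Bb
  rw [eq_div_iff (S.α_pos j x t).ne', S.hbβ j k x hx t, mul_comm]

/-- the spatial operator applied to a good function -/
def Lop (φ : Fin n → ℝ → ℝ) (j : Fin n) (x t : ℝ) : ℝ :=
  S.Aa j x t * deriv (φ j) x + ∑ k, S.Bb j k x t * φ k x

lemma Lop_c {δ : ℝ} {φ : Fin n → ℝ → ℝ} (h : Good δ φ) (j : Fin n) : C2 (S.Lop φ j) := by
  have h1 := S.Aa_c j
  have h2 := S.Bb_c j
  have h3 := h.cx
  have h4 := h.c
  unfold C2 Lop at *
  exact (h1.mul ((h3 j).comp continuous_fst)).add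
    (continuous_finsetSum _ fun k _ => (h2 k).mul ((h4 k).comp continuous_fst))

lemma Lop_bd {δ : ℝ} {φ : Fin n → ℝ → ℝ} (h : Good δ φ) : ∃ D, 0 ≤ D ∧ ∀ j x t, |S.Lop φ j x t| ≤ D := by
  obtain ⟨C, hC, hb⟩ := h.bd
  have h0 := S.C0
  have h1 := S.hc0
  refine ⟨1 / S.c * C + n * (S.C / S.c) * C, by positivity, fun j x t => ?_⟩
  unfold Lop
  refine (abs_add_le _ _).trans (add_le_add ?_ ?_)
  · rw [abs_mul]
    exact mul_le_mul (S.Aa_bd j x t) (hb j x).2 (abs_nonneg _) (by positivity)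
  · exact sum_bd _ _ (by positivity) (fun k => S.Bb_bd j k x t) (fun k => (hb k x).1)

lemma theta {δ : ℝ} {φ : Fin n → ℝ → ℝ} (h : Good δ φ) {θ θ1 : ℝ → ℝ} (hθ : ∀ t, HasDerivAt θ (θ1 t) t)
    (cθ1 : Continuous θ1) :
    CSol m p a b (fun j x t => θ1 t * φ j x + θ t * S.Lop φ j x t) (fun j x t => θ t * φ j x)
      (fun j x t => θ t * deriv (φ j) x) (fun j x t => θ1 t * φ j x) := by
  have cθ : Continuous θ := continuous_iff_continuousAt.2 fun t => (hθ t).continuousAt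
  refine ⟨fun j => ?_, fun j => ?_, fun j => ?_, fun j x _ t => ?_, fun j x t => ?_, fun j x hx t => ?_, fun t j => ?_⟩
  · exact (cθ.comp continuous_snd).mul ((h.c j).comp continuous_fst)
  · exact (cθ.comp continuous_snd).mul ((h.cx j).comp continuous_fst)
  · exact (cθ1.comp continuous_snd).mul ((h.c j).comp continuous_fst)
  · exact ((h.dx j x).const_mul (θ t)).hasDerivWithinAt
  · exact (hθ t).mul_const _
  · unfold Lop
    rw [S.a_eq j hx t]
    simp only [S.b_eq j _ hx t, mul_add, Finset.mul_sum]
    rw [add_assoc]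
    congr 2
    · ring
    · exact Finset.sum_congr rfl fun k _ => by ring
  · have e0 : ∀ k, θ t * φ k 0 = 0 := fun k => by rw [h.zl k 0 le_rfl, mul_zero]
    have e1 : ∀ k, θ t * φ k 1 = 0 := fun k => by rw [h.zr k 1 le_rfl, mul_zero]
    simp [e0, e1]

lemma Li_bd {z : Fin n → ℝ → ℝ} (hz : ∀ j, Continuous (z j)) {D : ℝ} (hD : 0 ≤ D)
    (h : ∀ j, ∀ x ∈ Icc (0:ℝ) 1, |z j x| ≤ D) : ‖Li z‖ ≤ n * D := by
  refine Li_norm_le (by positivity) hz ?_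
  have : Q z ≤ ∫ x in (0:ℝ)..1, ((n * D) ^ 2 : ℝ) := by
    unfold Q
    refine intervalIntegral.integral_mono_on zero_le_one
      (Continuous.intervalIntegrable (continuous_finsetSum _ fun j _ => (hz j).pow 2) _ _)
      (by simp) fun x hx => ?_
    calc ∑ j, z j x ^ 2 ≤ ∑ j : Fin n, D ^ 2 := Finset.sum_le_sum fun j _ => by
          rw [← sq_abs]; exact pow_le_pow_left₀ (abs_nonneg _) (h j x hx) 2
      _ = n * D ^ 2 := by simp
      _ ≤ (n * D) ^ 2 := by
        rw [mul_pow]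
        have : (n:ℝ) ≤ (n:ℝ) ^ 2 := by exact_mod_cast Nat.le_self_pow (by norm_num) n
        gcongr
  simpa using this

theorem stepA (S : Sys n m p a b) {U : ℝ → ℝ → L2 n →L[ℝ] L2 n} (hU : GeneratedBy n m p a b U)
    {δ : ℝ} {φ : Fin n → ℝ → ℝ} (h : Good δ φ) (t1 : ℝ) {ε : ℝ} (hε : 0 < ε) :
    ∃ z zx zt g : Fin n → ℝ → ℝ → ℝ, CSol m p a b g z zx zt ∧ (∀ j, C2 (g j)) ∧
      (∀ j x t, t1 ≤ t → g j x t = 0) ∧ ‖Li (fun j x => z j x t1) - Li φ‖ ≤ ε ∧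
      ∀ t, t1 ≤ t → U t t1 (Li (fun j x => z j x t1)) = Li (fun j x => z j x t) := by
  obtain ⟨K, hK, HE⟩ := S.energy'
  obtain ⟨D, hD, hLb⟩ := S.Lop_bd h
  obtain ⟨Cφ, hCφ, hφb⟩ := h.bd
  have hc := S.hc0
  have hδ := h.pos
  set η : ℝ := min 1 (min (S.c * δ / 2) (ε / (K * (n * D) + 1))) with hη
  have hden : 0 < K * (n * D) + 1 := by positivity
  have η0 : 0 < η := by
    simp only [hη, lt_min_iff]
    exact ⟨one_pos, by positivity, by positivity⟩
  have η1 : η ≤ 1 := min_le_left _ _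
  have η2 : η / S.c ≤ δ / 2 := by
    have : η ≤ S.c * δ / 2 := (min_le_right _ _).trans (min_le_left _ _)
    rw [div_le_iff₀ hc]; linarith
  have η3 : K * (η * (n * D)) ≤ ε := by
    have : η ≤ ε / (K * (n * D) + 1) := (min_le_right _ _).trans (min_le_right _ _)
    rw [le_div_iff₀ hden] at this
    nlinarith
  set t0 := t1 - η with ht0
  obtain ⟨Θ, Θ1, Θ2, dΘ, dΘ1, cΘ2, Θl, Θr, Θb, Θla, Θra, Θlb, Θrb⟩ := stepfn (show t0 < t1 by linarith)
  have cΘ : Continuous Θ := continuous_iff_continuousAt.2 fun t => (dΘ t).continuousAt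
  have cΘ1 : Continuous Θ1 := continuous_iff_continuousAt.2 fun t => (dΘ1 t).continuousAt
  obtain ⟨γ, hγ, Hγ⟩ := S.exist
  obtain ⟨K', hK', HX⟩ := Hγ γ le_rfl
  obtain ⟨M1, hM1, hb1⟩ := cs_bd (g := fun t => Θ1 t * Real.exp (-(γ * t))) (by fun_prop)
    (u := t0) (v := t1) (fun t ht => by simp [Θla t ht]) (fun t ht => by simp [Θra t ht])
  obtain ⟨M2, hM2, hb2⟩ := cs_bd (g := fun t => Θ2 t * Real.exp (-(γ * t))) (by fun_prop)
    (u := t0) (v := t1) (fun t ht => by simp [Θlb t ht]) (fun t ht => by simp [Θrb t ht])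
  have key : ∀ v M t : ℝ, |v * Real.exp (-(γ * t))| ≤ M → |v| ≤ M * Real.exp (γ * t) := by
    intro v M t hv
    rw [abs_mul, abs_of_pos (Real.exp_pos _), Real.exp_neg, ← div_eq_mul_inv, div_le_iff₀ (Real.exp_pos _)] at hv
    exact hv
  have hRg : ∀ j, Rg γ ((M1 + M2) * Cφ) (fun x t => Θ1 t * φ j x) (fun x t => Θ2 t * φ j x) := by
    intro j
    refine ⟨(cΘ1.comp continuous_snd).mul ((h.c j).comp continuous_fst),
      (cΘ2.comp continuous_snd).mul ((h.c j).comp continuous_fst), fun x t => (dΘ1 t).mul_const _,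
      fun x t => ?_, fun x t => ?_⟩
    · rw [abs_mul]
      have e := Real.exp_pos (γ * t)
      calc |Θ1 t| * |φ j x| ≤ (M1 * Real.exp (γ * t)) * Cφ :=
            mul_le_mul (key _ _ _ (hb1 t)) (hφb j x).1 (abs_nonneg _) (by positivity)
        _ ≤ _ := by
          have : 0 ≤ M2 * Cφ * Real.exp (γ * t) := by positivity
          nlinarith
    · rw [abs_mul]
      have e := Real.exp_pos (γ * t)
      calc |Θ2 t| * |φ j x| ≤ (M2 * Real.exp (γ * t)) * Cφ :=
            mul_le_mul (key _ _ _ (hb2 t)) (hφb j x).1 (abs_nonneg _) (by positivity)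
        _ ≤ _ := by
          have : 0 ≤ M1 * Cφ * Real.exp (γ * t) := by positivity
          nlinarith
  obtain ⟨W, Wt, hW, -, hsupp, -⟩ := HX ((M1 + M2) * Cφ) (fun j x t => Θ1 t * φ j x) _ (by positivity) hRg
  set Wx := S.wx (fun j x t => Θ1 t * φ j x) W Wt
  have hz := hsupp t0 δ (fun j x hx t hZ => by
    rcases hZ with hZ | hZ
    · rw [Θla t hZ, zero_mul]
    · rcases le_total t t0 with h' | h'
      · rw [Θla t h', zero_mul]
      · rw [h.z j x (hZ.trans (by
          have : 0 ≤ (t - t0) / S.c := div_nonneg (by linarith) hc.le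
          linarith)), mul_zero])
  have hW0 : ∀ j, ∀ x ∈ Icc (0:ℝ) 1, W j x t0 = 0 := fun j x hx => hz j x hx t0 (Or.inl le_rfl)
  have hW1 : ∀ j, ∀ x ∈ Icc (0:ℝ) 1, min x (1 - x) ≤ δ / 2 → W j x t1 = 0 := fun j x hx hm =>
    hz j x hx t1 (Or.inr (by
      have : t1 - t0 = η := by rw [ht0]; ring
      rw [this]; linarith))
  have cW : ∀ t j, Continuous fun x => W j x t := fun t j => (hW.c j).slice t
  have hG : Good (δ / 2) (fun j => cut fun x => W j x t1) :=
    ⟨by positivity, fun j => cutC1 (η := δ / 2) (by positivity) ((hW.cx j).slice t1)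
      (fun x hx => hW.dx j x hx t1) (hW1 j), fun j x hx => cut_zero (hW1 j) hx⟩
  refine ⟨W, Wx, Wt, _, hW, fun j => (hRg j).c, fun j x t ht => by simp [Θra t ht], ?_, fun t ht => ?_⟩
  · have hV := hW.sub (S.theta h dΘ cΘ1)
    have hgc : ∀ j, C2 (fun x t => Θ1 t * φ j x - (Θ1 t * φ j x + Θ t * S.Lop φ j x t)) := fun j =>
      Continuous.sub (hRg j).c (Continuous.add (hRg j).c ((cΘ.comp continuous_snd).mul (S.Lop_c h j)))
    have hE := HE η t0 (n * D) _ _ _ _ η0 η1 (by positivity) hgc hV (fun t _ => by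
      refine Li_bd (fun j => (hgc j).slice t) hD fun j x _ => ?_
      have : Θ1 t * φ j x - (Θ1 t * φ j x + Θ t * S.Lop φ j x t) = -(Θ t * S.Lop φ j x t) := by ring
      rw [this, abs_neg, abs_mul]
      have := hLb j x t
      have := Θb t
      nlinarith [abs_nonneg (Θ t), abs_nonneg (S.Lop φ j x t)])
    have e1 : t0 + η = t1 := by rw [ht0]; ring
    rw [e1] at hE
    have c0 : ∀ t j, Continuous fun x => W j x t - Θ t * φ j x := fun t j =>
      (cW t j).sub (continuous_const.mul (h.c j))
    have e2 : ‖Li (fun j x => W j x t0 - Θ t0 * φ j x)‖ = 0 := by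
      have := Li_bd (c0 t0) le_rfl (fun j x hx => by rw [hW0 j x hx, Θl t0 le_rfl]; simp)
      simpa using this
    rw [e2, zero_add] at hE
    rw [← Li_sub (cW t1) h.c]
    have e3 : (fun j x => W j x t1 - φ j x) = (fun j x => W j x t1 - Θ t1 * φ j x) := by
      funext j x; rw [Θr t1 le_rfl, one_mul]
    rw [e3]
    exact hE.trans η3
  · obtain ⟨-, -, -, hgen⟩ := hU
    have hLi : Li (fun j x => W j x t1) = Li (fun j => cut fun x => W j x t1) :=
      Li_congr (cW t1) hG.c fun j x hx => (cut_in (fun x => W j x t1) hx).symm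
    have cv : ∀ {y : Fin n → ℝ → ℝ → ℝ}, (∀ j, C2 (y j)) →
        Continuous (fun q : ℝ × ℝ => vec (fun j x => y j x q.2) q.1) := by
      intro y hy
      unfold vec
      exact (PiLp.continuous_toLp 2 _).comp (continuous_pi fun j => hy j)
    apply Li_eq (cW t)
    have := hgen t1 _ hG.vcd hG.vsupp (Li (fun j x => W j x t1)) (by rw [hLi]; exact Li_ae hG.c)
      (fun x t => vec (fun j x => W j x t) x) (fun x t => vec (fun j x => Wx j x t) x)
      (fun x t => vec (fun j x => Wt j x t) x)
      ⟨(cv hW.c).continuousOn, (cv hW.cx).continuousOn, (cv hW.ct).continuousOn,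
        fun x hx t _ j => ⟨hW.dx j x hx t, (hW.dt j x t).hasDerivWithinAt⟩,
        fun x hx t ht j => by
          have := hW.pde j x hx t
          rw [Θra t ht, zero_mul] at this
          exact this,
        fun t _ => hW.bc t, fun x hx => by
          exact congrArg (WithLp.toLp 2) (funext fun j => (cut_in (fun x => W j x t1) hx).symm)⟩ t ht
    exact this

end Sys
end

end Part12

section Part13
section
variable {n m : ℕ} {p : Fin n → Fin n → ℝ} {a : ℝ → ℝ → Fin n → ℝ} {b : ℝ → ℝ → Fin n → Fin n → ℝ}
  {U : ℝ → ℝ → L2 n →L[ℝ] L2 n}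

lemma U_bd (hU : GeneratedBy n m p a b U) : ∃ K ν : ℝ, 1 ≤ K ∧ 0 ≤ ν ∧ ∀ s t : ℝ, s ≤ t → ∀ y,
    ‖U t s y‖ ≤ K * Real.exp (ν * (t - s)) * ‖y‖ := by
  obtain ⟨-, -, ⟨K, hK, ν, h⟩, -⟩ := hU
  refine ⟨K, |ν|, hK, abs_nonneg _, fun s t hst y => ?_⟩
  refine ((U t s).le_opNorm y).trans ?_
  refine mul_le_mul_of_nonneg_right ((h s t hst).trans ?_) (norm_nonneg _)
  have := le_abs_self ν
  have : 0 ≤ t - s := by linarith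
  gcongr

theorem Sys.stepD (S : Sys n m p a b) (hU : GeneratedBy n m p a b U)
    {f fx w wx wt : Fin n → ℝ → ℝ → ℝ} (hw : CSol m p a b f w wx wt) (cf : ∀ j, C2 (f j))
    (cfx : ∀ j, C2 (fx j))
    (hfx : ∀ j, ∀ x ∈ Icc (0:ℝ) 1, ∀ t, HasDerivWithinAt (fun y => f j y t) (fx j x t) (Icc 0 1) x)
    (r : ℝ) {ε : ℝ} (hε : 0 < ε) :
    ∃ h0, 0 < h0 ∧ ∀ h, 0 < h → h < h0 →
      ‖Li (fun j x => w j x (r + h)) - U (r + h) r (Li (fun j x => w j x r)) - h • Li (fun j x => f j x r)‖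
        ≤ ε * h := by
  obtain ⟨K, hK, HE⟩ := S.energy'
  obtain ⟨KU, ν, hKU, hν, hUb⟩ := U_bd hU
  set B := KU * Real.exp ν with hB
  have hB0 : 0 ≤ B := by positivity
  set ε1 := ε / (4 * K + B + 1) with hε1
  have hden : 0 < 4 * K + B + 1 := by positivity
  have εpos : 0 < ε1 := by positivity
  have εeqn : ε1 * (4 * K + B + 1) = ε := div_mul_cancel₀ _ hden.ne'
  have cfs : ∀ t j, Continuous fun x => f j x t := fun t j => (cf j).slice t
  have cws : ∀ t j, Continuous fun x => w j x t := fun t j => (hw.c j).slice t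
  obtain ⟨δ, φ, hφ, hφf⟩ := stepB (cfs r) (fun j => (cfx j).slice r) (fun j x hx => hfx j x hx r) εpos
  obtain ⟨D, hD, hLb⟩ := S.Lop_bd hφ
  obtain ⟨δ1, hδ1, hδb⟩ := Metric.continuous_iff.1 (Li_cont cf) r ε1 εpos
  refine ⟨min 1 (min δ1 (ε1 / (n * D + 1))), ?_, fun h hh hlt => ?_⟩
  · simp only [lt_min_iff]; exact ⟨one_pos, hδ1, by positivity⟩
  simp only [lt_min_iff] at hlt
  obtain ⟨hh1, hh2, hh3⟩ := hlt
  have hh4 : h * (n * D) ≤ ε1 := by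
    rw [lt_div_iff₀ (by positivity)] at hh3
    nlinarith
  obtain ⟨δ2, ψ, hψ, hψw⟩ := stepB (cws r) (fun j => (hw.cx j).slice r) (fun j x hx => hw.dx j x hx r)
    (show 0 < ε1 * h / 2 by positivity)
  obtain ⟨z, zx, zt, g, hz, cg, g0, hzψ, hzU⟩ := S.stepA hU hψ r (show 0 < ε1 * h / 2 by positivity)
  have czs : ∀ t j, Continuous fun x => z j x t := fun t j => (hz.c j).slice t
  have hwz : ‖Li (fun j x => w j x r) - Li (fun j x => z j x r)‖ ≤ ε1 * h := by
    have := norm_sub_le_norm_sub_add_norm_sub (Li (fun j x => w j x r)) (Li ψ) (Li (fun j x => z j x r))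
    rw [norm_sub_rev (Li ψ)] at this
    linarith
  have hθ := S.theta hφ (θ := fun t => t - r) (θ1 := fun _ => 1) (fun t => (hasDerivAt_id t).sub_const r)
    continuous_const
  have hV := (hw.sub hz).sub hθ
  have cG : ∀ j, C2 fun x t => f j x t - g j x t - (1 * φ j x + (t - r) * S.Lop φ j x t) := by
    intro j
    refine Continuous.sub (Continuous.sub (cf j) (cg j)) (Continuous.add ?_ ?_)
    · exact continuous_const.mul ((hφ.c j).comp continuous_fst)
    · exact (continuous_snd.sub continuous_const).mul (S.Lop_c hφ j)
  have hE := HE h r (3 * ε1) _ _ _ _ hh hh1.le (by positivity) cG hV (fun t ht => by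
    have cL : ∀ j, Continuous fun x => S.Lop φ j x t := fun j => (S.Lop_c hφ j).slice t
    have e : (fun j x => f j x t - g j x t - (1 * φ j x + (t - r) * S.Lop φ j x t)) =
        fun j x => (f j x t - φ j x) - (t - r) * S.Lop φ j x t := by
      funext j x
      rw [g0 j x t ht.1]; ring
    rw [e, Li_sub (y := fun j x => f j x t - φ j x) (z := fun j x => (t - r) * S.Lop φ j x t)
      (fun j => (cfs t j).sub (hφ.c j)) (fun j => continuous_const.mul (cL j)), Li_sub (cfs t) hφ.c]
    have n1 : ‖Li (fun j x => (t - r) * S.Lop φ j x t)‖ ≤ ε1 := by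
      have := Li_bd (z := fun j x => (t - r) * S.Lop φ j x t) (D := h * D)
        (fun j => continuous_const.mul (cL j)) (by positivity) (fun j x _ => by
          rw [abs_mul, abs_of_nonneg (by linarith [ht.1])]
          exact mul_le_mul (by linarith [ht.2]) (hLb j x t) (abs_nonneg _) hh.le)
      nlinarith
    have n2 : ‖Li (fun j x => f j x t) - Li (fun j x => f j x r)‖ ≤ ε1 := by
      rw [← dist_eq_norm]
      refine (hδb t ?_).le
      rw [Real.dist_eq, abs_of_nonneg (by linarith [ht.1])]
      linarith [ht.2]
    have n3 := norm_sub_le_norm_sub_add_norm_sub (Li (fun j x => f j x t)) (Li (fun j x => f j x r)) (Li φ)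
    have n4 := norm_sub_le (Li (fun j x => f j x t) - Li φ) (Li (fun j x => (t - r) * S.Lop φ j x t))
    linarith)
  have split : ∀ t, Li (fun j x => w j x t - z j x t - (t - r) * φ j x) =
      Li (fun j x => w j x t) - Li (fun j x => z j x t) - (t - r) • Li φ := by
    intro t
    rw [← Li_smul hφ.c, ← Li_sub (cws t) (czs t), ← Li_sub (y := fun j x => w j x t - z j x t)
      (z := fun j x => (t - r) * φ j x) (fun j => (cws t j).sub (czs t j))
      (fun j => continuous_const.mul (hφ.c j))]
  rw [split, split, sub_self, zero_smul, sub_zero, add_sub_cancel_left] at hE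
  have hUz := hzU (r + h) (by linarith)
  have n5 : ‖U (r + h) r (Li (fun j x => w j x r) - Li (fun j x => z j x r))‖ ≤ B * (ε1 * h) := by
    refine (hUb r (r + h) (by linarith) _).trans ?_
    refine mul_le_mul ?_ hwz (norm_nonneg _) hB0
    rw [hB, add_sub_cancel_left]
    gcongr
    nlinarith
  have eq : Li (fun j x => w j x (r + h)) - U (r + h) r (Li (fun j x => w j x r)) - h • Li (fun j x => f j x r)
      = (Li (fun j x => w j x (r + h)) - Li (fun j x => z j x (r + h)) - h • Li φ)
        - U (r + h) r (Li (fun j x => w j x r) - Li (fun j x => z j x r))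
        - h • (Li (fun j x => f j x r) - Li φ) := by
    rw [map_sub, hUz, smul_sub]; abel
  rw [eq]
  have n6 : ‖h • (Li (fun j x => f j x r) - Li φ)‖ ≤ h * ε1 := by
    rw [norm_smul, Real.norm_eq_abs, abs_of_pos hh]
    gcongr
  have n7 := norm_sub_le (Li (fun j x => w j x (r + h)) - Li (fun j x => z j x (r + h)) - h • Li φ
        - U (r + h) r (Li (fun j x => w j x r) - Li (fun j x => z j x r)))
        (h • (Li (fun j x => f j x r) - Li φ))
  have n8 := norm_sub_le (Li (fun j x => w j x (r + h)) - Li (fun j x => z j x (r + h)) - h • Li φ)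
        (U (r + h) r (Li (fun j x => w j x r) - Li (fun j x => z j x r)))
  have n9 : K * (‖Li (fun j x => w j x r) - Li (fun j x => z j x r)‖ + h * (3 * ε1)) ≤
      K * (ε1 * h + h * (3 * ε1)) := by gcongr
  rw [← εeqn]
  linarith

lemma U_cont (hU : GeneratedBy n m p a b U) (T : ℝ) {y : ℝ → L2 n} (hy : Continuous y) :
    ContinuousOn (fun r => U T r (y r)) (Iic T) := by
  obtain ⟨KU, ν, hKU, hν, hUb⟩ := U_bd hU
  intro r0 hr0
  have hs : ContinuousOn (fun r => U T r (y r0)) (Iic T) := by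
    have := (hU.2.1 (y r0)).comp (f := fun r : ℝ => (T, r)) (s := Iic T) (by fun_prop) (fun r hr => hr)
    exact this
  have h1 := hs r0 hr0
  rw [ContinuousWithinAt, tendsto_iff_norm_sub_tendsto_zero] at h1 ⊢
  have h2 : Tendsto (fun r => KU * Real.exp (ν * (T - r)) * ‖y r - y r0‖) (nhdsWithin r0 (Iic T)) (nhds 0) := by
    have : Continuous fun r => KU * Real.exp (ν * (T - r)) * ‖y r - y r0‖ := by fun_prop
    have := this.tendsto r0
    simp only [sub_self, norm_zero, mul_zero] at this
    exact this.mono_left nhdsWithin_le_nhds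
  have h3 := h2.add h1
  rw [add_zero] at h3
  refine squeeze_zero' (Eventually.of_forall fun r => norm_nonneg _) ?_ h3
  filter_upwards [self_mem_nhdsWithin] with r hr
  have e : U T r (y r) - U T r0 (y r0) = U T r (y r - y r0) + (U T r (y r0) - U T r0 (y r0)) := by
    rw [map_sub]; abel
  rw [e]
  exact (norm_add_le _ _).trans (add_le_add (hUb r T hr _) le_rfl)

theorem Sys.duhamel (S : Sys n m p a b) (hU : GeneratedBy n m p a b U)
    {f fx w wx wt : Fin n → ℝ → ℝ → ℝ} (hw : CSol m p a b f w wx wt) (cf : ∀ j, C2 (f j))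
    (cfx : ∀ j, C2 (fx j))
    (hfx : ∀ j, ∀ x ∈ Icc (0:ℝ) 1, ∀ t, HasDerivWithinAt (fun y => f j y t) (fx j x t) (Icc 0 1) x)
    {s T : ℝ} (hsT : s ≤ T) :
    ∫ r in s..T, U T r (Li (fun j x => f j x r)) =
      Li (fun j x => w j x T) - U T s (Li (fun j x => w j x s)) := by
  have cfL := Li_cont cf
  have cwL := Li_cont hw.c
  have cF := U_cont hU T cwL
  have cG := U_cont hU T cfL
  have sub : Icc s T ⊆ Iic T := fun r hr => hr.2
  have main := intervalIntegral.integral_eq_sub_of_hasDeriv_right_of_le hsT (cF.mono sub)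
    (f' := fun r => U T r (Li (fun j x => f j x r))) ?_
    ((cG.mono sub).intervalIntegrable_of_Icc hsT)
  · rw [main, hU.1.1 T]; rfl
  intro r hr
  obtain ⟨KU, ν, hKU, hν, hUb⟩ := U_bd hU
  rw [hasDerivWithinAt_iff_isLittleO, Asymptotics.isLittleO_iff]
  intro c hc
  set B := KU * Real.exp (ν * (T - r)) with hB
  have hB1 : 0 < B := by positivity
  obtain ⟨h0, hh0, H⟩ := S.stepD hU hw cf cfx hfx r (show 0 < c / (2 * B) by positivity)
  have hs : ContinuousOn (fun r' => U T r' (Li (fun j x => f j x r))) (Iic T) := U_cont hU T continuous_const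
  have hs' : ContinuousAt (fun r' => U T r' (Li (fun j x => f j x r))) r :=
    (hs r hr.2.le).continuousAt (Iic_mem_nhds hr.2)
  have ev := Metric.continuousAt_iff'.1 hs' (c / 2) (by positivity)
  have ev1 : ∀ᶠ r' in nhds r, r' < r + h0 := gt_mem_nhds (by linarith)
  have ev2 : ∀ᶠ r' in nhds r, r' < T := gt_mem_nhds hr.2
  filter_upwards [self_mem_nhdsWithin, nhdsWithin_le_nhds ev, nhdsWithin_le_nhds ev1,
    nhdsWithin_le_nhds ev2] with r' hr' h1 h2 h3
  have hr' : r < r' := hr'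
  have hh : 0 < r' - r := by linarith
  have h4 := H (r' - r) hh (by linarith)
  rw [add_sub_cancel] at h4
  rw [dist_eq_norm] at h1
  have e1 := hU.1.2 r r' T hr'.le h3.le (Li (fun j x => w j x r))
  have e : U T r' (Li (fun j x => w j x r')) - U T r (Li (fun j x => w j x r)) - (r' - r) • U T r (Li (fun j x => f j x r))
      = U T r' (Li (fun j x => w j x r') - U r' r (Li (fun j x => w j x r)) - (r' - r) • Li (fun j x => f j x r))
        + (r' - r) • (U T r' (Li (fun j x => f j x r)) - U T r (Li (fun j x => f j x r))) := by
    rw [map_sub, map_sub, e1, map_smul, smul_sub]; abel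
  rw [e]
  refine (norm_add_le _ _).trans ?_
  rw [norm_smul, Real.norm_eq_abs, abs_of_pos hh]
  have n1 := hUb r' T h3.le (Li (fun j x => w j x r') - U r' r (Li (fun j x => w j x r)) - (r' - r) • Li (fun j x => f j x r))
  have n2 : KU * Real.exp (ν * (T - r')) ≤ B := by
    rw [hB]; gcongr
  have n3 : KU * Real.exp (ν * (T - r')) * ‖Li (fun j x => w j x r') - U r' r (Li (fun j x => w j x r)) - (r' - r) • Li (fun j x => f j x r)‖
      ≤ B * (c / (2 * B) * (r' - r)) := mul_le_mul n2 h4 (norm_nonneg _) hB1.le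
  have n4 : B * (c / (2 * B) * (r' - r)) = c / 2 * (r' - r) := by field_simp
  have n5 : (r' - r) * ‖U T r' (Li (fun j x => f j x r)) - U T r (Li (fun j x => f j x r))‖ ≤ (r' - r) * (c / 2) := by
    gcongr
  linarith
end

end Part13

section Part14
lemma chi_ex {γ : ℝ} (hγ : 0 < γ) : ∃ M : ℝ, 0 ≤ M ∧ ∃ χ χ1 χ2 : ℝ → ℝ,
    (∀ s, Sc2 γ (M * Real.exp (-(γ * s))) (fun _ t => χ (t - s)) (fun _ _ => 0)
      (fun _ t => χ1 (t - s)) (fun _ t => χ2 (t - s))) ∧ ∀ t, 0 ≤ t → χ t = 1 := by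
  obtain ⟨Θ, Θ1, Θ2, dΘ, dΘ1, cΘ2, Θl, Θr, Θb, Θla, Θra, Θlb, Θrb⟩ := stepfn (show (-1:ℝ) < 0 by norm_num)
  have cΘ : Continuous Θ := continuous_iff_continuousAt.2 fun t => (dΘ t).continuousAt
  have cΘ1 : Continuous Θ1 := continuous_iff_continuousAt.2 fun t => (dΘ1 t).continuousAt
  obtain ⟨M1, hM1, hb1⟩ := cs_bd (g := fun t => Θ1 t * Real.exp (-(γ * t))) (by fun_prop)
    (u := -1) (v := 0) (fun t ht => by simp [Θla t ht]) (fun t ht => by simp [Θra t ht])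
  obtain ⟨M2, hM2, hb2⟩ := cs_bd (g := fun t => Θ2 t * Real.exp (-(γ * t))) (by fun_prop)
    (u := -1) (v := 0) (fun t ht => by simp [Θlb t ht]) (fun t ht => by simp [Θrb t ht])
  have key : ∀ v M t : ℝ, |v * Real.exp (-(γ * t))| ≤ M → |v| ≤ M * Real.exp (γ * t) := by
    intro v M t hv
    rw [abs_mul, abs_of_pos (Real.exp_pos _), Real.exp_neg, ← div_eq_mul_inv, div_le_iff₀ (Real.exp_pos _)] at hv
    exact hv
  have b0 : ∀ t, |Θ t| ≤ Real.exp γ * Real.exp (γ * t) := by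
    intro t
    rcases le_total t (-1) with h | h
    · rw [Θl t h]; simp; positivity
    · refine (Θb t).trans ?_
      rw [← Real.exp_add]
      exact Real.one_le_exp (by nlinarith)
  set M := Real.exp γ + M1 + M2 with hM
  have hM0 : 0 ≤ M := by positivity
  have up : ∀ (v D s t : ℝ), D ≤ M → |v| ≤ D * Real.exp (γ * (t - s)) →
      |v| ≤ M * Real.exp (-(γ * s)) * Real.exp (γ * t) := by
    intro v D s t hD hv
    refine hv.trans ?_
    rw [mul_assoc, ← Real.exp_add]
    have : γ * (t - s) = -(γ * s) + γ * t := by ring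
    rw [this]
    gcongr
  have m0 : Real.exp γ ≤ M := by rw [hM]; linarith
  have m1 : M1 ≤ M := by rw [hM]; linarith [Real.exp_pos γ]
  have m2 : M2 ≤ M := by rw [hM]; linarith [Real.exp_pos γ]
  have sh : ∀ {g g1 : ℝ → ℝ}, (∀ t, HasDerivAt g (g1 t) t) → ∀ s t, HasDerivAt (fun t => g (t - s)) (g1 (t - s)) t := by
    intro g g1 hg s t
    exact ((hg (t - s)).comp t ((hasDerivAt_id t).sub_const s)).congr_deriv (by simp)
  have cs : ∀ {g : ℝ → ℝ}, Continuous g → ∀ s, C2 (fun _ t => g (t - s)) := by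
    intro g hg s
    exact hg.comp (continuous_snd.sub continuous_const)
  refine ⟨M, hM0, Θ, Θ1, Θ2, fun s => ⟨⟨⟨cs cΘ s, cs cΘ1 s, fun _ t => sh dΘ s t, fun x t => up _ _ s t m0 (b0 _),
    fun x t => up _ _ s t m1 (key _ _ _ (hb1 _))⟩, continuous_const, fun x _ t => hasDerivWithinAt_const _ _ _,
    fun x t => ?_⟩, ⟨cs cΘ1 s, cs cΘ2 s, fun _ t => sh dΘ1 s t,
    fun x t => up _ _ s t m1 (key _ _ _ (hb1 _)), fun x t => up _ _ s t m2 (key _ _ _ (hb2 _))⟩⟩, Θr⟩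
  rw [abs_zero]; positivity

section
variable {n m : ℕ} {p : Fin n → Fin n → ℝ} {a : ℝ → ℝ → Fin n → ℝ} {b : ℝ → ℝ → Fin n → Fin n → ℝ}
  {U : ℝ → ℝ → L2 n →L[ℝ] L2 n}

theorem Sys.main_core (S : Sys n m p a b) (hU : GeneratedBy n m p a b U) (d : ℝ) :
    ∃ A : ℝ, 0 ≤ A ∧ ∀ (s Cf : ℝ) (F Fx Ft : Fin n → ℝ → ℝ → ℝ), 0 ≤ Cf →
      (∀ j, Sc1 0 Cf (F j) (Fx j) (Ft j)) →
      ∃ w wx : Fin n → ℝ → ℝ → ℝ, (∀ j, C2 (w j)) ∧ (∀ j, C2 (wx j)) ∧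
        (∀ j, ∀ x ∈ Icc (0:ℝ) 1, ∀ t, HasDerivWithinAt (fun y => w j y t) (wx j x t) (Icc 0 1) x) ∧
        (∀ j, ∀ x ∈ Icc (0:ℝ) 1, ∀ t, t ≤ s + 3 * d → |w j x t| ≤ A * Cf ∧ |wx j x t| ≤ A * Cf) ∧
        (∀ T, s ≤ T → ∫ r in s..T, U T r (Li (fun j x => F j x r)) =
          Li (fun j x => w j x T) - U T s (Li (fun j x => w j x s))) ∧
        (∀ Ftt : Fin n → ℝ → ℝ → ℝ, (∀ j, Sc2 0 Cf (F j) (Fx j) (Ft j) (Ftt j)) →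
          ∃ wxx : Fin n → ℝ → ℝ → ℝ, (∀ j, C2 (wxx j)) ∧
            ∀ j, ∀ x ∈ Icc (0:ℝ) 1, ∀ t, HasDerivWithinAt (fun y => wx j y t) (wxx j x t) (Icc 0 1) x ∧
              (t ≤ s + 3 * d → |wxx j x t| ≤ A * Cf)) := by
  obtain ⟨γ, hγ, Hγ⟩ := S.exist
  obtain ⟨K, hK, HX⟩ := Hγ γ le_rfl
  obtain ⟨M, hM, χ, χ1, χ2, hχ, χr⟩ := chi_ex hγ
  refine ⟨K * (4 * M) * Real.exp (γ * (3 * d)), by positivity, fun s Cf F Fx Ft hCf hF => ?_⟩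
  set N := 4 * (M * Real.exp (-(γ * s)) * Cf) with hN
  have hN0 : 0 ≤ N := by positivity
  have bd : ∀ t, t ≤ s + 3 * d → K * N * Real.exp (γ * t) ≤ K * (4 * M) * Real.exp (γ * (3 * d)) * Cf := by
    intro t ht
    have e : K * N * Real.exp (γ * t) = K * (4 * M) * Cf * (Real.exp (-(γ * s)) * Real.exp (γ * t)) := by
      rw [hN]; ring
    rw [e, ← Real.exp_add]
    have : Real.exp (-(γ * s) + γ * t) ≤ Real.exp (γ * (3 * d)) := by
      apply Real.exp_le_exp.2; nlinarith
    calc _ ≤ K * (4 * M) * Cf * Real.exp (γ * (3 * d)) := by gcongr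
      _ = _ := by ring
  have hP : ∀ j, Sc1 γ N (fun x t => χ (t - s) * F j x t)
      (fun x t => 0 * F j x t + χ (t - s) * Fx j x t) (fun x t => χ1 (t - s) * F j x t + χ (t - s) * Ft j x t) := by
    intro j
    have := (hχ s).s.mul (hF j)
    rw [add_zero] at this
    refine this.mono ?_
    have : 0 ≤ M * Real.exp (-(γ * s)) * Cf := by positivity
    rw [hN]; linarith
  obtain ⟨W, Wt, hW, hWb, -, hW2⟩ := HX N (fun j x t => χ (t - s) * F j x t) _ hN0 (fun j => (hP j).r)
  refine ⟨W, _, hW.c, hW.cx, hW.dx, fun j x hx t ht => ⟨(hWb j x hx t).1.trans (bd t ht),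
    (hWb j x hx t).2.2.trans (bd t ht)⟩, fun T hT => ?_, fun Ftt hF2 => ?_⟩
  · rw [← S.duhamel hU hW (fun j => (hP j).r.c) (fun j => (hP j).cx) (fun j => (hP j).dx) hT]
    refine intervalIntegral.integral_congr fun r hr => ?_
    rw [uIcc_of_le hT] at hr
    have e : χ (r - s) = 1 := χr _ (by linarith [hr.1])
    simp only [e, one_mul]
  · obtain ⟨Wxx, c, h⟩ := hW2 (fun j x t => 0 * F j x t + χ (t - s) * Fx j x t) _ (fun j => by
      have := (hχ s).mul (hF2 j)
      rw [add_zero] at this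
      exact this)
    exact ⟨Wxx, c, fun j x hx t => ⟨(h j x hx t).1, fun ht => (h j x hx t).2.trans (bd t ht)⟩⟩

lemma vec_bd {z : Fin n → ℝ → ℝ} {x D : ℝ} (hD : 0 ≤ D) (h : ∀ j, |z j x| ≤ D) : ‖vec z x‖ ≤ n * D := by
  refine le_of_sq_le_sq ?_ (by positivity)
  rw [vec_sq]
  calc ∑ j, z j x ^ 2 ≤ ∑ j : Fin n, D ^ 2 := Finset.sum_le_sum fun j _ => by
        rw [← sq_abs]; exact pow_le_pow_left₀ (abs_nonneg _) (h j) 2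
    _ = n * D ^ 2 := by simp
    _ ≤ (n * D) ^ 2 := by
      rw [mul_pow]
      have : (n:ℝ) ≤ (n:ℝ) ^ 2 := by exact_mod_cast Nat.le_self_pow (by norm_num) n
      gcongr

lemma fh_eq {f : ℝ → ℝ → Fin n → ℝ} {fh : ℝ → L2 n} (hfh : ∀ r : ℝ, ∀ᵐ x ∂μ01, (fh r) x = fun j => f x r j)
    (hc : ∀ j, C2 (fun x t => f (cl x) t j)) (r : ℝ) : fh r = Li (fun j x => f (cl x) r j) := by
  apply Li_eq fun j => (hc j).slice r
  filter_upwards [hfh r, ae_of_Icc (P := fun x => cl x = x) (fun x hx => cl_of hx)] with x h1 h2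
  have : (fh r) x = WithLp.toLp 2 (((fh r) x).ofLp) := rfl
  rw [this, h1]
  simp only [vec, h2]

lemma split_ae {V y : L2 n} {z : Fin n → ℝ → ℝ} (hz : ∀ j, Continuous (z j)) {g : ℝ → Vn n}
    (h : V = Li z + y) (hy : ∀ᵐ x ∂μ01, y x = g x) : ∀ᵐ x ∂μ01, V x = vec z x + g x := by
  rw [h]
  filter_upwards [Lp.coeFn_add (Li z) y, Li_ae hz, hy] with x h1 h2 h3
  rw [h1, Pi.add_apply, h2, h3]
end


end Part14

/- STATEMENT 9: smoothing estimates for the mild solution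
`u(t) = U(t,s)φ + ∫ₛᵗ U(t,r) f(·,r) dr` of the nonhomogeneous problem. -/
theorem stmt_9 (n m : ℕ) (hn : 1 ≤ n) (hmn : m ≤ n)
    (p : Fin n → Fin n → ℝ) (hH3 : H3cond n p)
    (a : ℝ → ℝ → Fin n → ℝ) (b : ℝ → ℝ → Fin n → Fin n → ℝ)
    (hab : ∃ C : ℝ, ∀ j : Fin n, BCle 2 (fun x t => a x t j) C ∧
      ∀ k : Fin n, BCle 2 (fun x t => b x t j k) C)
    (Λ₀ : ℝ) (hΛ₀ : 0 < Λ₀) (hLam : LamCond n m Λ₀ a)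
    (U : ℝ → ℝ → L2 n →L[ℝ] L2 n) (hU : GeneratedBy n m p a b U)
    (d : ℝ) (hd : 0 < d)
    -- `d` is a smoothing time constant: `U(t,s)` maps `L²` boundedly into
    -- `C¹([0,1];ℝⁿ)` for `t ≥ s + 2d` ...
    (hsm1 : ∃ C : ℝ, ∀ s t : ℝ, s + 2 * d ≤ t → ∀ φ : L2 n,
      ∃ g g' : ℝ → Vn n,
        ContinuousOn g (Set.Icc 0 1) ∧ ContinuousOn g' (Set.Icc 0 1) ∧
        (∀ x ∈ Set.Icc (0:ℝ) 1, ∀ j : Fin n,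
          HasDerivWithinAt (fun y => g y j) (g' x j) (Set.Icc 0 1) x) ∧
        (∀ x ∈ Set.Icc (0:ℝ) 1, ‖g x‖ + ‖g' x‖ ≤ C * ‖φ‖) ∧
        (∀ᵐ x ∂μ01, (U t s φ) x = g x))
    -- ... and into `C²([0,1];ℝⁿ)` for `t ≥ s + 3d`, uniformly in `s`
    (hsm2 : ∃ C : ℝ, ∀ s t : ℝ, s + 3 * d ≤ t → ∀ φ : L2 n,
      ∃ g g' g'' : ℝ → Vn n,
        ContinuousOn g (Set.Icc 0 1) ∧ ContinuousOn g' (Set.Icc 0 1) ∧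
        ContinuousOn g'' (Set.Icc 0 1) ∧
        (∀ x ∈ Set.Icc (0:ℝ) 1, ∀ j : Fin n,
          HasDerivWithinAt (fun y => g y j) (g' x j) (Set.Icc 0 1) x ∧
          HasDerivWithinAt (fun y => g' y j) (g'' x j) (Set.Icc 0 1) x) ∧
        (∀ x ∈ Set.Icc (0:ℝ) 1, ‖g x‖ + ‖g' x‖ + ‖g'' x‖ ≤ C * ‖φ‖) ∧
        (∀ᵐ x ∂μ01, (U t s φ) x = g x)) :
    ∃ L : ℝ, 0 < L ∧
      ∀ s : ℝ, ∀ φ : L2 n, ∀ f : ℝ → ℝ → Fin n → ℝ, ∀ fh : ℝ → L2 n,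
        -- `fh r` is the `L²`-class of `f(·,r)`
        (∀ r : ℝ, ∀ᵐ x ∂μ01, (fh r) x = fun j => f x r j) →
        -- the mild solution
        ∀ u : ℝ → L2 n,
        (∀ t : ℝ, u t = U t s φ + ∫ r in s..t, (U t r) (fh r)) →
        -- (i) `f ∈ BC¹` implies the `C¹`-smoothing estimate on `[s+2d, s+3d]`
        ((∀ j : Fin n, ContDiffOn ℝ 1 (fun q : ℝ × ℝ => f q.1 q.2 j) strip) →
          ∀ Cf : ℝ,
          (∀ j : Fin n, ∀ i : ℕ, i ≤ 1 → ∀ q ∈ strip,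
            ‖iteratedFDerivWithin ℝ i (fun q : ℝ × ℝ => f q.1 q.2 j) strip q‖ ≤ Cf) →
          ∀ t : ℝ, s + 2 * d ≤ t → t ≤ s + 3 * d →
            ∃ g g' : ℝ → Vn n,
              ContinuousOn g (Set.Icc 0 1) ∧ ContinuousOn g' (Set.Icc 0 1) ∧
              (∀ x ∈ Set.Icc (0:ℝ) 1, ∀ j : Fin n,
                HasDerivWithinAt (fun y => g y j) (g' x j) (Set.Icc 0 1) x) ∧
              (∀ᵐ x ∂μ01, (u t) x = g x) ∧
              (∀ x ∈ Set.Icc (0:ℝ) 1, ‖g x‖ + ‖g' x‖ ≤ L * (‖φ‖ + Cf))) ∧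
        -- (ii) `f ∈ BC²` implies the `C²`-smoothing estimate at `t = s + 3d`
        ((∀ j : Fin n, ContDiffOn ℝ 2 (fun q : ℝ × ℝ => f q.1 q.2 j) strip) →
          ∀ Cf : ℝ,
          (∀ j : Fin n, ∀ i : ℕ, i ≤ 2 → ∀ q ∈ strip,
            ‖iteratedFDerivWithin ℝ i (fun q : ℝ × ℝ => f q.1 q.2 j) strip q‖ ≤ Cf) →
          ∃ g g' g'' : ℝ → Vn n,
            ContinuousOn g (Set.Icc 0 1) ∧ ContinuousOn g' (Set.Icc 0 1) ∧
            ContinuousOn g'' (Set.Icc 0 1) ∧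
            (∀ x ∈ Set.Icc (0:ℝ) 1, ∀ j : Fin n,
              HasDerivWithinAt (fun y => g y j) (g' x j) (Set.Icc 0 1) x ∧
              HasDerivWithinAt (fun y => g' y j) (g'' x j) (Set.Icc 0 1) x) ∧
            (∀ᵐ x ∂μ01, (u (s + 3 * d)) x = g x) ∧
            (∀ x ∈ Set.Icc (0:ℝ) 1, ‖g x‖ + ‖g' x‖ + ‖g'' x‖ ≤ L * (‖φ‖ + Cf))) := by
  obtain ⟨S⟩ := Sys.exists_sys (m := m) (p := p) hab hΛ₀ hLam
  obtain ⟨A, hA, HA⟩ := S.main_core hU d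
  obtain ⟨C1, h1⟩ := hsm1
  obtain ⟨C2', h2⟩ := hsm2
  have hnA : 0 ≤ n * A := by positivity
  set B := |C1| + |C2'| with hB
  have hB0 : 0 ≤ B := by positivity
  refine ⟨3 * (n * A) + B * (1 + n * A) + 1, by positivity, ?_⟩
  intro s φ f fh hfh u hu
  have j0 : Fin n := ⟨0, hn⟩
  have fin : ∀ (X N Cf C : ℝ) (y : L2 n), 0 ≤ Cf → |C| ≤ B → N ≤ 3 * (n * (A * Cf)) → ‖y‖ ≤ n * (A * Cf) → X ≤ C * ‖φ - y‖ →
      N + X ≤ (3 * (n * A) + B * (1 + n * A) + 1) * (‖φ‖ + Cf) := by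
    intro X N Cf C y hCf hC hN hy hX
    have e1 : C * ‖φ - y‖ ≤ B * (‖φ‖ + n * (A * Cf)) := by
      refine mul_le_mul ((le_abs_self C).trans hC) ((norm_sub_le _ _).trans (by linarith)) (norm_nonneg _) hB0
    have p0 := norm_nonneg φ
    have p1 : 0 ≤ n * A * ‖φ‖ := by positivity
    have p2 : 0 ≤ B * (n * A * ‖φ‖) := by positivity
    have p3 : 0 ≤ B * Cf := by positivity
    nlinarith
  constructor
  · intro hf Cf hCf t ht1 ht2
    have hCf0 : 0 ≤ Cf := (norm_nonneg _).trans (hCf j0 0 (by norm_num) (0, 0) ⟨by simp, mem_univ _⟩)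
    have hE : ∀ j : Fin n, ∃ gx gt, Sc1 0 Cf (fun x t => f (cl x) t j) gx gt := fun j =>
      BCle.ext1 (g := fun x t => f x t j) ⟨by exact_mod_cast hf j, hCf j⟩
    choose Fx Ft hF using hE
    obtain ⟨w, wx, cw, cwx, dw, bw, du, -⟩ := HA s Cf (fun j x t => f (cl x) t j) Fx Ft hCf0 hF
    obtain ⟨g, g', cg, cg', dg, bg, ag⟩ := h1 s t ht1 (φ - Li (fun j x => w j x s))
    have cs : ∀ t j, Continuous fun x => w j x t := fun t j => (cw j).slice t
    have csx : ∀ t j, Continuous fun x => wx j x t := fun t j => (cwx j).slice t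
    have hst : s ≤ t := by linarith
    refine ⟨fun x => vec (fun j x => w j x t) x + g x, fun x => vec (fun j x => wx j x t) x + g' x,
      (vec_cont (cs t)).continuousOn.add cg, (vec_cont (csx t)).continuousOn.add cg',
      fun x hx j => (dw j x hx t).add (dg x hx j), split_ae (cs t) ?_ ag, fun x hx => ?_⟩
    · rw [hu t, map_sub]
      have : (∫ r in s..t, (U t r) (fh r)) = ∫ r in s..t, (U t r) (Li (fun j x => f (cl x) r j)) :=
        intervalIntegral.integral_congr fun r _ => by
          simp only [fh_eq hfh (fun j => (hF j).r.c) r]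
      rw [this, du t hst]
      abel
    · have n1 := norm_add_le (vec (fun j x => w j x t) x) (g x)
      have n2 := norm_add_le (vec (fun j x => wx j x t) x) (g' x)
      have n3 := vec_bd (z := fun j x => w j x t) (x := x) (by positivity) (fun j => (bw j x hx t ht2).1)
      have n4 := vec_bd (z := fun j x => wx j x t) (x := x) (by positivity) (fun j => (bw j x hx t ht2).2)
      have n5 := Sys.Li_bd (cs s) (by positivity) (fun j x hx => (bw j x hx s (by linarith)).1)
      have n6 : 0 ≤ n * (A * Cf) := by positivity
      have := fin (‖g x‖ + ‖g' x‖) (2 * (n * (A * Cf))) Cf C1 _ hCf0 (by rw [hB]; linarith [abs_nonneg C2']) (by linarith) n5 (bg x hx)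
      linarith
  · intro hf Cf hCf
    have hCf0 : 0 ≤ Cf := (norm_nonneg _).trans (hCf j0 0 (by norm_num) (0, 0) ⟨by simp, mem_univ _⟩)
    have hE : ∀ j : Fin n, ∃ gx gt gtt, Sc2 0 Cf (fun x t => f (cl x) t j) gx gt gtt := fun j =>
      BCle.ext2 (g := fun x t => f x t j) ⟨by exact_mod_cast hf j, hCf j⟩
    choose Fx Ft Ftt hF using hE
    obtain ⟨w, wx, cw, cwx, dw, bw, du, hxx⟩ := HA s Cf (fun j x t => f (cl x) t j) Fx Ft hCf0 (fun j => (hF j).s)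
    obtain ⟨wxx, cwxx, bwxx⟩ := hxx Ftt hF
    set t := s + 3 * d with ht
    obtain ⟨g, g', g'', cg, cg', cg'', dg, bg, ag⟩ := h2 s t le_rfl (φ - Li (fun j x => w j x s))
    have cs : ∀ t j, Continuous fun x => w j x t := fun t j => (cw j).slice t
    have csx : ∀ t j, Continuous fun x => wx j x t := fun t j => (cwx j).slice t
    have csxx : ∀ t j, Continuous fun x => wxx j x t := fun t j => (cwxx j).slice t
    have hst : s ≤ t := by linarith
    refine ⟨fun x => vec (fun j x => w j x t) x + g x, fun x => vec (fun j x => wx j x t) x + g' x,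
      fun x => vec (fun j x => wxx j x t) x + g'' x,
      (vec_cont (cs t)).continuousOn.add cg, (vec_cont (csx t)).continuousOn.add cg',
      (vec_cont (csxx t)).continuousOn.add cg'',
      fun x hx j => ⟨(dw j x hx t).add (dg x hx j).1, (bwxx j x hx t).1.add (dg x hx j).2⟩,
      split_ae (cs t) ?_ ag, fun x hx => ?_⟩
    · rw [hu t, map_sub]
      have : (∫ r in s..t, (U t r) (fh r)) = ∫ r in s..t, (U t r) (Li (fun j x => f (cl x) r j)) :=
        intervalIntegral.integral_congr fun r _ => by
          simp only [fh_eq hfh (fun j => (hF j).s.r.c) r]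
      rw [this, du t hst]
      abel
    · have n1 := norm_add_le (vec (fun j x => w j x t) x) (g x)
      have n2 := norm_add_le (vec (fun j x => wx j x t) x) (g' x)
      have n2' := norm_add_le (vec (fun j x => wxx j x t) x) (g'' x)
      have n3 := vec_bd (z := fun j x => w j x t) (x := x) (by positivity) (fun j => (bw j x hx t le_rfl).1)
      have n4 := vec_bd (z := fun j x => wx j x t) (x := x) (by positivity) (fun j => (bw j x hx t le_rfl).2)
      have n4' := vec_bd (z := fun j x => wxx j x t) (x := x) (by positivity) (fun j => (bwxx j x hx t).2 le_rfl)
      have n5 := Sys.Li_bd (cs s) (by positivity) (fun j x hx => (bw j x hx s (by linarith)).1)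
      have n6 : 0 ≤ n * (A * Cf) := by positivity
      have := fin (‖g x‖ + ‖g' x‖ + ‖g'' x‖) (3 * (n * (A * Cf))) Cf C2' _ hCf0 (by rw [hB]; linarith [abs_nonneg C1]) (by linarith) n5 (bg x hx)
      linarith
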